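/- arXiv:2509.06935 — 2 statements merged into one kernel-verified Lean document; each statement's English description precedes it below -/
import Mathlib

section
/- Let d, k, r be positive integers with k < d and r ≥ k + 2, and let A(n,d,k,r) denote the number of ordered r-tuples of points of [n]^d all of whose entries lie in a common affine subspace of ℝ^d of dimension at most k. Define a_{d,k,r}(n) = n^{d + k·max{r−1, d}} if r − 1 ≠ d, and a_{d,k,r}(n) = n^{d(k+1)} · log n if r − 1 = d. Then there exist constants c_1, c_2 > 0 and N ∈ ℕ such that c_1 · a_{d,k,r}(n) ≤ A(n,d,k,r) ≤ c_2 · a_{d,k,r}(n) for all n ≥ N. -/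
/-- The grid `[n]^d`: points of `ℝ^d` with all coordinates integers in `{1, …, n}`. -/
def grid (d n : ℕ) : Set (EuclideanSpace ℝ (Fin d)) :=
  {x | ∀ i, ∃ m : ℕ, 1 ≤ m ∧ m ≤ n ∧ x i = (m : ℝ)}

/-- `A(n,d,k,r)`: the number of ordered `r`-tuples of points of `[n]^d` all of whose entries
lie in a common affine subspace of `ℝ^d` of dimension at most `k`. -/
noncomputable def affDegCount (n d k r : ℕ) : ℕ :=
  {t : Fin r → EuclideanSpace ℝ (Fin d) | (∀ i, t i ∈ grid d n) ∧
    ∃ A : AffineSubspace ℝ (EuclideanSpace ℝ (Fin d)),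
      Module.finrank ℝ A.direction ≤ k ∧ ∀ i, t i ∈ A}.ncard

/-- The function `a_{d,k,r}(n)` from Proposition 1.9. -/
noncomputable def adkr (d k r n : ℕ) : ℝ :=
  if r - 1 ≠ d then (n : ℝ) ^ (d + k * max (r - 1) d)
  else (n : ℝ) ^ (d * (k + 1)) * Real.log n

namespace AffDeg
open Finset

/-- Sup norm of an integer vector, as a natural number. -/
def nrm {d : ℕ} (x : Fin d → ℤ) : ℕ := Finset.univ.sup fun i => (x i).natAbs
/-- Cast of an integer vector to a real vector. -/
def cst {d : ℕ} (x : Fin d → ℤ) : Fin d → ℝ := fun i => (x i : ℝ)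
/-- Real span of the first `j` vectors. -/
def sp {d : ℕ} (b : ℕ → Fin d → ℤ) (j : ℕ) : Submodule ℝ (Fin d → ℝ) :=
  Submodule.span ℝ ((fun i => cst (b i)) '' Set.Iio j)

variable {d : ℕ}

lemma cst_add (x y : Fin d → ℤ) : cst (x + y) = cst x + cst y := by
  ext i; simp [cst]
lemma cst_sub (x y : Fin d → ℤ) : cst (x - y) = cst x - cst y := by
  ext i; simp [cst]
lemma cst_smul (a : ℤ) (x : Fin d → ℤ) : cst (a • x) = (a : ℝ) • cst x := by
  ext i; simp [cst]
lemma cst_nsmul (a : ℕ) (x : Fin d → ℤ) : cst (a • x) = (a : ℝ) • cst x := by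
  ext i; simp [cst]
lemma cst_zero : cst (0 : Fin d → ℤ) = 0 := by
  ext i; simp [cst]
lemma cst_sum {ι : Type*} (s : Finset ι) (f : ι → Fin d → ℤ) :
    cst (∑ i ∈ s, f i) = ∑ i ∈ s, cst (f i) := by
  ext i; simp [cst, Finset.sum_apply]
lemma cst_inj {x y : Fin d → ℤ} (h : cst x = cst y) : x = y := by
  ext i
  have := congrFun h i
  simpa [cst] using this

lemma nrm_le {x : Fin d → ℤ} {n : ℕ} : nrm x ≤ n ↔ ∀ i, (x i).natAbs ≤ n := by
  simp [nrm, Finset.sup_le_iff]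
lemma le_nrm (x : Fin d → ℤ) (i : Fin d) : (x i).natAbs ≤ nrm x := nrm_le.1 le_rfl i
lemma nrm_sub_le (x y : Fin d → ℤ) : nrm (x - y) ≤ nrm x + nrm y := by
  rw [nrm_le]; intro i
  have h1 := le_nrm x i
  have h2 := le_nrm y i
  simp only [Pi.sub_apply]; omega
lemma nrm_add_le (x y : Fin d → ℤ) : nrm (x + y) ≤ nrm x + nrm y := by
  rw [nrm_le]; intro i
  have h1 := le_nrm x i
  have h2 := le_nrm y i
  simp only [Pi.add_apply]; omega
lemma nrm_smul_le (a : ℤ) (x : Fin d → ℤ) : nrm (a • x) ≤ a.natAbs * nrm x := by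
  rw [nrm_le]; intro i
  simp only [Pi.smul_apply, smul_eq_mul, Int.natAbs_mul]
  exact Nat.mul_le_mul_left _ (le_nrm x i)
lemma nrm_nsmul (a : ℕ) (x : Fin d → ℤ) : a * nrm x ≤ nrm (a • x) := by
  rcases Nat.eq_zero_or_pos d with h | h
  · subst h; simp [nrm]
  · obtain ⟨i, -, hi⟩ := Finset.exists_mem_eq_sup (univ : Finset (Fin d)) ⟨⟨0, h⟩, mem_univ _⟩
      (fun i => (x i).natAbs)
    have h2 := le_nrm (a • x) i
    simp only [Pi.smul_apply, nsmul_eq_mul, Int.natAbs_mul, Int.natAbs_natCast] at h2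
    unfold nrm at *
    rw [hi]; exact h2
lemma nrm_sum_le {ι : Type*} (s : Finset ι) (f : ι → Fin d → ℤ) :
    nrm (∑ i ∈ s, f i) ≤ ∑ i ∈ s, nrm (f i) := by
  classical
  induction s using Finset.induction_on with
  | empty => simp [nrm]
  | insert a s ha ih =>
    rw [sum_insert ha, sum_insert ha]
    exact (nrm_add_le _ _).trans (by omega)
lemma nrm_pos {x : Fin d → ℤ} (h : x ≠ 0) : 1 ≤ nrm x := by
  by_contra hc
  apply h
  ext i
  have := le_nrm x i
  simp; omega

lemma sp_zero (b : ℕ → Fin d → ℤ) : sp b 0 = ⊥ := by simp [sp]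
lemma sp_succ (b : ℕ → Fin d → ℤ) (j : ℕ) :
    sp b (j + 1) = Submodule.span ℝ {cst (b j)} ⊔ sp b j := by
  have : Set.Iio (j + 1) = insert j (Set.Iio j) := by ext; simp
  rw [sp, this, Set.image_insert_eq, Submodule.span_insert]; rfl
lemma sp_mono (b : ℕ → Fin d → ℤ) {i j : ℕ} (h : i ≤ j) : sp b i ≤ sp b j :=
  Submodule.span_mono (Set.image_mono (Set.Iio_subset_Iio h))
lemma mem_sp (b : ℕ → Fin d → ℤ) {i j : ℕ} (h : i < j) : cst (b i) ∈ sp b j :=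
  Submodule.subset_span ⟨i, h, rfl⟩
lemma sp_congr {b b' : ℕ → Fin d → ℤ} {j : ℕ} (h : ∀ i < j, b i = b' i) : sp b j = sp b' j := by
  unfold sp
  congr 1
  apply Set.image_congr
  intro i hi
  rw [h i hi]

lemma exists_functional (b : ℕ → Fin d → ℤ) (j : ℕ) (h : cst (b j) ∉ sp b j) :
    ∃ l : Fin d → ℤ, (∀ i < j, l ⬝ᵥ b i = 0) ∧ l ⬝ᵥ b j ≠ 0 := by
  let q : (Fin d → ℤ) → (Fin d → ℚ) := fun x i => (x i : ℚ)
  let W : Submodule ℚ (Fin d → ℚ) := Submodule.span ℚ ((fun i => q (b i)) '' Set.Iio j)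
  have hW : q (b j) ∉ W := by
    intro hm
    apply h
    let T : (Fin d → ℚ) →ₗ[ℚ] (Fin d → ℝ) :=
      { toFun := fun x i => (x i : ℝ)
        map_add' := by intro x y; ext i; simp
        map_smul' := by intro a x; ext i; simp [Rat.smul_def] }
    have hT : ∀ x, T (q x) = cst x := by intro x; ext i; simp [T, q, cst]
    have : W ≤ ((sp b j).restrictScalars ℚ).comap T := by
      apply Submodule.span_le.2
      rintro _ ⟨i, hi, rfl⟩
      simp only [SetLike.mem_coe, Submodule.mem_comap, hT, Submodule.restrictScalars_mem]
      exact mem_sp b hi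
    have := this hm
    simpa only [Submodule.mem_comap, hT, Submodule.restrictScalars_mem] using this
  obtain ⟨f, hf1, hf2⟩ := Submodule.exists_le_ker_of_notMem hW
  let c : Fin d → ℚ := fun i => f (Pi.single i 1)
  have hfc : ∀ x, f x = ∑ i, c i * x i := by
    intro x
    conv_lhs => rw [← Finset.univ_sum_single x]
    rw [map_sum]
    apply sum_congr rfl
    intro i _
    have : Pi.single i (x i) = x i • (Pi.single i (1:ℚ) : Fin d → ℚ) := by
      rw [← Pi.single_smul]; simp
    rw [this, map_smul]; simp [c, mul_comm]
  let D : ℕ := ∏ i, (c i).den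
  have hD : D ≠ 0 := Finset.prod_ne_zero_iff.2 fun i _ => (c i).den_nz
  have hz : ∀ i, ∃ z : ℤ, (z : ℚ) = D * c i := by
    intro i
    obtain ⟨e, he⟩ : (c i).den ∣ D := Finset.dvd_prod_of_mem _ (mem_univ i)
    refine ⟨(c i).num * e, ?_⟩
    have h1 : (c i) * (c i).den = (c i).num := Rat.mul_den_eq_num (c i)
    rw [he]; push_cast; rw [← h1]; ring
  choose l hl using hz
  have key : ∀ x : Fin d → ℤ, ((l ⬝ᵥ x : ℤ) : ℚ) = D * f (q x) := by
    intro x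
    rw [hfc, mul_sum]
    simp only [dotProduct]
    push_cast
    apply sum_congr rfl
    intro i _
    rw [hl]; simp [q]; ring
  refine ⟨l, ?_, ?_⟩
  · intro i hi
    have h0 : f (q (b i)) = 0 := hf2 (Submodule.subset_span ⟨i, hi, rfl⟩)
    have := key (b i)
    rw [h0, mul_zero] at this
    exact_mod_cast this
  · intro h0
    have := key (b j)
    rw [h0] at this
    simp at this
    rcases this with h | h
    · exact hD h
    · exact hf1 h

lemma code (b : ℕ → Fin d → ℤ) (N : ℕ → ℕ) (k : ℕ) (hb : ∀ j < k, cst (b j) ∉ sp b j)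
    (hN : ∀ j < k, 0 < N j) (hdiv : ∀ i j, i ≤ j → j < k → N j ∣ N i) :
    ∃ ψ : (Fin d → ℤ) → ℕ, (∀ x, ψ x < ∏ i ∈ range k, N i) ∧
      ∀ x y, cst x ∈ sp b k → cst y ∈ sp b k → ψ x = ψ y → x = y ∨
        ∃ j < k, ∃ g, cst g ∈ sp b (j + 1) ∧ cst g ∉ sp b j ∧ x - y = N j • g := by
  induction k with
  | zero =>
    refine ⟨fun _ => 0, by simp, ?_⟩
    intro x y hx hy _
    left
    rw [sp_zero, Submodule.mem_bot] at hx hy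
    exact cst_inj (hx.trans hy.symm)
  | succ k ih =>
    obtain ⟨ψ, h1, h2⟩ := ih (fun j hj => hb j (by omega)) (fun j hj => hN j (by omega))
      (fun i j hij hj => hdiv i j hij (by omega))
    obtain ⟨l, hl1, hl2⟩ := exists_functional b k (hb k (by omega))
    let L : (Fin d → ℝ) →ₗ[ℝ] ℝ := ∑ i, (l i : ℝ) • LinearMap.proj i
    have hL : ∀ x, L (cst x) = ((l ⬝ᵥ x : ℤ) : ℝ) := by
      intro x; simp [L, cst, dotProduct]
    have hL0 : ∀ v ∈ sp b k, L v = 0 := by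
      intro v hv
      have : sp b k ≤ LinearMap.ker L := by
        apply Submodule.span_le.2
        rintro _ ⟨i, hi, rfl⟩
        simp [hL, hl1 i hi]
      exact this hv
    have hker : ∀ x, cst x ∈ sp b (k + 1) → l ⬝ᵥ x = 0 → cst x ∈ sp b k := by
      intro x hx h0
      rw [sp_succ, Submodule.mem_sup] at hx
      obtain ⟨u, hu, w, hw, huw⟩ := hx
      obtain ⟨r, rfl⟩ := Submodule.mem_span_singleton.1 hu
      have h3 := hL x
      rw [← huw, map_add, map_smul, hL0 w hw, hL, h0] at h3
      have h4 : ((l ⬝ᵥ b k : ℤ) : ℝ) ≠ 0 := by exact_mod_cast hl2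
      have h5 : r = 0 := by
        simpa [h4] using h3
      rw [← huw, h5]; simpa using hw
    let H : AddSubgroup ℤ :=
      { carrier := {z | ∃ x, cst x ∈ sp b (k + 1) ∧ l ⬝ᵥ x = z}
        zero_mem' := ⟨0, by rw [cst_zero]; exact Submodule.zero_mem _, by simp⟩
        add_mem' := by
          rintro _ _ ⟨x, hx, rfl⟩ ⟨y, hy, rfl⟩
          exact ⟨x + y, by rw [cst_add]; exact Submodule.add_mem _ hx hy, by simp [dotProduct_add]⟩
        neg_mem' := by
          rintro _ ⟨x, hx, rfl⟩
          refine ⟨(-1 : ℤ) • x, by rw [cst_smul]; exact Submodule.smul_mem _ _ hx, by simp⟩ }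
    obtain ⟨a, ha⟩ := Int.subgroup_cyclic H
    have hH : ∀ x, cst x ∈ sp b (k + 1) → a ∣ l ⬝ᵥ x := by
      intro x hx
      have : l ⬝ᵥ x ∈ H := ⟨x, hx, rfl⟩
      rw [ha, AddSubgroup.mem_closure_singleton] at this
      obtain ⟨n, hn⟩ := this
      exact ⟨n, by rw [← hn]; simp [mul_comm]⟩
    have ha0 : a ≠ 0 := by
      rintro rfl
      have := hH (b k) (mem_sp b (by omega))
      exact hl2 (by simpa using this)
    obtain ⟨e, he, hea⟩ : a ∈ H := by
      rw [ha]; exact AddSubgroup.subset_closure rfl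
    have heN : cst e ∉ sp b k := by
      intro hh
      have := hL0 _ hh
      rw [hL, hea] at this
      exact ha0 (by exact_mod_cast this)
    let Q : (Fin d → ℤ) → ℤ := fun x => (l ⬝ᵥ x) / a
    have hQ : ∀ x, cst x ∈ sp b (k + 1) → cst (x - Q x • e) ∈ sp b k := by
      intro x hx
      apply hker
      · rw [cst_sub, cst_smul]; exact Submodule.sub_mem _ hx (Submodule.smul_mem _ _ he)
      · rw [dotProduct_sub, dotProduct_smul, hea, smul_eq_mul, Int.ediv_mul_cancel (hH x hx), sub_self]
    have hNk := hN k (by omega)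
    refine ⟨fun x => ψ (x - Q x • e) * N k + (Q x % N k).toNat, ?_, ?_⟩
    · intro x
      rw [prod_range_succ]
      have h3 := h1 (x - Q x • e)
      have h4 : (Q x % N k).toNat < N k := by
        have := Int.emod_lt_of_pos (Q x) (b := N k) (by exact_mod_cast hNk)
        omega
      calc _ < ψ (x - Q x • e) * N k + N k := Nat.add_lt_add_left h4 _
        _ = (ψ (x - Q x • e) + 1) * N k := by ring
        _ ≤ _ := Nat.mul_le_mul_right _ h3
    · intro x y hx hy hxy
      simp only at hxy
      have lt1 : (Q x % N k).toNat < N k := by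
        have := Int.emod_lt_of_pos (Q x) (b := N k) (by exact_mod_cast hNk)
        omega
      have lt2 : (Q y % N k).toNat < N k := by
        have := Int.emod_lt_of_pos (Q y) (b := N k) (by exact_mod_cast hNk)
        omega
      have e1 : ψ (x - Q x • e) = ψ (y - Q y • e) := by
        have := congrArg (· / N k) hxy
        simp only [mul_comm _ (N k)] at this
        rwa [Nat.mul_add_div hNk, Nat.mul_add_div hNk, Nat.div_eq_of_lt lt1, Nat.div_eq_of_lt lt2] at this
      have e2 : (Q x % N k) = (Q y % N k) := by
        rw [e1] at hxy
        have p1 := Int.emod_nonneg (Q x) (b := N k) (by exact_mod_cast hNk.ne')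
        have p2 := Int.emod_nonneg (Q y) (b := N k) (by exact_mod_cast hNk.ne')
        omega
      obtain ⟨c, hc⟩ : (N k : ℤ) ∣ Q x - Q y := Int.ModEq.dvd (Int.ModEq.symm e2)
      have hdec : x - y = (x - Q x • e) - (y - Q y • e) + ((N k : ℤ) * c) • e := by
        rw [← hc, sub_smul]; abel
      by_cases hc0 : c = 0
      · rcases h2 _ _ (hQ x hx) (hQ y hy) e1 with h | ⟨j, hj, g, hg1, hg2, hg3⟩
        · left
          rw [hc0, h] at hdec
          simp at hdec
          exact sub_eq_zero.1 hdec
        · right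
          refine ⟨j, by omega, g, hg1, hg2, ?_⟩
          rw [hdec, hc0, hg3]; simp
      · right
        obtain ⟨w, hw, hw2⟩ : ∃ w, cst w ∈ sp b k ∧ (x - Q x • e) - (y - Q y • e) = N k • w := by
          rcases h2 _ _ (hQ x hx) (hQ y hy) e1 with h | ⟨j, hj, g, hg1, hg2, hg3⟩
          · exact ⟨0, by rw [cst_zero]; exact Submodule.zero_mem _, by rw [h]; simp⟩
          · obtain ⟨f, hf⟩ := hdiv j k (by omega) (by omega)
            refine ⟨f • g, ?_, ?_⟩
            · rw [cst_nsmul]; exact Submodule.smul_mem _ _ (sp_mono b (by omega) hg1)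
            · rw [hg3, hf, mul_smul]
        refine ⟨k, by omega, w + c • e, ?_, ?_, ?_⟩
        · rw [cst_add, cst_smul]
          exact Submodule.add_mem _ (sp_mono b (by omega) hw) (Submodule.smul_mem _ _ he)
        · intro hh
          rw [cst_add, cst_smul] at hh
          have h3 := (Submodule.add_mem_iff_right _ hw).1 hh
          have h4 : (c : ℝ) ≠ 0 := by exact_mod_cast hc0
          exact heN ((Submodule.smul_mem_iff _ h4).1 h3)
        · rw [hdec, hw2, smul_add, mul_smul]; simp

end AffDeg

namespace AffDeg
open Finset
variable {d : ℕ}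

/-- Integer box. -/
noncomputable def box (d n : ℕ) : Finset (Fin d → ℤ) := Fintype.piFinset fun _ => Finset.Icc (-(n : ℤ)) n

lemma mem_box {n : ℕ} {x : Fin d → ℤ} : x ∈ box d n ↔ nrm x ≤ n := by
  simp only [box, Fintype.mem_piFinset, mem_Icc, nrm_le]
  refine forall_congr' fun i => ?_
  omega

/-- Almost-minimal flags. -/
def Good (κ n k : ℕ) (b : ℕ → Fin d → ℤ) : Prop :=
  (∀ j < k, cst (b j) ∉ sp b j) ∧ (∀ j < k, nrm (b j) ≤ κ * n) ∧
  (∀ i j, i ≤ j → j < k → nrm (b i) ≤ nrm (b j)) ∧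
  ∀ j < k, ∀ x, cst x ∈ sp b k → cst x ∉ sp b j → nrm (b j) ≤ κ * nrm x

lemma nrm_pos_of_notMem {b : ℕ → Fin d → ℤ} {j : ℕ} {x : Fin d → ℤ} (h : cst x ∉ sp b j) :
    1 ≤ nrm x := by
  apply nrm_pos
  rintro rfl
  rw [cst_zero] at h
  exact h (Submodule.zero_mem _)

open Classical in
lemma card_span_box {κ n k : ℕ} {b : ℕ → Fin d → ℤ} (h : Good κ n k b) :
    (((box d n).filter fun x => cst x ∈ sp b k).card : ℝ) ≤
      ∏ i ∈ range k, (4 * κ * n / nrm (b i) : ℝ) := by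
  obtain ⟨h1, h2, h3, h4⟩ := h
  let q : ℕ → ℕ := fun i => 2 * κ * n / nrm (b i)
  let N : ℕ → ℕ := fun i => 2 ^ (Nat.log 2 (q i) + 1)
  have hpos : ∀ j < k, 1 ≤ nrm (b j) := fun j hj => nrm_pos_of_notMem (h1 j hj)
  have hq : ∀ j < k, 1 ≤ q j := by
    intro j hj
    have := h2 j hj
    exact (Nat.one_le_div_iff (hpos j hj)).2 (by nlinarith)
  obtain ⟨ψ, hψ1, hψ2⟩ := code b N k h1 (fun j _ => by positivity) (by
    intro i j hij hj
    apply pow_dvd_pow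
    have : q j ≤ q i := Nat.div_le_div_left (h3 i j hij hj) (hpos i (by omega))
    have := Nat.log_mono_right (b := 2) this
    omega)
  have hcard : ((box d n).filter fun x => cst x ∈ sp b k).card ≤ ∏ i ∈ range k, N i := by
    rw [← card_range (∏ i ∈ range k, N i)]
    apply Finset.card_le_card_of_injOn ψ
    · intro x _; simpa using hψ1 x
    · intro x hx y hy hxy
      simp only [coe_filter, mem_box, Set.mem_ofPred_eq] at hx hy
      rcases hψ2 x y hx.2 hy.2 hxy with h | ⟨j, hj, g, hg1, hg2, hg3⟩
      · exact h
      · exfalso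
        have a1 := h4 j hj g (sp_mono b (by omega) hg1) hg2
        have a2 : N j * nrm g ≤ 2 * n := by
          have := nrm_nsmul (N j) g
          rw [← hg3] at this
          have := nrm_sub_le x y
          omega
        have a3 : 2 * κ * n < N j * nrm (b j) := by
          have : q j < N j := Nat.lt_pow_succ_log_self (by norm_num) _
          exact (Nat.div_lt_iff_lt_mul (hpos j hj)).1 this
        have : N j * nrm (b j) ≤ κ * (N j * nrm g) := by
          calc N j * nrm (b j) ≤ N j * (κ * nrm g) := Nat.mul_le_mul_left _ a1
            _ = _ := by ring
        have : κ * (N j * nrm g) ≤ κ * (2 * n) := Nat.mul_le_mul_left _ a2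
        nlinarith
  calc (((box d n).filter fun x => cst x ∈ sp b k).card : ℝ) ≤ ((∏ i ∈ range k, N i : ℕ) : ℝ) := by
        exact_mod_cast hcard
    _ = ∏ i ∈ range k, (N i : ℝ) := by push_cast; rfl
    _ ≤ _ := by
      apply prod_le_prod
      · intro i _; positivity
      · intro i hi
        rw [mem_range] at hi
        have p := hpos i hi
        have a1 : 2 ^ (Nat.log 2 (q i)) ≤ q i := Nat.pow_log_le_self 2 (by have := hq i hi; omega)
        have a2 : q i * nrm (b i) ≤ 2 * κ * n := Nat.div_mul_le_self _ _
        have a3 : N i * nrm (b i) ≤ 4 * κ * n := by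
          simp only [N, pow_succ]; nlinarith
        rw [le_div_iff₀ (by exact_mod_cast p)]
        exact_mod_cast a3

/-- real span of an integer family -/
def rs {m : ℕ} (M : Fin m → Fin d → ℤ) : Submodule ℝ (Fin d → ℝ) :=
  Submodule.span ℝ (Set.range fun i => cst (M i))

lemma finrank_sp_le (b : ℕ → Fin d → ℤ) (j : ℕ) : Module.finrank ℝ (sp b j) ≤ j := by
  have h := finrank_span_finset_le_card (R := ℝ) ((range j).image fun i => cst (b i))
  have e : (((range j).image fun i => cst (b i) : Finset _) : Set (Fin d → ℝ)) =
    (fun i => cst (b i)) '' Set.Iio j := by simp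
  rw [Set.finrank, e] at h
  exact h.trans (card_image_le.trans (by simp))

lemma le_finrank_sp (b : ℕ → Fin d → ℤ) (j : ℕ) (hb : ∀ i < j, cst (b i) ∉ sp b i) :
    j ≤ Module.finrank ℝ (sp b j) := by
  induction j with
  | zero => simp
  | succ j ih =>
    have h1 := ih fun i hi => hb i (by omega)
    have : sp b j < sp b (j + 1) := by
      refine lt_of_le_of_ne (sp_mono b (by omega)) ?_
      intro h
      apply hb j (by omega)
      rw [h]; exact mem_sp b (by omega)
    have := Submodule.finrank_lt_finrank_of_lt this
    omega

lemma greedy {m n : ℕ} (M : Fin m → Fin d → ℤ) (hM : ∀ i, nrm (M i) ≤ n) (k : ℕ)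
    (hk : k ≤ Module.finrank ℝ (rs M)) :
    ∃ b : ℕ → Fin d → ℤ, ∀ j < k, cst (b j) ∈ rs M ∧ cst (b j) ∉ sp b j ∧ nrm (b j) ≤ n ∧
      ∀ x, cst x ∈ rs M → cst x ∉ sp b j → nrm (b j) ≤ nrm x := by
  classical
  induction k with
  | zero => exact ⟨fun _ => 0, by simp⟩
  | succ k ih =>
    obtain ⟨b, hb⟩ := ih (by omega)
    have hex : ∃ i, cst (M i) ∉ sp b k := by
      by_contra! hc
      have : rs M ≤ sp b k := by
        apply Submodule.span_le.2
        rintro _ ⟨i, rfl⟩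
        exact hc i
      have := Submodule.finrank_mono this
      have := finrank_sp_le b k
      omega
    obtain ⟨i0, hi0⟩ := hex
    have hP : ∃ s, ∃ x, cst x ∈ rs M ∧ cst x ∉ sp b k ∧ nrm x = s :=
      ⟨_, M i0, Submodule.subset_span ⟨i0, rfl⟩, hi0, rfl⟩
    obtain ⟨v, hv1, hv2, hv3⟩ := Nat.find_spec hP
    have hmin : ∀ x, cst x ∈ rs M → cst x ∉ sp b k → nrm v ≤ nrm x := by
      intro x hx1 hx2
      rw [hv3]
      exact Nat.find_min' hP ⟨x, hx1, hx2, rfl⟩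
    have hsp : ∀ j ≤ k, sp (Function.update b k v) j = sp b j := by
      intro j hj
      apply sp_congr
      intro i hi
      rw [Function.update_of_ne (by omega)]
    refine ⟨Function.update b k v, ?_⟩
    intro j hj
    rw [hsp j (by omega)]
    rcases Nat.lt_succ_iff_lt_or_eq.1 hj with h | h
    · rw [Function.update_of_ne (by omega)]
      exact hb j h
    · subst h
      rw [Function.update_self]
      exact ⟨hv1, hv2, (hmin _ (Submodule.subset_span ⟨i0, rfl⟩) hi0).trans (hM i0), hmin⟩

lemma flag_linInd (b : ℕ → Fin d → ℤ) (k : ℕ) (hb : ∀ j < k, cst (b j) ∉ sp b j) :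
    LinearIndependent ℝ (fun j : Fin k => cst (b j)) := by
  rw [linearIndependent_iff_card_eq_finrank_span]
  have e : Set.range (fun j : Fin k => cst (b j)) = (fun i => cst (b i)) '' Set.Iio k := by
    ext x; constructor
    · rintro ⟨j, rfl⟩; exact ⟨j, j.2, rfl⟩
    · rintro ⟨j, hj, rfl⟩; exact ⟨⟨j, hj⟩, rfl⟩
  rw [Set.finrank, e]
  have h1 := finrank_sp_le b k
  have h2 := le_finrank_sp b k hb
  unfold sp at h1 h2
  simp; omega

/-- Extension of a finite tuple to a sequence. -/
def ex {k : ℕ} (b : Fin k → Fin d → ℤ) : ℕ → Fin d → ℤ :=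
  fun i => if h : i < k then b ⟨i, h⟩ else 0

/-- The weight of a tuple. -/
noncomputable def wt {k : ℕ} (b : Fin (k + 1) → Fin d → ℤ) : ℝ :=
  ∏ j : Fin k, ((nrm (b j.castSucc) : ℝ) / nrm (b (Fin.last k)))

lemma wt_nonneg {k : ℕ} (b : Fin (k + 1) → Fin d → ℤ) : 0 ≤ wt b := by
  unfold wt; positivity

/-- `b` is an almost-minimal flag for the span of `M`. -/
def Rel {m : ℕ} (k n : ℕ) (M : Fin m → Fin d → ℤ) (b : Fin (k + 1) → Fin d → ℤ) : Prop :=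
  Good (k + 1) n (k + 1) (ex b) ∧ sp (ex b) (k + 1) = rs M

open Classical in
lemma weight_sum {m n k : ℕ} (M : Fin m → Fin d → ℤ) (hM : ∀ i, nrm (M i) ≤ n)
    (hk : Module.finrank ℝ (rs M) = k + 1) (Q : Finset (Fin (k + 1) → Fin d → ℤ))
    (hQ : ∀ b, Rel k n M b → b ∈ Q) :
    1 / ((k : ℝ) + 1) ^ k ≤ ∑ b ∈ Q.filter (Rel k n M), wt b := by
  obtain ⟨b, hb⟩ := greedy M hM (k + 1) hk.ge
  have hspV : sp b (k + 1) = rs M := by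
    apply Submodule.eq_of_le_of_finrank_le
    · apply Submodule.span_le.2
      rintro _ ⟨i, hi, rfl⟩
      exact (hb i hi).1
    · rw [hk]; exact le_finrank_sp b _ fun j hj => (hb j hj).2.1
  have hpos : ∀ j < k + 1, 1 ≤ nrm (b j) := fun j hj => nrm_pos_of_notMem (hb j hj).2.1
  have hmono : ∀ i j, i ≤ j → j < k + 1 → nrm (b i) ≤ nrm (b j) := by
    intro i j hij hj
    exact (hb i (by omega)).2.2.2 _ (hb j hj).1 fun h => (hb j hj).2.1 (sp_mono b hij h)
  let T : Finset (Fin k → ℕ) := Fintype.piFinset fun j => range (nrm (b k) / nrm (b j) + 1)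
  let c : (Fin k → ℕ) → (Fin d → ℤ) := fun t => b k + ∑ j : Fin k, t j • b j
  let τ : (Fin k → ℕ) → (Fin (k + 1) → Fin d → ℤ) := fun t => Fin.snoc (fun j : Fin k => b j) (c t)
  have hτ1 : ∀ t, ∀ i < k, ex (τ t) i = b i := by
    intro t i hi
    have : (⟨i, by omega⟩ : Fin (k + 1)) = Fin.castSucc ⟨i, hi⟩ := rfl
    simp only [ex, show i < k + 1 by omega, dif_pos, this, τ, Fin.snoc_castSucc]
  have hτ2 : ∀ t, ex (τ t) k = c t := by
    intro t
    have : (⟨k, by omega⟩ : Fin (k + 1)) = Fin.last k := rfl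
    simp only [ex, show k < k + 1 by omega, dif_pos, this, τ, Fin.snoc_last]
  have hcs : ∀ t, cst (c t) - cst (b k) ∈ sp b k := by
    intro t
    simp only [c, cst_add, cst_sum, cst_nsmul, add_sub_cancel_left]
    exact Submodule.sum_mem _ fun j _ => Submodule.smul_mem _ _ (mem_sp b j.2)
  have hcn : ∀ t, cst (c t) ∉ sp b k := by
    intro t h
    apply (hb k (by omega)).2.1
    have := Submodule.sub_mem _ h (hcs t)
    simpa using this
  have hs1 : ∀ t, ∀ j ≤ k, sp (ex (τ t)) j = sp b j := by
    intro t j hj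
    exact sp_congr fun i hi => hτ1 t i (by omega)
  have hs2 : ∀ t, sp (ex (τ t)) (k + 1) = rs M := by
    intro t
    rw [← hspV, sp_succ, sp_succ, hs1 t k le_rfl, hτ2]
    apply le_antisymm
    · refine sup_le ?_ le_sup_right
      rw [Submodule.span_singleton_le_iff_mem, ← sp_succ]
      have := Submodule.add_mem _ (sp_mono b (by omega : k ≤ k + 1) (hcs t)) (mem_sp b (by omega : k < k + 1))
      simpa using this
    · refine sup_le ?_ le_sup_right
      rw [Submodule.span_singleton_le_iff_mem]
      have h1 : cst (c t) ∈ Submodule.span ℝ {cst (c t)} ⊔ sp b k :=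
        Submodule.mem_sup_left (Submodule.mem_span_singleton_self _)
      have h2 := Submodule.mem_sup_right (S := Submodule.span ℝ {cst (c t)}) (hcs t)
      have := Submodule.sub_mem _ h1 h2
      simpa using this
  have hcV : ∀ t, cst (c t) ∈ rs M := by
    intro t
    rw [← hs2 t, ← hτ2 t]
    exact mem_sp _ (by omega)
  have hcnorm : ∀ t ∈ T, nrm (c t) ≤ (k + 1) * nrm (b k) := by
    intro t ht
    have h1 : ∀ j : Fin k, nrm (t j • b j) ≤ nrm (b k) := by
      intro j
      have h2 := Fintype.mem_piFinset.1 ht j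
      rw [mem_range, Nat.lt_succ_iff] at h2
      have h3 := nrm_smul_le (t j : ℤ) (b j)
      rw [Int.natAbs_natCast, natCast_zsmul] at h3
      exact h3.trans ((Nat.mul_le_mul_right _ h2).trans (Nat.div_mul_le_self _ _))
    calc nrm (c t) ≤ nrm (b k) + nrm (∑ j : Fin k, t j • b j) := nrm_add_le _ _
      _ ≤ nrm (b k) + ∑ j : Fin k, nrm (t j • b j) := by gcongr; exact nrm_sum_le _ _
      _ ≤ nrm (b k) + ∑ j : Fin k, nrm (b k) := by gcongr with j; exact h1 j
      _ = _ := by simp; ring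
  have hclow : ∀ t, nrm (b k) ≤ nrm (c t) := fun t => (hb k (by omega)).2.2.2 _ (hcV t) (hcn t)
  have hrel : ∀ t ∈ T, Rel k n M (τ t) := by
    intro t ht
    refine ⟨⟨?_, ?_, ?_, ?_⟩, hs2 t⟩
    · intro j hj
      rw [hs1 t j (by omega)]
      rcases Nat.lt_succ_iff_lt_or_eq.1 hj with h | h
      · rw [hτ1 t j h]; exact (hb j hj).2.1
      · subst h; rw [hτ2]; exact hcn t
    · intro j hj
      rcases Nat.lt_succ_iff_lt_or_eq.1 hj with h | h
      · rw [hτ1 t j h]; have := (hb j hj).2.2.1; nlinarith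
      · subst h; rw [hτ2]; exact (hcnorm t ht).trans (Nat.mul_le_mul_left _ (hb _ hj).2.2.1)
    · intro i j hij hj
      rcases Nat.lt_succ_iff_lt_or_eq.1 hj with h | h
      · rw [hτ1 t j h, hτ1 t i (by omega)]; exact hmono i j hij hj
      · subst h
        rcases Nat.lt_or_eq_of_le hij with h' | h'
        · rw [hτ2, hτ1 t i h']; exact (hmono i j hij hj).trans (hclow t)
        · rw [h']
    · intro j hj x hx1 hx2
      rw [hs2] at hx1
      rw [hs1 t j (by omega)] at hx2
      have h0 := (hb j hj).2.2.2 x hx1 hx2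
      rcases Nat.lt_succ_iff_lt_or_eq.1 hj with h | h
      · rw [hτ1 t j h]; nlinarith
      · subst h; rw [hτ2]; exact (hcnorm t ht).trans (Nat.mul_le_mul_left _ h0)
  have hinj : Set.InjOn τ T := by
    intro t _ t' _ h
    have h1 : c t = c t' := by rw [← hτ2, ← hτ2, h]
    have h2 : ∑ j : Fin k, (t j : ℝ) • cst (b j) = ∑ j : Fin k, (t' j : ℝ) • cst (b j) := by
      have h3 : ∑ j : Fin k, t j • b j = ∑ j : Fin k, t' j • b j := add_left_cancel h1
      have := congrArg cst h3
      simpa only [cst_sum, cst_nsmul] using this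
    have hli := flag_linInd b k fun j hj => (hb j (by omega)).2.1
    have h4 := Fintype.linearIndependent_iff.1 hli (fun j => (t j : ℝ) - t' j) (by
      simp only [sub_smul, sum_sub_distrib, h2, sub_self])
    ext j
    have := h4 j
    simp only [sub_eq_zero] at this
    exact_mod_cast this
  have hsub : T.image τ ⊆ Q.filter (Rel k n M) := by
    intro y hy
    obtain ⟨t, ht, rfl⟩ := mem_image.1 hy
    exact mem_filter.2 ⟨hQ _ (hrel t ht), hrel t ht⟩
  have hkpos : (1 : ℝ) ≤ nrm (b k) := by exact_mod_cast hpos k (by omega)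
  calc 1 / ((k : ℝ) + 1) ^ k
      = ∏ j : Fin k, (((nrm (b k) : ℝ) / nrm (b j)) * ((nrm (b j) : ℝ) / ((k + 1) * nrm (b k)))) := by
        rw [prod_congr rfl (g := fun _ => 1 / ((k : ℝ) + 1))]
        · simp
        · intro j _
          have : (1 : ℝ) ≤ nrm (b j) := by exact_mod_cast hpos j (by omega)
          field_simp
    _ = (∏ j : Fin k, ((nrm (b k) : ℝ) / nrm (b j))) * ∏ j : Fin k, ((nrm (b j) : ℝ) / ((k + 1) * nrm (b k))) :=
        prod_mul_distrib
    _ ≤ (T.card : ℝ) * ∏ j : Fin k, ((nrm (b j) : ℝ) / ((k + 1) * nrm (b k))) := by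
        gcongr
        simp only [T, Fintype.card_piFinset, card_range]
        push_cast
        apply prod_le_prod
        · intro i _; positivity
        · intro j _
          have h1 : (0 : ℝ) < nrm (b j) := by exact_mod_cast hpos j (by omega)
          rw [div_le_iff₀ h1]
          have := Nat.lt_mul_div_succ (nrm (b k)) (hpos j (by omega))
          have h2 : nrm (b k) ≤ (nrm (b k) / nrm (b j) + 1) * nrm (b j) := by
            rw [mul_comm]; exact this.le
          exact_mod_cast h2
    _ = ∑ t ∈ T, ∏ j : Fin k, ((nrm (b j) : ℝ) / ((k + 1) * nrm (b k))) := by simp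
    _ ≤ ∑ t ∈ T, wt (τ t) := by
        apply sum_le_sum
        intro t ht
        unfold wt
        apply prod_le_prod
        · intro i _; positivity
        · intro j _
          simp only [τ, Fin.snoc_castSucc, Fin.snoc_last]
          have h1 : (nrm (c t) : ℝ) ≤ (k + 1) * nrm (b k) := by exact_mod_cast hcnorm t ht
          have h2 : (0 : ℝ) < nrm (c t) := by
            have : 1 ≤ nrm (c t) := (hpos k (by omega)).trans (hclow t)
            exact_mod_cast this
          gcongr
    _ = ∑ y ∈ T.image τ, wt y := (sum_image hinj).symm
    _ ≤ _ := sum_le_sum_of_subset_of_nonneg hsub fun y _ _ => wt_nonneg y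

lemma main_count {m n k : ℕ} (S : Finset (Fin m → Fin d → ℤ)) 
    (hS : ∀ M ∈ S, (∀ i, nrm (M i) ≤ n) ∧ Module.finrank ℝ (rs M) = k + 1)
    (Q : Finset (Fin (k + 1) → Fin d → ℤ)) (hQ : ∀ M ∈ S, ∀ b, Rel k n M b → b ∈ Q) :
    (S.card : ℝ) ≤ ((k : ℝ) + 1) ^ k *
      ∑ b ∈ Q, wt b * (∏ i, (4 * ((k : ℝ) + 1) * n / nrm (b i))) ^ m := by
  classical
  have h1 : (S.card : ℝ) * (1 / ((k : ℝ) + 1) ^ k) ≤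
      ∑ M ∈ S, ∑ b ∈ Q.filter (Rel k n M), wt b := by
    rw [← nsmul_eq_mul]
    exact card_nsmul_le_sum _ _ _ fun M hM => weight_sum M (hS M hM).1 (hS M hM).2 Q (hQ M hM)
  have h2 : ∑ M ∈ S, ∑ b ∈ Q.filter (Rel k n M), wt b =
      ∑ b ∈ Q, ∑ M ∈ S.filter (fun M => Rel k n M b), wt b := by
    simp only [sum_filter]; exact sum_comm
  have h3 : ∀ b ∈ Q, ∑ M ∈ S.filter (fun M => Rel k n M b), wt b ≤
      wt b * (∏ i, (4 * ((k : ℝ) + 1) * n / nrm (b i))) ^ m := by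
    intro b _
    rw [sum_const, nsmul_eq_mul, mul_comm]
    apply mul_le_mul_of_nonneg_left _ (wt_nonneg b)
    by_cases hG : Good (k + 1) n (k + 1) (ex b)
    · have hc := card_span_box hG
      have hsub : S.filter (fun M => Rel k n M b) ⊆
          Fintype.piFinset fun _ => (box d n).filter fun x => cst x ∈ sp (ex b) (k + 1) := by
        intro M hM
        obtain ⟨hM1, hM2⟩ := mem_filter.1 hM
        rw [Fintype.mem_piFinset]
        intro i
        rw [mem_filter, mem_box, hM2.2]
        exact ⟨(hS M hM1).1 i, Submodule.subset_span ⟨i, rfl⟩⟩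
      have hc2 := card_le_card hsub
      rw [Fintype.card_piFinset, prod_const, card_univ, Fintype.card_fin] at hc2
      have e : ∏ i ∈ range (k + 1), (4 * ((k + 1 : ℕ) : ℝ) * n / nrm (ex b i)) =
          ∏ i, (4 * ((k : ℝ) + 1) * n / nrm (b i)) := by
        rw [prod_range]
        apply prod_congr rfl
        intro i _
        have hi : (i : ℕ) < k + 1 := i.2
        simp only [ex, hi, dif_pos, Fin.eta]
        push_cast; rfl
      rw [e] at hc
      calc _ ≤ ((((box d n).filter fun x => cst x ∈ sp (ex b) (k + 1)).card ^ m : ℕ) : ℝ) := by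
            exact_mod_cast hc2
        _ ≤ _ := by push_cast; gcongr
    · have : S.filter (fun M => Rel k n M b) = ∅ := by
        apply filter_eq_empty_iff.2
        intro M _ h
        exact hG h.1
      rw [this]; simp; positivity
  have hpos : (0 : ℝ) < ((k : ℝ) + 1) ^ k := by positivity
  rw [h2] at h1
  have h4 := h1.trans (sum_le_sum h3)
  rw [mul_one_div, div_le_iff₀ hpos] at h4
  linarith
end AffDeg

namespace AffDeg
open Finset
variable {d : ℕ}

/-- Nonzero vectors of the box. -/
noncomputable def pb (d R : ℕ) : Finset (Fin d → ℤ) := (box d R).filter fun x => 1 ≤ nrm x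

lemma mem_pb {R : ℕ} {x : Fin d → ℤ} : x ∈ pb d R ↔ nrm x ≤ R ∧ 1 ≤ nrm x := by
  simp [pb, mem_box]

/-- shell constant -/
noncomputable def cd (d : ℕ) : ℝ := 2 * d * 3 ^ (d - 1)

lemma cd_nonneg (d : ℕ) : 0 ≤ cd d := by unfold cd; positivity

lemma shell_card (R s : ℕ) (hs : 1 ≤ s) :
    (((pb d R).filter fun x => nrm x = s).card : ℝ) ≤ cd d * (s : ℝ) ^ (d - 1) := by
  classical
  have hsub : ((pb d R).filter fun x => nrm x = s) ⊆
      (univ : Finset (Fin d)).biUnion fun i => Fintype.piFinset fun j =>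
        if j = i then ({(s : ℤ), -(s : ℤ)} : Finset ℤ) else Finset.Icc (-(s : ℤ)) s := by
    intro x hx
    obtain ⟨hx1, hx2⟩ := mem_filter.1 hx
    have hd : 0 < d := by
      rcases Nat.eq_zero_or_pos d with h | h
      · subst h; simp [nrm] at hx2; omega
      · exact h
    obtain ⟨i, -, hi⟩ := Finset.exists_mem_eq_sup (univ : Finset (Fin d)) ⟨⟨0, hd⟩, mem_univ _⟩
      (fun i => (x i).natAbs)
    have hi' : (x i).natAbs = s := by rw [← hx2]; exact hi.symm
    rw [mem_biUnion]
    refine ⟨i, mem_univ _, ?_⟩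
    rw [Fintype.mem_piFinset]
    intro j
    have hj := le_nrm x j
    split_ifs with h
    · subst h; simp only [mem_insert, mem_singleton]; omega
    · rw [mem_Icc]; omega
  have hc := (card_le_card hsub).trans card_biUnion_le
  have h2 : ∀ i : Fin d, (Fintype.piFinset fun j =>
        if j = i then ({(s : ℤ), -(s : ℤ)} : Finset ℤ) else Finset.Icc (-(s : ℤ)) s).card ≤
        2 * (3 * s) ^ (d - 1) := by
    intro i
    rw [Fintype.card_piFinset, ← mul_prod_erase univ _ (mem_univ i)]
    apply Nat.mul_le_mul
    · simp only [if_true]; exact card_le_two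
    · rw [prod_congr rfl (g := fun _ => 2 * s + 1)]
      · rw [prod_const, card_erase_of_mem (mem_univ i), card_univ, Fintype.card_fin]
        exact Nat.pow_le_pow_left (by omega) _
      · intro j hj
        rw [if_neg (ne_of_mem_erase hj), Int.card_Icc]; omega
  have h3 := hc.trans (sum_le_sum fun i _ => h2 i)
  rw [sum_const, card_univ, Fintype.card_fin, smul_eq_mul] at h3
  have h4 : (((pb d R).filter fun x => nrm x = s).card : ℝ) ≤ ((d * (2 * (3 * s) ^ (d - 1)) : ℕ) : ℝ) := by
    exact_mod_cast h3
  refine h4.trans (le_of_eq ?_)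
  unfold cd; push_cast; rw [mul_pow]; ring

lemma shell_sum (R : ℕ) (f : ℕ → ℝ) (hf : ∀ s, 0 ≤ f s) :
    ∑ x ∈ pb d R, f (nrm x) ≤ cd d * ∑ s ∈ Icc 1 R, (s : ℝ) ^ (d - 1) * f s := by
  classical
  have h : ∀ x ∈ pb d R, nrm x ∈ Icc 1 R := by
    intro x hx; rw [mem_pb] at hx; rw [mem_Icc]; omega
  rw [← sum_fiberwise_of_maps_to h, mul_sum]
  apply sum_le_sum
  intro s hs
  rw [mem_Icc] at hs
  rw [sum_congr rfl (g := fun _ => f s) (by intro x hx; rw [(mem_filter.1 hx).2]), sum_const,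
    nsmul_eq_mul, ← mul_assoc]
  exact mul_le_mul_of_nonneg_right (shell_card R s hs.1) (hf s)

lemma inner_sum (hd : 0 < d) (m R : ℕ) (hR : 1 ≤ R) :
    ∑ x ∈ pb d R, ((nrm x : ℝ) / R) / (nrm x : ℝ) ^ m ≤ cd d * (R : ℝ) ^ (d - m) := by
  refine (shell_sum R (fun s => ((s : ℝ) / R) / (s : ℝ) ^ m) (fun s => by positivity)).trans ?_
  apply mul_le_mul_of_nonneg_left _ (cd_nonneg d)
  have hR' : (0 : ℝ) < R := by exact_mod_cast hR
  have : ∀ s ∈ Icc 1 R, (s : ℝ) ^ (d - 1) * (((s : ℝ) / R) / (s : ℝ) ^ m) ≤ (R : ℝ) ^ (d - m) / R := by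
    intro s hs
    rw [mem_Icc] at hs
    have hs1 : (1 : ℝ) ≤ s := by exact_mod_cast hs.1
    have hs2 : (s : ℝ) ≤ R := by exact_mod_cast hs.2
    have e : (s : ℝ) ^ (d - 1) * (((s : ℝ) / R) / (s : ℝ) ^ m) = (s : ℝ) ^ d / s ^ m / R := by
      have : (s : ℝ) ^ d = s ^ (d - 1) * s := by rw [← pow_succ]; congr 1; omega
      rw [this]; field_simp
    rw [e]
    apply div_le_div_of_nonneg_right _ hR'.le
    rw [div_le_iff₀ (by positivity)]
    calc (s : ℝ) ^ d ≤ s ^ ((d - m) + m) := pow_le_pow_right₀ hs1 (by omega)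
      _ = s ^ (d - m) * s ^ m := pow_add _ _ _
      _ ≤ _ := by gcongr
  refine (sum_le_sum this).trans ?_
  rw [sum_const, Nat.card_Icc, nsmul_eq_mul]
  simp only [Nat.add_sub_cancel]
  rw [mul_div_cancel₀ _ hR'.ne']

/-- outer sum -/
noncomputable def osum (d m k R : ℕ) : ℝ :=
  ∑ s ∈ Icc 1 R, (s : ℝ) ^ (d - 1) * ((s : ℝ) ^ ((d - m) * k) / (s : ℝ) ^ m)

lemma rel_facts {m n k : ℕ} {M : Fin m → Fin d → ℤ} {b : Fin (k + 1) → Fin d → ℤ}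
    (h : Rel k n M b) : (∀ i, 1 ≤ nrm (b i)) ∧ (∀ i, nrm (b i) ≤ (k + 1) * n) ∧
      (∀ i, nrm (b i) ≤ nrm (b (Fin.last k))) ∧
      ∀ x, cst x ∈ rs M → x ≠ 0 → nrm (b 0) ≤ (k + 1) * nrm x := by
  obtain ⟨⟨h1, h2, h3, h4⟩, h5⟩ := h
  have he : ∀ i : Fin (k + 1), ex b i = b i := by
    intro i
    have hi : (i : ℕ) < k + 1 := i.2
    simp only [ex, hi, dif_pos, Fin.eta]
  refine ⟨?_, ?_, ?_, ?_⟩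
  · intro i; rw [← he]; exact nrm_pos_of_notMem (h1 i i.2)
  · intro i; rw [← he]; exact h2 i i.2
  · intro i; rw [← he, ← he]; exact h3 _ _ (Fin.le_last i) (Fin.last k).2
  · intro x hx hx0
    rw [← he]
    refine h4 _ (Fin.is_lt _) x (by rw [h5]; exact hx) ?_
    simp only [Fin.val_zero, sp_zero, Submodule.mem_bot]
    intro h0
    exact hx0 (cst_inj (h0.trans cst_zero.symm))

lemma upper_raw (hd : 0 < d) {m n k : ℕ} (S : Finset (Fin m → Fin d → ℤ))
    (hS : ∀ M ∈ S, (∀ i, nrm (M i) ≤ n) ∧ Module.finrank ℝ (rs M) = k + 1) :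
    (S.card : ℝ) ≤ ((k : ℝ) + 1) ^ k * ((4 * ((k : ℝ) + 1) * n) ^ ((k + 1) * m) *
      (cd d ^ (k + 1) * osum d m k ((k + 1) * n))) := by
  classical
  let X := Fin d → ℤ
  let P : Finset (Σ _ : X, (Fin k → X)) :=
    (pb d ((k + 1) * n)).sigma fun c => Fintype.piFinset fun _ => pb d (nrm c)
  let F : (Σ _ : X, (Fin k → X)) → (Fin (k + 1) → X) := fun p => Fin.snoc p.2 p.1
  have hF : Set.InjOn F P := by
    rintro ⟨c, a⟩ _ ⟨c', a'⟩ _ h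
    simp only [F] at h
    have h1 : c = c' := by
      have := congrFun h (Fin.last k)
      simpa only [Fin.snoc_last] using this
    have h2 : a = a' := by
      funext j
      have := congrFun h j.castSucc
      simpa only [Fin.snoc_castSucc] using this
    rw [h1, h2]
  have h0 := main_count S hS (P.image F) (by
    intro M hM b hb
    obtain ⟨f1, f2, f3, -⟩ := rel_facts hb
    rw [mem_image]
    refine ⟨⟨b (Fin.last k), fun j => b j.castSucc⟩, ?_, ?_⟩
    · simp only [P, mem_sigma, Fintype.mem_piFinset, mem_pb]
      exact ⟨⟨f2 _, f1 _⟩, fun j => mem_pb.2 ⟨f3 _, f1 _⟩⟩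
    · funext j
      refine Fin.lastCases ?_ (fun j => ?_) j
      · simp only [F, Fin.snoc_last]
      · simp only [F, Fin.snoc_castSucc])
  refine h0.trans ?_
  apply mul_le_mul_of_nonneg_left _ (by positivity)
  rw [sum_image hF]
  set B : ℝ := 4 * ((k : ℝ) + 1) * n with hB
  have hterm : ∀ p : (Σ _ : X, (Fin k → X)),
      wt (F p) * (∏ i, (B / nrm (F p i))) ^ m = B ^ ((k + 1) * m) * ((1 / (nrm p.1 : ℝ) ^ m) *
        ∏ j : Fin k, ((nrm (p.2 j) : ℝ) / nrm p.1) / (nrm (p.2 j) : ℝ) ^ m) := by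
    intro p
    unfold wt
    rw [Fin.prod_univ_castSucc]
    simp only [F, Fin.snoc_last, Fin.snoc_castSucc]
    simp only [prod_div_distrib, prod_const, card_univ, Fintype.card_fin, prod_pow, mul_pow, div_pow]
    ring
  rw [sum_congr rfl fun p _ => hterm p, ← mul_sum]
  apply mul_le_mul_of_nonneg_left _ (by positivity)
  simp only [P]
  rw [sum_sigma]
  calc _ ≤ ∑ c ∈ pb d ((k + 1) * n), (cd d ^ k * ((nrm c : ℝ) ^ ((d - m) * k) / (nrm c : ℝ) ^ m)) := by
        apply sum_le_sum
        intro c hc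
        rw [mem_pb] at hc
        simp only
        rw [← mul_sum, ← prod_univ_sum (t := fun _ : Fin k => pb d (nrm c))
          (f := fun _ a => ((nrm a : ℝ) / nrm c) / (nrm a : ℝ) ^ m)]
        rw [prod_const, card_univ, Fintype.card_fin]
        have h1 := inner_sum hd m (nrm c) hc.2
        have h2 := pow_le_pow_left₀ (sum_nonneg fun x _ => by positivity) h1 k
        calc _ ≤ 1 / (nrm c : ℝ) ^ m * (cd d * (nrm c : ℝ) ^ (d - m)) ^ k :=
              mul_le_mul_of_nonneg_left h2 (by positivity)
          _ = _ := by rw [mul_pow, ← pow_mul]; ring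
    _ = cd d ^ k * ∑ c ∈ pb d ((k + 1) * n), ((nrm c : ℝ) ^ ((d - m) * k) / (nrm c : ℝ) ^ m) := by
        rw [mul_sum]
    _ ≤ cd d ^ k * (cd d * osum d m k ((k + 1) * n)) := by
        apply mul_le_mul_of_nonneg_left _ (pow_nonneg (cd_nonneg d) _)
        exact shell_sum _ (fun s => (s : ℝ) ^ ((d - m) * k) / (s : ℝ) ^ m) (fun s => by positivity)
    _ = _ := by ring

lemma jsum (m R : ℕ) (hm : m < d) :
    ∑ x ∈ pb d R, (1 / (nrm x : ℝ)) ^ m ≤ cd d * (R : ℝ) ^ (d - m) := by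
  refine (shell_sum R (fun s => (1 / (s : ℝ)) ^ m) (fun s => by positivity)).trans ?_
  apply mul_le_mul_of_nonneg_left _ (cd_nonneg d)
  have : ∀ s ∈ Icc 1 R, (s : ℝ) ^ (d - 1) * (1 / (s : ℝ)) ^ m ≤ (R : ℝ) ^ (d - m - 1) := by
    intro s hs
    rw [mem_Icc] at hs
    have hs1 : (1 : ℝ) ≤ s := by exact_mod_cast hs.1
    have hs2 : (s : ℝ) ≤ R := by exact_mod_cast hs.2
    have e : (s : ℝ) ^ (d - 1) = s ^ (d - m - 1) * s ^ m := by rw [← pow_add]; congr 1; omega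
    rw [e, mul_assoc, ← mul_pow, mul_one_div_cancel (by positivity), one_pow, mul_one]
    gcongr
  refine (sum_le_sum this).trans ?_
  rw [sum_const, Nat.card_Icc, nsmul_eq_mul]
  simp only [Nat.add_sub_cancel]
  rw [← pow_succ']
  apply le_of_eq; congr 1; omega

lemma bad_count {k : ℕ} (hk : k + 1 < d) : ∃ C : ℝ, 0 < C ∧ ∀ (K s : ℕ), 1 ≤ K →
    ∀ S : Finset (Fin (k + 1) → Fin d → ℤ),
    (∀ M ∈ S, (∀ i, nrm (M i) ≤ s) ∧ Module.finrank ℝ (rs M) = k + 1) →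
    (∀ M ∈ S, ∃ x, cst x ∈ rs M ∧ x ≠ 0 ∧ K * nrm x ≤ s) →
    (S.card : ℝ) ≤ C * (s : ℝ) ^ ((k + 1) * d) / K := by
  classical
  let D : ℝ := (4 * ((k : ℝ) + 1)) ^ (k + 1) * (cd d * ((k : ℝ) + 1) ^ (d - (k + 1)))
  have hD : 0 ≤ D := by have := cd_nonneg d; positivity
  refine ⟨((k : ℝ) + 1) ^ k * D ^ (k + 1) + 1, by positivity, ?_⟩
  intro K s hK S hS hS2
  have hK' : (1 : ℝ) ≤ K := by exact_mod_cast hK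
  let R := (k + 1) * s
  let t : Fin (k + 1) → Finset (Fin d → ℤ) := fun i => if i = 0 then pb d (R / K) else pb d R
  let Q := (Fintype.piFinset t).filter fun b => ∀ i, nrm (b i) ≤ nrm (b (Fin.last k))
  have h0 := main_count S hS Q (by
    intro M hM b hb
    obtain ⟨f1, f2, f3, f4⟩ := rel_facts hb
    rw [mem_filter, Fintype.mem_piFinset]
    refine ⟨fun i => ?_, f3⟩
    simp only [t]
    split_ifs with h
    · subst h
      rw [mem_pb]
      refine ⟨?_, f1 _⟩
      obtain ⟨x, hx1, hx2, hx3⟩ := hS2 M hM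
      rw [Nat.le_div_iff_mul_le (by omega)]
      have := f4 x hx1 hx2
      calc nrm (b 0) * K ≤ (k + 1) * nrm x * K := Nat.mul_le_mul_right _ this
        _ = (k + 1) * (K * nrm x) := by ring
        _ ≤ _ := Nat.mul_le_mul_left _ hx3
    · rw [mem_pb]; exact ⟨f2 _, f1 _⟩)
  have h1 : ∑ b ∈ Q, wt b * (∏ i, (4 * ((k : ℝ) + 1) * s / nrm (b i))) ^ (k + 1) ≤
      ∑ b ∈ Fintype.piFinset t, ∏ i, (4 * ((k : ℝ) + 1) * s / nrm (b i)) ^ (k + 1) := by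
    have hsub : Q ⊆ Fintype.piFinset t := filter_subset _ _
    refine le_trans ?_ (sum_le_sum_of_subset_of_nonneg hsub ?_)
    · apply sum_le_sum
      intro b hb
      rw [prod_pow]
      refine mul_le_of_le_one_left (by positivity) ?_
      unfold wt
      apply prod_le_one
      · intro i _; positivity
      · intro i _
        apply div_le_one_of_le₀ _ (by positivity)
        exact_mod_cast (mem_filter.1 hb).2 i.castSucc
    · intro b _ _; positivity
  have h2 : ∑ b ∈ Fintype.piFinset t, ∏ i, (4 * ((k : ℝ) + 1) * s / nrm (b i)) ^ (k + 1) =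
      ∏ i, ∑ x ∈ t i, (4 * ((k : ℝ) + 1) * s / nrm x) ^ (k + 1) :=
    (prod_univ_sum t (fun _ x => (4 * ((k : ℝ) + 1) * s / nrm x) ^ (k + 1))).symm
  have hpb : ∀ r, ∑ x ∈ pb d r, (4 * ((k : ℝ) + 1) * s / nrm x) ^ (k + 1) ≤
      (4 * ((k : ℝ) + 1) * s) ^ (k + 1) * (cd d * (r : ℝ) ^ (d - (k + 1))) := by
    intro r
    have := jsum (k + 1) r hk
    calc _ = (4 * ((k : ℝ) + 1) * s) ^ (k + 1) * ∑ x ∈ pb d r, (1 / (nrm x : ℝ)) ^ (k + 1) := by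
          rw [mul_sum]
          apply sum_congr rfl
          intro x _
          rw [← mul_pow, mul_one_div]
      _ ≤ _ := by gcongr
  have hRr : ((R : ℕ) : ℝ) = ((k : ℝ) + 1) * s := by simp [R]
  have hfull : (4 * ((k : ℝ) + 1) * s) ^ (k + 1) * (cd d * (R : ℝ) ^ (d - (k + 1))) = D * (s : ℝ) ^ d := by
    have e : (s : ℝ) ^ d = s ^ (k + 1) * s ^ (d - (k + 1)) := by rw [← pow_add]; congr 1; omega
    rw [hRr, e, mul_pow _ (s : ℝ) (k + 1), mul_pow _ (s : ℝ) (d - (k + 1))]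
    simp only [D]; ring
  have hsmall : (4 * ((k : ℝ) + 1) * s) ^ (k + 1) * (cd d * ((R / K : ℕ) : ℝ) ^ (d - (k + 1))) ≤
      D * (s : ℝ) ^ d / K := by
    rw [← hfull]
    have a1 : ((R / K : ℕ) : ℝ) ≤ R / K := Nat.cast_div_le
    have a2 : ((R / K : ℕ) : ℝ) ^ (d - (k + 1)) ≤ (R : ℝ) ^ (d - (k + 1)) / K := by
      calc ((R / K : ℕ) : ℝ) ^ (d - (k + 1)) ≤ ((R : ℝ) / K) ^ (d - (k + 1)) := by gcongr
        _ = (R : ℝ) ^ (d - (k + 1)) / (K : ℝ) ^ (d - (k + 1)) := div_pow _ _ _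
        _ ≤ _ := by
          apply div_le_div_of_nonneg_left (by positivity) (by positivity)
          exact le_self_pow₀ hK' (by omega)
    have := cd_nonneg d
    calc _ ≤ (4 * ((k : ℝ) + 1) * s) ^ (k + 1) * (cd d * ((R : ℝ) ^ (d - (k + 1)) / K)) := by gcongr
      _ = _ := by ring
  have h3 : ∏ i, ∑ x ∈ t i, (4 * ((k : ℝ) + 1) * s / nrm x) ^ (k + 1) ≤
      (D * (s : ℝ) ^ d) ^ (k + 1) / K := by
    rw [Fin.prod_univ_succ, pow_succ']
    have a1 : ∑ x ∈ t 0, (4 * ((k : ℝ) + 1) * s / nrm x) ^ (k + 1) ≤ D * (s : ℝ) ^ d / K := by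
      simp only [t, if_true]
      exact (hpb _).trans hsmall
    have a2 : ∏ i : Fin k, ∑ x ∈ t i.succ, (4 * ((k : ℝ) + 1) * s / nrm x) ^ (k + 1) ≤
        (D * (s : ℝ) ^ d) ^ k := by
      calc _ ≤ ∏ i : Fin k, (D * (s : ℝ) ^ d) := by
            apply prod_le_prod
            · intro i _; exact sum_nonneg fun x _ => by positivity
            · intro i _
              simp only [t, Fin.succ_ne_zero, if_false]
              rw [← hfull]
              exact hpb R
        _ = _ := by simp
    calc _ ≤ D * (s : ℝ) ^ d / K * (D * (s : ℝ) ^ d) ^ k := by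
          apply mul_le_mul a1 a2
          · exact prod_nonneg fun i _ => sum_nonneg fun x _ => by positivity
          · positivity
      _ = _ := by ring
  have h4 := h0.trans (mul_le_mul_of_nonneg_left (h1.trans (h2.le.trans h3)) (by positivity))
  refine h4.trans ?_
  rw [mul_pow, ← pow_mul, mul_comm d (k + 1), mul_div_assoc', ← mul_assoc]
  gcongr
  linarith
end AffDeg

namespace AffDeg
open Finset
variable {d : ℕ}

/-- matrix count order -/
noncomputable def aM (d m k n : ℕ) : ℝ :=
  if m ≠ d then (n : ℝ) ^ (k * max m d) else (n : ℝ) ^ (d * k) * Real.log n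

lemma log_ge_one {n : ℕ} (hn : 3 ≤ n) : 1 ≤ Real.log n := by
  rw [Real.le_log_iff_exp_le (by positivity)]
  have := Real.exp_one_lt_three
  have h3 : (3 : ℝ) ≤ n := by exact_mod_cast hn
  linarith

lemma aM_pos (m k : ℕ) {n : ℕ} (hn : 3 ≤ n) : 0 < aM d m k n := by
  have := log_ge_one hn
  have h3 : (3 : ℝ) ≤ n := by exact_mod_cast hn
  unfold aM; split_ifs <;> positivity

lemma aM_mono (m k : ℕ) {n : ℕ} (hn : 3 ≤ n) : aM d m k n ≤ aM d m (k + 1) n := by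
  have := log_ge_one hn
  have h3 : (1 : ℝ) ≤ n := by exact_mod_cast (by omega : 1 ≤ n)
  unfold aM
  split_ifs
  · exact pow_le_pow_right₀ h3 (Nat.mul_le_mul_right _ (by omega))
  · gcongr <;> first | exact h3 | omega

lemma osum_lt {m k R : ℕ} (h : m < d) : osum d m k R ≤ (R : ℝ) ^ ((d - m) * (k + 1)) := by
  unfold osum
  have : ∀ s ∈ Icc 1 R, (s : ℝ) ^ (d - 1) * ((s : ℝ) ^ ((d - m) * k) / (s : ℝ) ^ m) ≤
      (R : ℝ) ^ ((d - m - 1) + (d - m) * k) := by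
    intro s hs
    rw [mem_Icc] at hs
    have hs1 : (1 : ℝ) ≤ s := by exact_mod_cast hs.1
    have hs2 : (s : ℝ) ≤ R := by exact_mod_cast hs.2
    have e : (s : ℝ) ^ (d - 1) = s ^ (d - m - 1) * s ^ m := by rw [← pow_add]; congr 1; omega
    calc _ = (s : ℝ) ^ ((d - m - 1) + (d - m) * k) := by
          rw [e, pow_add]; field_simp
      _ ≤ _ := by gcongr
  refine (sum_le_sum this).trans ?_
  rw [sum_const, Nat.card_Icc, nsmul_eq_mul]
  simp only [Nat.add_sub_cancel]
  rw [← pow_succ']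
  apply le_of_eq; congr 1
  obtain ⟨e, he⟩ : ∃ e, d - m = e + 1 := ⟨d - m - 1, by omega⟩
  rw [he]; simp; ring

lemma osum_gt {m k R : ℕ} (hd : 0 < d) (h : d < m) : osum d m k R ≤ 2 := by
  unfold osum
  have : ∀ s ∈ Icc 1 R, (s : ℝ) ^ (d - 1) * ((s : ℝ) ^ ((d - m) * k) / (s : ℝ) ^ m) ≤
      ((s : ℝ) ^ 2)⁻¹ := by
    intro s hs
    rw [mem_Icc] at hs
    have hs1 : (1 : ℝ) ≤ s := by exact_mod_cast hs.1
    rw [show d - m = 0 by omega, zero_mul, pow_zero, mul_one_div, div_le_iff₀ (by positivity),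
      le_inv_mul_iff₀ (by positivity), ← pow_add]
    exact pow_le_pow_right₀ hs1 (by omega)
  refine (sum_le_sum this).trans ?_
  have := sum_Ioo_inv_sq_le (α := ℝ) 0 (R + 1)
  have e : Icc 1 R = Ioo 0 (R + 1) := by ext; simp; omega
  rw [e]
  simpa using this

lemma osum_eq {k R : ℕ} (hd : 0 < d) : osum d d k R ≤ 1 + Real.log R := by
  have h := harmonic_le_one_add_log R
  rw [harmonic_eq_sum_Icc] at h
  push_cast at h
  refine le_trans (le_of_eq ?_) h
  unfold osum
  apply sum_congr rfl
  intro s hs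
  rw [mem_Icc] at hs
  have hs1 : (1 : ℝ) ≤ s := by exact_mod_cast hs.1
  have e : (s : ℝ) ^ d = s ^ (d - 1) * s := by rw [← pow_succ]; congr 1; omega
  rw [Nat.sub_self, zero_mul, pow_zero, e]; field_simp

lemma upper_rank (hd : 0 < d) (m k : ℕ) : ∃ C : ℝ, 0 < C ∧ ∀ n : ℕ, 3 ≤ n →
    ∀ S : Finset (Fin m → Fin d → ℤ),
    (∀ M ∈ S, (∀ i, nrm (M i) ≤ n) ∧ Module.finrank ℝ (rs M) = k + 1) →
    (S.card : ℝ) ≤ C * aM d m (k + 1) n := by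
  have hc : 0 < cd d := by unfold cd; positivity
  set A : ℝ := ((k : ℝ) + 1) ^ k * ((4 * ((k : ℝ) + 1)) ^ ((k + 1) * m) * cd d ^ (k + 1)) with hA
  have hA0 : 0 < A := by positivity
  have raw : ∀ n : ℕ, ∀ S : Finset (Fin m → Fin d → ℤ),
    (∀ M ∈ S, (∀ i, nrm (M i) ≤ n) ∧ Module.finrank ℝ (rs M) = k + 1) →
    (S.card : ℝ) ≤ A * ((n : ℝ) ^ ((k + 1) * m) * osum d m k ((k + 1) * n)) := by
    intro n S hS
    refine (upper_raw hd S hS).trans (le_of_eq ?_)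
    rw [hA, mul_pow _ (n : ℝ)]; ring
  clear_value A
  rcases lt_trichotomy m d with h | h | h
  · refine ⟨A * ((k : ℝ) + 1) ^ ((d - m) * (k + 1)), by positivity, ?_⟩
    intro n hn S hS
    refine (raw n S hS).trans ?_
    rw [mul_assoc]
    apply mul_le_mul_of_nonneg_left _ hA0.le
    rw [aM, if_pos h.ne, max_eq_right h.le]
    have := osum_lt (k := k) (R := (k + 1) * n) h
    push_cast at this
    calc _ ≤ (n : ℝ) ^ ((k + 1) * m) * (((k : ℝ) + 1) * n) ^ ((d - m) * (k + 1)) := by gcongr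
      _ = _ := by
        have e : (k + 1) * d = (k + 1) * m + (d - m) * (k + 1) := by
          obtain ⟨e, rfl⟩ := Nat.exists_eq_add_of_le h.le
          simp; ring
        rw [mul_pow, e, pow_add]; ring
  · subst h
    refine ⟨A * (2 + Real.log (k + 1)), ?_, ?_⟩
    · have : 0 ≤ Real.log ((k : ℝ) + 1) := Real.log_nonneg (by linarith [(Nat.cast_nonneg k : (0 : ℝ) ≤ k)])
      positivity
    intro n hn S hS
    refine (raw n S hS).trans ?_
    rw [mul_assoc]
    apply mul_le_mul_of_nonneg_left _ hA0.le
    rw [aM, if_neg (by simp)]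
    have h1 := osum_eq (d := m) (k := k) (R := (k + 1) * n) hd
    push_cast at h1
    have hn0 : (n : ℝ) ≠ 0 := by positivity
    have hl0 : 0 ≤ Real.log ((k : ℝ) + 1) := Real.log_nonneg (by linarith [(Nat.cast_nonneg k : (0 : ℝ) ≤ k)])
    rw [Real.log_mul (by positivity) hn0] at h1
    have hl := log_ge_one hn
    have h2 : osum m m k ((k + 1) * n) ≤ (2 + Real.log (k + 1)) * Real.log n := by nlinarith
    calc _ ≤ (n : ℝ) ^ ((k + 1) * m) * ((2 + Real.log (k + 1)) * Real.log n) := by gcongr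
      _ = _ := by rw [mul_comm (k + 1) m]; ring
  · refine ⟨A * 2, by positivity, ?_⟩
    intro n hn S hS
    refine (raw n S hS).trans ?_
    rw [mul_assoc]
    apply mul_le_mul_of_nonneg_left _ hA0.le
    rw [aM, if_pos h.ne', max_eq_left h.le]
    have := osum_gt (k := k) (R := (k + 1) * n) hd h
    rw [mul_comm]
    gcongr

lemma upper_mat (hd : 0 < d) (m k : ℕ) : ∃ C : ℝ, 0 < C ∧ ∀ n : ℕ, 3 ≤ n →
    ∀ S : Finset (Fin m → Fin d → ℤ),
    (∀ M ∈ S, (∀ i, nrm (M i) ≤ n) ∧ Module.finrank ℝ (rs M) ≤ k) →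
    (S.card : ℝ) ≤ C * aM d m k n := by
  classical
  induction k with
  | zero =>
    refine ⟨1, one_pos, ?_⟩
    intro n hn S hS
    have h1 : S.card ≤ 1 := by
      apply card_le_one.2
      have : ∀ M ∈ S, M = 0 := by
        intro M hM
        have h0 : rs M = ⊥ := Submodule.finrank_eq_zero.1 (Nat.le_zero.1 (hS M hM).2)
        funext i
        apply cst_inj
        have : cst (M i) ∈ rs M := Submodule.subset_span ⟨i, rfl⟩
        rw [h0, Submodule.mem_bot] at this
        rw [this]; exact cst_zero.symm
      intro a ha b hb
      rw [this a ha, this b hb]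
    have h2 : (1 : ℝ) ≤ aM d m 0 n := by
      unfold aM
      split_ifs
      · simp
      · simpa using log_ge_one hn
    have : (S.card : ℝ) ≤ 1 := by exact_mod_cast h1
    linarith
  | succ k ih =>
    obtain ⟨C1, hC1, h1⟩ := ih
    obtain ⟨C2, hC2, h2⟩ := upper_rank hd m k
    refine ⟨C1 + C2, by positivity, ?_⟩
    intro n hn S hS
    have a1 := h1 n hn (S.filter fun M => Module.finrank ℝ (rs M) ≤ k) (by
      intro M hM
      rw [mem_filter] at hM
      exact ⟨(hS M hM.1).1, hM.2⟩)
    have a2 := h2 n hn (S.filter fun M => ¬ Module.finrank ℝ (rs M) ≤ k) (by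
      intro M hM
      rw [mem_filter] at hM
      have := (hS M hM.1).2
      exact ⟨(hS M hM.1).1, by omega⟩)
    have a3 := card_filter_add_card_filter_not (s := S) (fun M => Module.finrank ℝ (rs M) ≤ k)
    have a4 : (S.card : ℝ) = (S.filter fun M => Module.finrank ℝ (rs M) ≤ k).card +
      (S.filter fun M => ¬ Module.finrank ℝ (rs M) ≤ k).card := by exact_mod_cast a3.symm
    have a5 := mul_le_mul_of_nonneg_left (aM_mono (d := d) m k hn) hC1.le
    rw [a4, add_mul]
    linarith

/-- points to Euclidean tuples -/
noncomputable def toT {m : ℕ} (p : (Fin d → ℤ) × (Fin m → Fin d → ℤ)) :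
    Fin (m + 1) → EuclideanSpace ℝ (Fin d) :=
  Fin.cons (WithLp.toLp 2 (cst p.1)) fun j => WithLp.toLp 2 (cst (p.1 + p.2 j))

lemma toT_inj {m : ℕ} : Function.Injective (toT (d := d) (m := m)) := by
  rintro ⟨p, M⟩ ⟨p', M'⟩ h
  have h0 := congrFun h 0
  simp only [toT, Fin.cons_zero] at h0
  have h1 : p = p' := cst_inj ((WithLp.toLp_injective 2) h0)
  subst h1
  have : M = M' := by
    funext j
    have hj := congrFun h j.succ
    simp only [toT, Fin.cons_succ] at hj
    have := cst_inj ((WithLp.toLp_injective 2) hj)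
    exact add_left_cancel this
  rw [this]

/-- the degenerate set -/
def degSet (n d k r : ℕ) : Set (Fin r → EuclideanSpace ℝ (Fin d)) :=
  {t : Fin r → EuclideanSpace ℝ (Fin d) | (∀ i, t i ∈ grid d n) ∧
    ∃ A : AffineSubspace ℝ (EuclideanSpace ℝ (Fin d)),
      Module.finrank ℝ A.direction ≤ k ∧ ∀ i, t i ∈ A}

open Classical in
lemma degSet_sub (n d k m : ℕ) : degSet n d k (m + 1) ⊆ toT ''
    (((Fintype.piFinset fun _ : Fin d => Icc (1 : ℤ) n) ×ˢ
      ((Fintype.piFinset fun _ : Fin m => box d n).filter fun M => Module.finrank ℝ (rs M) ≤ k) :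
      Finset _) : Set ((Fin d → ℤ) × (Fin m → Fin d → ℤ))) := by
  rintro t ⟨ht, A, hA, htA⟩
  have hx : ∀ i, ∃ x : Fin d → ℤ, t i = WithLp.toLp 2 (cst x) ∧ ∀ j, 1 ≤ x j ∧ x j ≤ n := by
    intro i
    choose y hy1 hy2 hy3 using ht i
    refine ⟨fun j => (y j : ℤ), ?_, ?_⟩
    · ext j; simp [hy3, cst]
    · intro j
      have h1 := hy1 j
      have h2 := hy2 j
      change 1 ≤ (y j : ℤ) ∧ (y j : ℤ) ≤ n
      omega
  choose x hx1 hx2 using hx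
  refine ⟨(x 0, fun j => x j.succ - x 0), ?_, ?_⟩
  · rw [mem_coe, mem_product, Fintype.mem_piFinset, mem_filter, Fintype.mem_piFinset]
    refine ⟨fun j => ?_, fun j => ?_, ?_⟩
    · rw [mem_Icc]; exact hx2 0 j
    · rw [mem_box, nrm_le]
      intro i
      have a1 := hx2 0 i
      have a2 := hx2 j.succ i
      simp only [Pi.sub_apply]; omega
    · let e := (WithLp.linearEquiv 2 ℝ (Fin d → ℝ))
      have hle : rs (fun j : Fin m => x j.succ - x 0) ≤ A.direction.map e.toLinearMap := by
        apply Submodule.span_le.2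
        rintro _ ⟨j, rfl⟩
        refine ⟨t j.succ -ᵥ t 0, AffineSubspace.vsub_mem_direction (htA _) (htA _), ?_⟩
        rw [hx1, hx1]
        ext i
        simp [e, cst]
      have h1 := Submodule.finrank_mono hle
      have h2 := LinearEquiv.finrank_map_eq e A.direction
      exact h1.trans (h2.le.trans hA)
  · funext i
    refine Fin.cases ?_ (fun j => ?_) i
    · simp [toT, hx1]
    · simp [toT, hx1]

lemma upper_A (n d k m : ℕ) : ∃ S : Finset (Fin m → Fin d → ℤ), 
    (∀ M ∈ S, (∀ i, nrm (M i) ≤ n) ∧ Module.finrank ℝ (rs M) ≤ k) ∧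
    affDegCount n d k (m + 1) ≤ n ^ d * S.card := by
  classical
  refine ⟨(Fintype.piFinset fun _ : Fin m => box d n).filter fun M => Module.finrank ℝ (rs M) ≤ k, ?_, ?_⟩
  · intro M hM
    rw [mem_filter, Fintype.mem_piFinset] at hM
    exact ⟨fun i => mem_box.1 (hM.1 i), hM.2⟩
  · have h1 := Set.ncard_le_ncard (degSet_sub n d k m) (Set.toFinite _)
    have h2 := h1.trans (Set.ncard_image_le (Set.toFinite _))
    rw [Set.ncard_coe_finset, card_product, Fintype.card_piFinset] at h2
    change (degSet n d k (m + 1)).ncard ≤ _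
    simpa using h2

lemma lower_A (n d k m h : ℕ) (hn : 3 * h ≤ n) (S : Finset (Fin m → Fin d → ℤ))
    (hS : ∀ M ∈ S, (∀ i, nrm (M i) ≤ h) ∧ Module.finrank ℝ (rs M) ≤ k) :
    h ^ d * S.card ≤ affDegCount n d k (m + 1) := by
  classical
  have hsub : toT '' (((Fintype.piFinset fun _ : Fin d => Icc ((h : ℤ) + 1) (2 * h)) ×ˢ S :
      Finset _) : Set ((Fin d → ℤ) × (Fin m → Fin d → ℤ))) ⊆ degSet n d k (m + 1) := by
    rintro _ ⟨⟨p, M⟩, hp, rfl⟩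
    rw [mem_coe, mem_product, Fintype.mem_piFinset] at hp
    obtain ⟨hp1, hp2⟩ := hp
    simp only [mem_Icc] at hp1 hp2
    have gr : ∀ x : Fin d → ℤ, (∀ j, 1 ≤ x j ∧ x j ≤ n) → WithLp.toLp 2 (cst x) ∈ grid d n := by
      intro x hx j
      refine ⟨(x j).toNat, ?_, ?_, ?_⟩
      · have := hx j; omega
      · have := hx j; omega
      · have h1 : ((x j).toNat : ℤ) = x j := by have := hx j; omega
        have h2 : (((x j).toNat : ℤ) : ℝ) = (x j : ℝ) := by rw [h1]
        change (x j : ℝ) = (((x j).toNat : ℕ) : ℝ)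
        rw [← h2]; norm_cast
    refine ⟨?_, AffineSubspace.mk' (WithLp.toLp 2 (cst p))
      ((rs M).map (WithLp.linearEquiv 2 ℝ (Fin d → ℝ)).symm.toLinearMap), ?_, ?_⟩
    · intro i
      refine Fin.cases ?_ (fun j => ?_) i
      · simp only [toT, Fin.cons_zero]
        apply gr
        intro j; have := hp1 j; omega
      · simp only [toT, Fin.cons_succ]
        apply gr
        intro i
        have a1 := hp1 i
        have a2 := (le_nrm (M j) i).trans ((hS M hp2).1 j)
        simp only [Pi.add_apply]; omega
    · rw [AffineSubspace.direction_mk']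
      exact (LinearEquiv.finrank_map_eq (WithLp.linearEquiv 2 ℝ (Fin d → ℝ)).symm (rs M)).le.trans (hS M hp2).2
    · intro i
      rw [AffineSubspace.mem_mk']
      refine Fin.cases ?_ (fun j => ?_) i
      · simp only [toT, Fin.cons_zero, vsub_self]; exact Submodule.zero_mem _
      · simp only [toT, Fin.cons_succ]
        refine ⟨cst (M j), Submodule.subset_span ⟨j, rfl⟩, ?_⟩
        ext i
        simp [cst]
  have hfin : (degSet n d k (m + 1)).Finite := Set.Finite.subset (Set.toFinite _) (degSet_sub n d k m)
  have h1 := Set.ncard_le_ncard hsub hfin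
  rw [Set.ncard_image_of_injective _ toT_inj, Set.ncard_coe_finset, card_product, Fintype.card_piFinset] at h1
  have e : (2 * (h : ℤ)).toNat - h = h := by omega
  change _ ≤ (degSet n d k (m + 1)).ncard
  simpa [e] using h1
end AffDeg

namespace AffDeg
open Finset
variable {d : ℕ}

/-- parameter matrices with entries in `[0,q)` -/
noncomputable def U (a b q : ℕ) : Finset (Fin a → Fin b → ℤ) :=
  Fintype.piFinset fun _ => Fintype.piFinset fun _ => Ico (0 : ℤ) q

lemma mem_U {a b q : ℕ} {u : Fin a → Fin b → ℤ} : u ∈ U a b q ↔ ∀ i j, 0 ≤ u i j ∧ u i j < q := by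
  simp [U, Fintype.mem_piFinset]

lemma card_U (a b q : ℕ) : (U a b q).card = q ^ (a * b) := by
  simp [U, Fintype.card_piFinset, ← pow_mul, mul_comm]

/-- `2u + identity` -/
def od {a b : ℕ} (u : Fin a → Fin b → ℤ) : Fin a → Fin b → ℤ :=
  fun i j => 2 * u i j + if i.val = j.val then 1 else 0

lemma od_inj {a b : ℕ} : Function.Injective (od : (Fin a → Fin b → ℤ) → _) := by
  intro u v h
  funext i j
  have := congrFun (congrFun h i) j
  simp only [od] at this
  omega

lemma od_bound {a b q : ℕ} {u : Fin a → Fin b → ℤ} (hu : u ∈ U a b q) (i : Fin a) (j : Fin b) :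
    (od u i j).natAbs ≤ 2 * q := by
  have := mem_U.1 hu i j
  simp only [od]
  split_ifs <;> omega

lemma od_nrm {a b q : ℕ} {u : Fin a → Fin b → ℤ} (hu : u ∈ U a b q) (i : Fin a) :
    nrm (od u i) ≤ 2 * q := nrm_le.2 fun j => od_bound hu i j

lemma odd_det {k : ℕ} (A V : Matrix (Fin k) (Fin k) ℤ)
    (h : ∀ i j, A i j = 2 * V i j + if i.val = j.val then 1 else 0) : A.det ≠ 0 := by
  intro h0
  have h1 : (Int.castRingHom (ZMod 2)) A.det = 1 := by
    rw [RingHom.map_det]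
    have : (Int.castRingHom (ZMod 2)).mapMatrix A = 1 := by
      ext i j
      simp only [RingHom.mapMatrix_apply, Matrix.map_apply, h, Matrix.one_apply, Fin.ext_iff]
      have h2 : (2 : ZMod 2) = 0 := by decide
      split_ifs <;> simp [h2]
    rw [this, Matrix.det_one]
  rw [h0] at h1
  simp at h1

lemma od_li {a b : ℕ} (hab : a ≤ b) (u : Fin a → Fin b → ℤ) :
    LinearIndependent ℝ (fun i => cst (od u i)) := by
  apply LinearIndependent.of_comp (LinearMap.funLeft ℝ ℝ (Fin.castLE hab))
  let A : Matrix (Fin a) (Fin a) ℤ := fun i j => od u i (Fin.castLE hab j)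
  have hA : A.det ≠ 0 := odd_det A (fun i j => u i (Fin.castLE hab j)) (fun i j => by simp [A, od])
  have hB : (A.map (Int.castRingHom ℝ)).det ≠ 0 := by
    rw [← RingHom.mapMatrix_apply, ← RingHom.map_det]
    simpa using hA
  exact Matrix.linearIndependent_rows_of_det_ne_zero hB

/-- integer combinations -/
def comb {m k : ℕ} (C : Fin m → Fin k → ℤ) (B : Fin k → Fin d → ℤ) : Fin m → Fin d → ℤ :=
  fun j => ∑ i, C j i • B i

lemma cst_comb {m k : ℕ} (C : Fin m → Fin k → ℤ) (B : Fin k → Fin d → ℤ) (j : Fin m) :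
    cst (comb C B j) = ∑ i, (C j i : ℝ) • cst (B i) := by
  simp only [comb, cst_sum, cst_smul]

lemma rs_comb_le {m k : ℕ} (C : Fin m → Fin k → ℤ) (B : Fin k → Fin d → ℤ) :
    rs (comb C B) ≤ rs B := by
  apply Submodule.span_le.2
  rintro _ ⟨j, rfl⟩
  simp only [cst_comb]
  exact Submodule.sum_mem _ fun i _ => Submodule.smul_mem _ _ (Submodule.subset_span ⟨i, rfl⟩)

lemma finrank_rs_le {k : ℕ} (B : Fin k → Fin d → ℤ) : Module.finrank ℝ (rs B) ≤ k := by
  have := finrank_range_le_card (R := ℝ) (fun i => cst (B i))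
  rw [Fintype.card_fin] at this
  exact this

lemma finrank_comb_le {m k : ℕ} (C : Fin m → Fin k → ℤ) (B : Fin k → Fin d → ℤ) :
    Module.finrank ℝ (rs (comb C B)) ≤ k :=
  (Submodule.finrank_mono (rs_comb_le C B)).trans (finrank_rs_le B)

lemma nrm_comb_le {m k c s : ℕ} (C : Fin m → Fin k → ℤ) (B : Fin k → Fin d → ℤ) (j : Fin m)
    (hC : ∀ i, (C j i).natAbs ≤ c) (hB : ∀ i, nrm (B i) ≤ s) : nrm (comb C B j) ≤ k * (c * s) := by
  refine (nrm_sum_le _ _).trans ?_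
  refine (sum_le_sum fun i _ => (nrm_smul_le _ _).trans (Nat.mul_le_mul (hC i) (hB i))).trans ?_
  simp

lemma rs_comb {m k : ℕ} (hkm : k ≤ m) (v : Fin m → Fin k → ℤ) (B : Fin k → Fin d → ℤ) :
    rs (comb (od v) B) = rs B := by
  refine le_antisymm (rs_comb_le _ _) ?_
  let A : Matrix (Fin k) (Fin k) ℤ := fun i j => od v (Fin.castLE hkm i) j
  have hA : A.det ≠ 0 := odd_det A (fun i j => v (Fin.castLE hkm i) j) (fun i j => by simp [A, od])
  apply Submodule.span_le.2
  rintro _ ⟨i, rfl⟩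
  have h1 : ∑ j, A.adjugate i j • comb (od v) B (Fin.castLE hkm j) = A.det • B i := by
    simp only [comb, smul_sum, smul_smul]
    rw [sum_comm]
    have h2 : ∀ l, ∑ j, (A.adjugate i j * od v (Fin.castLE hkm j) l) • B l =
        (if i = l then A.det else 0) • B l := by
      intro l
      rw [← sum_smul]
      congr 1
      have := congrFun (congrFun (Matrix.adjugate_mul A) i) l
      rw [Matrix.mul_apply] at this
      simp only [A] at this ⊢
      rw [this]
      simp [Matrix.one_apply]
    rw [sum_congr rfl fun l _ => h2 l]
    simp
  have h3 : (A.det : ℝ) • cst (B i) ∈ rs (comb (od v) B) := by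
    rw [← cst_smul, ← h1, cst_sum]
    refine Submodule.sum_mem _ fun j _ => ?_
    rw [cst_smul]
    exact Submodule.smul_mem _ _ (Submodule.subset_span ⟨_, rfl⟩)
  exact (Submodule.smul_mem_iff _ (by exact_mod_cast hA)).1 h3

lemma comb_inj {m k : ℕ} {C C' : Fin m → Fin k → ℤ} {B : Fin k → Fin d → ℤ}
    (hB : LinearIndependent ℝ (fun i => cst (B i))) (h : comb C B = comb C' B) : C = C' := by
  funext j i
  have h1 := congrArg cst (congrFun h j)
  rw [cst_comb, cst_comb] at h1
  have h2 : ∑ i, ((C j i : ℝ) - C' j i) • cst (B i) = 0 := by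
    simp only [sub_smul, sum_sub_distrib, h1, sub_self]
  have h3 := Fintype.linearIndependent_iff.1 hB _ h2 i
  have : (C j i : ℝ) = C' j i := by linarith
  exact_mod_cast this

lemma few_short (V : Submodule ℝ (Fin d → ℝ)) (K s : ℕ) (hK : 1 ≤ K)
    (hV : ∀ x, cst x ∈ V → x ≠ 0 → s < K * nrm x) (T : Finset (Fin d → ℤ))
    (hT : ∀ x ∈ T, cst x ∈ V ∧ nrm x ≤ s) : T.card ≤ (2 * K) ^ d := by
  classical
  have : NeZero (2 * K) := ⟨by omega⟩
  have hinj : Set.InjOn (fun (x : Fin d → ℤ) (i : Fin d) => ((x i : ℤ) : ZMod (2 * K))) T := by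
    intro x hx y hy hxy
    by_contra hne
    have hz : ∀ i, ∃ z : ℤ, x i - y i = (2 * K : ℕ) * z := by
      intro i
      have h1 := congrFun hxy i
      have h2 := ((ZMod.intCast_eq_intCast_iff_dvd_sub _ _ _).1 h1.symm)
      obtain ⟨z, hz⟩ := h2
      exact ⟨z, hz⟩
    choose z hz using hz
    have e : x - y = (2 * K) • z := by
      funext i
      simp [hz]
    have hm : cst z ∈ V := by
      have h1 : cst (x - y) ∈ V := by
        rw [cst_sub]; exact V.sub_mem (hT x hx).1 (hT y hy).1
      rw [e, cst_nsmul] at h1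
      refine (Submodule.smul_mem_iff _ ?_).1 h1
      have : (2 * K : ℕ) ≠ 0 := by omega
      exact_mod_cast this
    have hz0 : z ≠ 0 := by
      rintro rfl
      rw [smul_zero] at e
      exact hne (sub_eq_zero.1 e)
    have h1 := hV z hm hz0
    have h2 := nrm_nsmul (2 * K) z
    rw [← e] at h2
    have h3 := nrm_sub_le x y
    have h4 := (hT x hx).2
    have h5 := (hT y hy).2
    nlinarith
  have h1 := card_le_card_of_injOn (t := (univ : Finset (Fin d → ZMod (2 * K)))) _
    (fun _ _ => mem_coe.2 (mem_univ _)) hinj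
  simpa [ZMod.card] using h1

lemma scale_count {k : ℕ} (hk : k + 1 < d) : ∃ (K₀ : ℕ) (c : ℝ), 1 ≤ K₀ ∧ 0 < c ∧
    ∀ q t h : ℕ, (k + 1) * (2 * t * (2 * q)) ≤ h → ∃ S : Finset (Fin d → Fin d → ℤ),
      (∀ M ∈ S, (∀ j, nrm (M j) ≤ h) ∧ Module.finrank ℝ (rs M) ≤ k + 1 ∧
        (∀ x, cst x ∈ rs M → x ≠ 0 → 2 * q < 2 * K₀ * nrm x) ∧
        ∃ x, cst x ∈ rs M ∧ x ≠ 0 ∧ nrm x ≤ 2 * q) ∧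
      c * ((q : ℝ) * t) ^ ((k + 1) * d) ≤ S.card := by
  classical
  obtain ⟨C, hC, hbad⟩ := bad_count hk
  obtain ⟨K₀, hK₀⟩ := exists_nat_ge (C * 2 ^ ((k + 1) * d) + 1)
  have hK1 : 1 ≤ K₀ := by
    have : (0 : ℝ) ≤ C * 2 ^ ((k + 1) * d) := by positivity
    have : (1 : ℝ) ≤ K₀ := by linarith
    exact_mod_cast this
  have hKpos : (0 : ℝ) < (2 * K₀ : ℕ) := by exact_mod_cast (by omega : 0 < 2 * K₀)
  set D : ℝ := ((((2 * (2 * K₀)) ^ d) ^ (k + 1) : ℕ) : ℝ) with hD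
  have hDpos : 0 < D := by rw [hD]; positivity
  refine ⟨K₀, 1 / (2 * D), hK1, by positivity, ?_⟩
  intro q t h hh
  set P : (Fin (k + 1) → Fin d → ℤ) → Prop := fun u =>
    ∃ x, cst x ∈ rs (od u) ∧ x ≠ 0 ∧ (2 * K₀) * nrm x ≤ 2 * q with hP
  set Bd := (U (k + 1) d q).filter P with hBd
  set G := (U (k + 1) d q).filter fun u => ¬ P u with hG
  have hcard : Bd.card + G.card = q ^ ((k + 1) * d) := by
    rw [← card_U, hBd, hG, card_filter_add_card_filter_not]
  have hBdc : (Bd.card : ℝ) ≤ (q : ℝ) ^ ((k + 1) * d) / 2 := by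
    have h1 := hbad (2 * K₀) (2 * q) (by omega) (Bd.image od) ?_ ?_
    · rw [card_image_of_injective _ od_inj] at h1
      refine h1.trans ?_
      rw [div_le_div_iff₀ hKpos two_pos]
      push_cast
      rw [mul_pow]
      have : (0 : ℝ) ≤ (q : ℝ) ^ ((k + 1) * d) := by positivity
      nlinarith
    · intro M hM
      obtain ⟨u, hu, rfl⟩ := mem_image.1 hM
      rw [hBd, mem_filter] at hu
      refine ⟨fun i => od_nrm hu.1 i, ?_⟩
      have := finrank_span_eq_card (od_li hk.le u)
      rw [Fintype.card_fin] at this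
      exact this
    · intro M hM
      obtain ⟨u, hu, rfl⟩ := mem_image.1 hM
      rw [hBd, mem_filter] at hu
      exact hu.2
  have hGc : (q : ℝ) ^ ((k + 1) * d) / 2 ≤ G.card := by
    have : (Bd.card : ℝ) + G.card = (q : ℝ) ^ ((k + 1) * d) := by exact_mod_cast hcard
    linarith
  let F : (Fin (k + 1) → Fin d → ℤ) × (Fin d → Fin (k + 1) → ℤ) → Fin d → Fin d → ℤ :=
    fun p => comb (od p.2) (od p.1)
  have hrs : ∀ p, rs (F p) = rs (od p.1) := fun p => rs_comb hk.le _ _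
  have hprop : ∀ u ∈ G, ∀ x, cst x ∈ rs (od u) → x ≠ 0 → 2 * q < 2 * K₀ * nrm x := by
    intro u hu x hx hx0
    rw [hG, mem_filter] at hu
    by_contra hc
    exact hu.2 ⟨x, hx, hx0, by omega⟩
  refine ⟨(G ×ˢ U d (k + 1) t).image F, ?_, ?_⟩
  · intro M hM
    obtain ⟨⟨u, v⟩, huv, rfl⟩ := mem_image.1 hM
    rw [mem_product] at huv
    obtain ⟨hu, hv⟩ := huv
    simp only at hu hv
    have hu' : u ∈ U (k + 1) d q := (mem_filter.1 hu).1
    rw [hrs]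
    refine ⟨fun j => ?_, finrank_rs_le _, hprop u hu, ?_⟩
    · exact (nrm_comb_le _ _ j (fun i => od_bound hv j i) (fun i => od_nrm hu' i)).trans hh
    · refine ⟨od u 0, Submodule.subset_span ⟨0, rfl⟩, ?_, od_nrm hu' 0⟩
      intro h0
      apply (od_li hk.le u).ne_zero 0
      simp only [h0, cst_zero]
  · have hfib : (G ×ˢ U d (k + 1) t).card ≤
        ((2 * (2 * K₀)) ^ d) ^ (k + 1) * ((G ×ˢ U d (k + 1) t).image F).card := by
      apply card_le_mul_card_image
      intro M hM
      obtain ⟨⟨u₀, v₀⟩, huv₀, hM0⟩ := mem_image.1 hM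
      rw [mem_product] at huv₀
      set T := (box d (2 * q)).filter fun x => cst x ∈ rs M with hT
      have hTc : T.card ≤ (2 * (2 * K₀)) ^ d := by
        apply few_short (rs M) (2 * K₀) (2 * q) (by omega)
        · rw [← hM0, hrs]
          exact hprop u₀ huv₀.1
        · intro x hx
          rw [hT, mem_filter, mem_box] at hx
          exact ⟨hx.2, hx.1⟩
      have h1 : ((G ×ˢ U d (k + 1) t).filter fun p => F p = M).card ≤
          (Fintype.piFinset fun _ : Fin (k + 1) => T).card := by
        apply card_le_card_of_injOn (fun p => od p.1)
        · rintro ⟨u, v⟩ hp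
          rw [mem_coe, mem_filter, mem_product] at hp
          rw [mem_coe, Fintype.mem_piFinset]
          intro i
          rw [hT, mem_filter, mem_box]
          refine ⟨od_nrm (mem_filter.1 hp.1.1).1 i, ?_⟩
          rw [← hp.2, hrs]
          exact Submodule.subset_span ⟨i, rfl⟩
        · rintro ⟨u, v⟩ hp ⟨u', v'⟩ hp' he
          rw [mem_coe, mem_filter] at hp hp'
          have e1 : u = u' := od_inj he
          subst e1
          have e2 : F (u, v) = F (u, v') := hp.2.trans hp'.2.symm
          have e3 := od_inj (comb_inj (od_li hk.le u) e2)
          exact congrArg (Prod.mk u) e3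
      rw [Fintype.card_piFinset] at h1
      simp only [prod_const, card_univ, Fintype.card_fin] at h1
      exact h1.trans (Nat.pow_le_pow_left hTc _)
    rw [card_product, card_U] at hfib
    have hfib' : (G.card : ℝ) * (t : ℝ) ^ (d * (k + 1)) ≤
        D * ((G ×ˢ U d (k + 1) t).image F).card := by
      rw [hD]; exact_mod_cast hfib
    rw [mul_comm d (k + 1)] at hfib'
    have ht : (0 : ℝ) ≤ (t : ℝ) ^ ((k + 1) * d) := by positivity
    have h2 := (mul_le_mul_of_nonneg_right hGc ht).trans hfib'
    rw [mul_pow, div_mul_eq_mul_div, div_le_iff₀ (by positivity)]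
    linarith

end AffDeg

namespace AffDeg
open Finset
variable {d : ℕ}

lemma lower_log {k : ℕ} (hk : k + 1 < d) : ∃ c : ℝ, 0 < c ∧ ∃ N : ℕ, ∀ h ≥ N,
    ∃ S : Finset (Fin d → Fin d → ℤ),
      (∀ M ∈ S, (∀ j, nrm (M j) ≤ h) ∧ Module.finrank ℝ (rs M) ≤ k + 1) ∧
      c * ((h : ℝ) ^ (d * (k + 1)) * Real.log h) ≤ S.card := by
  classical
  obtain ⟨K₀, c, hK, hc, hsc⟩ := scale_count hk
  set K := 2 * K₀ with hKdef
  have hK2 : 2 ≤ K := by omega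
  have hlogK : 0 < Real.log K := Real.log_pos (by exact_mod_cast (by omega : 1 < K))
  set a : ℝ := Real.log (2 * (k + 1) : ℕ) + Real.log K with ha
  obtain ⟨N₀, hN₀⟩ := Filter.eventually_atTop.1
    ((Real.tendsto_log_atTop.comp tendsto_natCast_atTop_atTop).eventually_ge_atTop (2 * a))
  refine ⟨c * (1 / (8 * (k + 1))) ^ ((k + 1) * d) * (1 / (2 * Real.log K)), by positivity,
    N₀ + 2 * (k + 1), ?_⟩
  intro h hh
  have hlog : 2 * a ≤ Real.log h := hN₀ h (by omega)
  have hh1 : 2 * (k + 1) ≤ h := by omega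
  set H := h / (2 * (k + 1)) with hH
  have hHpos : 1 ≤ H := (Nat.one_le_div_iff (by omega)).2 hh1
  set L := Nat.log K H with hL
  have hL1 : K ^ L ≤ H := Nat.pow_log_le_self K (by omega)
  have hL2 : H < K ^ (L + 1) := Nat.lt_pow_succ_log_self (by omega) H
  have hL3 : h < 2 * (k + 1) * K ^ (L + 1) := by
    rw [hH, Nat.div_lt_iff_lt_mul (by omega)] at hL2
    linarith
  have hLlog : Real.log h / (2 * Real.log K) ≤ L := by
    have hpos : (0 : ℝ) < h := by exact_mod_cast (by omega : 0 < h)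
    have h1 : (h : ℝ) ≤ ((2 * (k + 1) : ℕ) : ℝ) * (K : ℝ) ^ (L + 1) := by exact_mod_cast hL3.le
    have h2 := Real.log_le_log hpos h1
    have hK0 : (K : ℝ) ≠ 0 := by
      have : K ≠ 0 := by omega
      exact_mod_cast this
    rw [Real.log_mul (by positivity) (by positivity), Real.log_pow] at h2
    push_cast at h2 ha
    rw [div_le_iff₀ (by positivity)]
    rw [ha] at hlog
    nlinarith
  -- scales
  have key : ∀ i : ℕ, ∃ S : Finset (Fin d → Fin d → ℤ), i < L →
      (∀ M ∈ S, (∀ j, nrm (M j) ≤ h) ∧ Module.finrank ℝ (rs M) ≤ k + 1 ∧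
        (∀ x, cst x ∈ rs M → x ≠ 0 → K ^ (i + 1) < K * nrm x) ∧
        ∃ x, cst x ∈ rs M ∧ x ≠ 0 ∧ nrm x ≤ K ^ (i + 1)) ∧
      c * ((1 / (8 * (k + 1))) * (h : ℝ)) ^ ((k + 1) * d) ≤ S.card := by
    intro i
    by_cases hi : i < L
    swap
    · exact ⟨∅, fun h => absurd h hi⟩
    set q := K₀ * K ^ i with hq
    have hs : 2 * q = K ^ (i + 1) := by rw [hq, pow_succ, hKdef]; ring
    set w := 2 * (k + 1) * K ^ (i + 1) with hw
    have hwpos : 0 < w := by positivity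
    have hwh : w ≤ h := by
      have h1 : K ^ (i + 1) ≤ K ^ L := Nat.pow_le_pow_right (by omega) hi
      have h2 : H * (2 * (k + 1)) ≤ h := Nat.div_mul_le_self _ _
      rw [hw]
      nlinarith
    set t := h / w with ht
    have ht1 : t * w ≤ h := Nat.div_mul_le_self _ _
    have ht2 : h < (t + 1) * w := by
      have := Nat.lt_div_mul_add hwpos (a := h)
      rw [← ht] at this
      linarith
    have ht3 : 1 ≤ t := (Nat.one_le_div_iff hwpos).2 hwh
    obtain ⟨S, hS1, hS2⟩ := hsc q t h (by
      calc (k + 1) * (2 * t * (2 * q)) = t * w := by rw [hs, hw]; ring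
        _ ≤ h := ht1)
    refine ⟨S, fun _ => ⟨?_, ?_⟩⟩
    · rw [hs] at hS1
      exact hS1
    · refine le_trans ?_ hS2
      have h8 : h ≤ 8 * (k + 1) * (q * t) := by
        have : 8 * (k + 1) * (q * t) = 2 * t * w := by rw [hw, ← hs]; ring
        rw [this]; nlinarith
      have h8' : (h : ℝ) ≤ 8 * (k + 1) * (q * t) := by exact_mod_cast h8
      have h9 : (1 / (8 * (k + 1))) * (h : ℝ) ≤ q * t := by
        rw [one_div, inv_mul_le_iff₀ (by positivity)]
        exact h8'
      exact mul_le_mul_of_nonneg_left (pow_le_pow_left₀ (by positivity) h9 _) hc.le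
  choose S hS using key
  refine ⟨(range L).biUnion S, ?_, ?_⟩
  · intro M hM
    obtain ⟨i, hi, hMi⟩ := mem_biUnion.1 hM
    have := (hS i (mem_range.1 hi)).1 M hMi
    exact ⟨this.1, this.2.1⟩
  · have hlt : ∀ i j, i < j → j < L → Disjoint (S i) (S j) := by
      intro i j hij hj
      rw [disjoint_left]
      intro M hMi hMj
      obtain ⟨x, hx, hx0, hxn⟩ := ((hS i (hij.trans hj)).1 M hMi).2.2.2
      have h1 := ((hS j hj).1 M hMj).2.2.1 x hx hx0
      have h2 : K ^ (i + 1 + 1) ≤ K ^ (j + 1) := Nat.pow_le_pow_right (by omega) (by omega)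
      have h3 : K * nrm x ≤ K ^ (i + 1 + 1) := by
        rw [pow_succ, mul_comm (K ^ (i + 1))]
        exact Nat.mul_le_mul_left _ hxn
      omega
    rw [card_biUnion]
    · push_cast
      have h1 : ∑ i ∈ range L, c * ((1 / (8 * (k + 1))) * (h : ℝ)) ^ ((k + 1) * d) ≤
          ∑ i ∈ range L, ((S i).card : ℝ) := sum_le_sum fun i hi => (hS i (mem_range.1 hi)).2
      refine le_trans ?_ h1
      rw [sum_const, card_range, nsmul_eq_mul, mul_comm d (k + 1), mul_pow]
      have h2 : (0 : ℝ) ≤ c * ((1 / (8 * (k + 1))) ^ ((k + 1) * d) * (h : ℝ) ^ ((k + 1) * d)) := by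
        positivity
      refine le_trans (le_of_eq ?_) (mul_le_mul_of_nonneg_right hLlog h2)
      ring
    · intro i hi j hj hij
      rw [mem_coe, mem_range] at hi hj
      rcases lt_or_gt_of_ne hij with h1 | h1
      · exact hlt i j h1 hj
      · exact (hlt j i h1 hi).symm

lemma lower_wide {m k : ℕ} (hkd : k ≤ d) (h : ℕ) : ∃ S : Finset (Fin m → Fin d → ℤ),
    (∀ M ∈ S, (∀ j, nrm (M j) ≤ h) ∧ Module.finrank ℝ (rs M) ≤ k) ∧ S.card = h ^ (k * m) := by
  classical
  refine ⟨(U m k h).image fun w => comb w (od (0 : Fin k → Fin d → ℤ)), ?_, ?_⟩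
  · intro M hM
    obtain ⟨w, hw, rfl⟩ := mem_image.1 hM
    refine ⟨fun j => ?_, finrank_comb_le _ _⟩
    rw [nrm_le]
    intro i
    simp only [comb, od, Finset.sum_apply, Pi.smul_apply, Pi.zero_apply, smul_eq_mul, mul_zero,
      zero_add, mul_ite, mul_one]
    by_cases hi : i.val < k
    · rw [sum_eq_single ⟨i.val, hi⟩]
      · simp only [if_true]
        have := mem_U.1 hw j ⟨i.val, hi⟩
        omega
      · intro b _ hb
        rw [if_neg]
        intro h; exact hb (Fin.ext h)
      · simp
    · rw [sum_eq_zero]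
      · simp
      · intro b _
        rw [if_neg]
        have := b.2
        omega
  · rw [card_image_of_injective, card_U, mul_comm]
    intro w w' he
    exact comb_inj (od_li hkd 0) he

lemma lower_tall {m k : ℕ} (hkm : k ≤ m) (h : ℕ) : ∃ S : Finset (Fin m → Fin d → ℤ),
    (∀ M ∈ S, (∀ j, nrm (M j) ≤ h) ∧ Module.finrank ℝ (rs M) ≤ k) ∧ S.card = h ^ (k * d) := by
  classical
  have e1 : ∀ (w : Fin k → Fin d → ℤ) (j : Fin k),
      comb (od (0 : Fin m → Fin k → ℤ)) w (Fin.castLE hkm j) = w j := by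
    intro w j
    simp only [comb, od, Pi.zero_apply, mul_zero, zero_add, Fin.val_castLE]
    rw [sum_eq_single j]
    · simp
    · intro b _ hb
      rw [if_neg, zero_smul]
      intro h; exact hb (Fin.ext h.symm)
    · simp
  refine ⟨(U k d h).image fun w => comb (od (0 : Fin m → Fin k → ℤ)) w, ?_, ?_⟩
  · intro M hM
    obtain ⟨w, hw, rfl⟩ := mem_image.1 hM
    refine ⟨fun j => ?_, finrank_comb_le _ _⟩
    by_cases hj : j.val < k
    · have := e1 w ⟨j.val, hj⟩
      have e2 : Fin.castLE hkm ⟨j.val, hj⟩ = j := Fin.ext rfl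
      rw [e2] at this
      simp only [this, nrm_le]
      intro i
      have := mem_U.1 hw ⟨j.val, hj⟩ i
      omega
    · have : comb (od (0 : Fin m → Fin k → ℤ)) w j = 0 := by
        simp only [comb, od, Pi.zero_apply, mul_zero, zero_add]
        apply sum_eq_zero
        intro b _
        rw [if_neg, zero_smul]
        have := b.2
        omega
      simp only [this, nrm_le]
      simp
  · rw [card_image_of_injective, card_U]
    intro w w' he
    funext j
    rw [← e1 w j, ← e1 w' j]
    exact congrFun he _

lemma lower_mat {m k : ℕ} (hk : 0 < k) (hkd : k < d) (hkm : k ≤ m) : ∃ c : ℝ, 0 < c ∧ ∃ N : ℕ,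
    ∀ h ≥ N, ∃ S : Finset (Fin m → Fin d → ℤ),
      (∀ M ∈ S, (∀ j, nrm (M j) ≤ h) ∧ Module.finrank ℝ (rs M) ≤ k) ∧
      c * aM d m k h ≤ S.card := by
  rcases lt_trichotomy m d with hm | hm | hm
  · refine ⟨1, one_pos, 0, fun h _ => ?_⟩
    obtain ⟨S, h1, h2⟩ := lower_tall (d := d) hkm h
    refine ⟨S, h1, ?_⟩
    rw [h2, aM, if_pos hm.ne, max_eq_right hm.le]
    push_cast; rw [one_mul]
  · subst hm
    obtain ⟨k, rfl⟩ : ∃ k', k = k' + 1 := ⟨k - 1, by omega⟩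
    obtain ⟨c, hc, N, h1⟩ := lower_log hkd
    refine ⟨c, hc, N, fun h hh => ?_⟩
    obtain ⟨S, h2, h3⟩ := h1 h hh
    refine ⟨S, h2, ?_⟩
    rw [aM, if_neg (by simp)]
    exact h3
  · refine ⟨1, one_pos, 0, fun h _ => ?_⟩
    obtain ⟨S, h1, h2⟩ := lower_wide (m := m) hkd.le h
    refine ⟨S, h1, ?_⟩
    rw [h2, aM, if_pos hm.ne', max_eq_left hm.le]
    push_cast; rw [one_mul]

lemma adkr_eq (d k m n : ℕ) : adkr d k (m + 1) n = (n : ℝ) ^ d * aM d m k n := by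
  unfold adkr aM
  simp only [Nat.add_sub_cancel]
  split_ifs
  · rw [pow_add]
  · rw [mul_add, pow_add, mul_one]; ring

lemma aM_scale (m k n : ℕ) (hn : 36 ≤ n) :
    (1 / 2) * (1 / 6) ^ (k * max m d) * aM d m k n ≤ aM d m k (n / 3) := by
  have h6 : (1 / 6) * (n : ℝ) ≤ (n / 3 : ℕ) := by
    have : n ≤ 6 * (n / 3) := by omega
    have : (n : ℝ) ≤ 6 * (n / 3 : ℕ) := by exact_mod_cast this
    linarith
  have hn' : (36 : ℝ) ≤ n := by exact_mod_cast hn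
  unfold aM
  split_ifs with hm
  · have h1 := pow_le_pow_left₀ (by positivity) h6 (k * max m d)
    rw [mul_pow] at h1
    have : (0 : ℝ) ≤ (1 / 6) ^ (k * max m d) * (n : ℝ) ^ (k * max m d) := by positivity
    nlinarith
  · push Not at hm
    subst hm
    rw [max_self, mul_comm k m]
    have h1 := pow_le_pow_left₀ (by positivity) h6 (m * k)
    rw [mul_pow] at h1
    have h2 : (1 / 2) * Real.log n ≤ Real.log (n / 3 : ℕ) := by
      have h3 : Real.log n ≤ Real.log (((n / 3 : ℕ) : ℝ) ^ 2) := by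
        apply Real.log_le_log (by linarith)
        have := pow_le_pow_left₀ (by positivity) h6 2
        nlinarith
      rw [Real.log_pow] at h3
      push_cast at h3 ⊢
      linarith
    have h4 : 0 ≤ Real.log n := Real.log_nonneg (by linarith)
    have h5 := mul_le_mul h1 h2 (by positivity) (by positivity)
    refine le_trans (le_of_eq ?_) h5
    ring

theorem final (d k r : ℕ) (hd : 0 < d) (hk : 0 < k)
    (hkd : k < d) (hrk : k + 2 ≤ r) :
    ∃ c₁ c₂ : ℝ, 0 < c₁ ∧ 0 < c₂ ∧ ∃ N : ℕ, ∀ n ≥ N,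
      c₁ * adkr d k r n ≤ (affDegCount n d k r : ℝ) ∧
      (affDegCount n d k r : ℝ) ≤ c₂ * adkr d k r n := by
  obtain ⟨m, rfl⟩ : ∃ m, r = m + 1 := ⟨r - 1, by omega⟩
  obtain ⟨C, hC, hup⟩ := upper_mat hd m k
  obtain ⟨c, hc, N, hlow⟩ := lower_mat (d := d) (m := m) hk hkd (by omega)
  refine ⟨(1 / 6) ^ d * c * ((1 / 2) * (1 / 6) ^ (k * max m d)), C, by positivity, hC,
    3 * N + 36, ?_⟩
  intro n hn
  rw [adkr_eq]
  constructor
  · obtain ⟨S, hS, hSc⟩ := hlow (n / 3) (by omega)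
    have h1 := lower_A n d k m (n / 3) (by omega) S hS
    have h2 : (((n / 3 : ℕ) : ℝ)) ^ d * S.card ≤ affDegCount n d k (m + 1) := by exact_mod_cast h1
    refine le_trans ?_ h2
    have h6 : (1 / 6) * (n : ℝ) ≤ (n / 3 : ℕ) := by
      have : n ≤ 6 * (n / 3) := by omega
      have : (n : ℝ) ≤ 6 * (n / 3 : ℕ) := by exact_mod_cast this
      linarith
    have h3 := pow_le_pow_left₀ (by positivity) h6 d
    rw [mul_pow] at h3
    have h4 := (mul_le_mul_of_nonneg_left (aM_scale (d := d) m k n (by omega)) hc.le).trans hSc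
    have h5 := aM_pos (d := d) m k (n := n) (by omega)
    have h7 := mul_le_mul h3 h4 (by positivity) (by positivity)
    refine le_trans (le_of_eq ?_) h7
    ring
  · obtain ⟨S, hS, hSc⟩ := upper_A n d k m
    have h1 := hup n (by omega) S hS
    have h2 : (affDegCount n d k (m + 1) : ℝ) ≤ (n : ℝ) ^ d * S.card := by exact_mod_cast hSc
    refine h2.trans ?_
    have h3 : (0 : ℝ) ≤ (n : ℝ) ^ d := by positivity
    refine (mul_le_mul_of_nonneg_left h1 h3).trans (le_of_eq ?_)
    ring

end AffDeg

theorem affine_degenerate_tuples_count (d k r : ℕ) (hd : 0 < d) (hk : 0 < k) (hr : 0 < r)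
    (hkd : k < d) (hrk : k + 2 ≤ r) :
    ∃ c₁ c₂ : ℝ, 0 < c₁ ∧ 0 < c₂ ∧ ∃ N : ℕ, ∀ n ≥ N,
      c₁ * adkr d k r n ≤ (affDegCount n d k r : ℝ) ∧
      (affDegCount n d k r : ℝ) ≤ c₂ * adkr d k r n := by
  exact AffDeg.final d k r hd hk hkd hrk
end

section
/- Let d, k, r be positive integers with k < min{d, r}, and let L(n,d,k,r) denote the number of ordered r-tuples of points of [n]^d all of whose entries lie in a common linear subspace of ℝ^d of dimension at most k. Define l_{d,k,r}(n) = n^{k·max{r, d}} if r ≠ d, and l_{d,k,r}(n) = n^{kd} · log n if r = d. Then there exist constants c_1, c_2 > 0 and N ∈ ℕ such that c_1 · l_{d,k,r}(n) ≤ L(n,d,k,r) ≤ c_2 · l_{d,k,r}(n) for all n ≥ N. -/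
/-- `L(n,d,k,r)`: the number of ordered `r`-tuples of points of `[n]^d` all of whose entries
lie in a common linear subspace of `ℝ^d` of dimension at most `k`. -/
noncomputable def linDegCount (n d k r : ℕ) : ℕ :=
  {t : Fin r → EuclideanSpace ℝ (Fin d) | (∀ i, t i ∈ grid d n) ∧
    ∃ W : Submodule ℝ (EuclideanSpace ℝ (Fin d)),
      Module.finrank ℝ W ≤ k ∧ ∀ i, t i ∈ W}.ncard

/-- The function `l_{d,k,r}(n)` from Proposition 1.10. -/
noncomputable def ldkr (d k r n : ℕ) : ℝ :=
  if r ≠ d then (n : ℝ) ^ (k * max r d)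
  else (n : ℝ) ^ (k * d) * Real.log n

/-- Integer matrices with entries in `[1,n]` and rank at most `k`. -/
def mats (n k : ℕ) (ι κ : Type) [Fintype ι] [Fintype κ] : Set (Matrix ι κ ℤ) :=
  {M | (∀ i j, 1 ≤ M i j ∧ M i j ≤ n) ∧ (M.map (Int.cast : ℤ → ℝ)).rank ≤ k}

lemma mats_finite (n k : ℕ) (ι κ : Type) [Fintype ι] [Fintype κ] : (mats n k ι κ).Finite := by
  classical
  apply Set.Finite.subset (Set.finite_Icc (fun (_ : ι) (_ : κ) => (1 : ℤ)) (fun _ _ => (n : ℤ)))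
  intro M hM
  exact ⟨fun i j => (hM.1 i j).1, fun i j => (hM.1 i j).2⟩

lemma mats_reindex (n k : ℕ) {ι κ ι' κ' : Type} [Fintype ι] [Fintype κ] [Fintype ι'] [Fintype κ']
    (e : ι ≃ ι') (f : κ ≃ κ') : (mats n k ι κ).ncard ≤ (mats n k ι' κ').ncard := by
  classical
  refine Set.ncard_le_ncard_of_injOn (fun M => M.submatrix e.symm f.symm) ?_ ?_ (mats_finite _ _ _ _)
  · intro M hM
    refine ⟨fun i j => hM.1 _ _, ?_⟩
    have := hM.2
    have h2 : ((M.submatrix e.symm f.symm).map (Int.cast : ℤ → ℝ)) =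
      (M.map (Int.cast : ℤ → ℝ)).submatrix e.symm f.symm := rfl
    rw [h2, Matrix.rank_submatrix]
    exact this
  · intro M _ M' _ h
    ext i j
    have := congrFun (congrFun h (e i)) (f j)
    simpa using this

lemma mats_transpose (n k : ℕ) (ι κ : Type) [Fintype ι] [Fintype κ] :
    (mats n k ι κ).ncard ≤ (mats n k κ ι).ncard := by
  classical
  refine Set.ncard_le_ncard_of_injOn (fun M => M.transpose) ?_ ?_ (mats_finite _ _ _ _)
  · intro M hM
    refine ⟨fun i j => hM.1 _ _, ?_⟩
    have h2 : (M.transpose.map (Int.cast : ℤ → ℝ)) =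
      (M.map (Int.cast : ℤ → ℝ)).transpose := rfl
    rw [h2, Matrix.rank_transpose]
    exact hM.2
  · intro M _ M' _ h
    exact Matrix.transpose_injective h

/-- column of an integer matrix as a Euclidean vector -/
noncomputable def colv {d r : ℕ} (M : Matrix (Fin d) (Fin r) ℤ) (j : Fin r) :
    EuclideanSpace ℝ (Fin d) := WithLp.toLp 2 (fun i => (M i j : ℝ))

lemma rank_le_iff {d r k : ℕ} (M : Matrix (Fin d) (Fin r) ℤ) :
    (M.map (Int.cast : ℤ → ℝ)).rank ≤ k ↔
    ∃ W : Submodule ℝ (EuclideanSpace ℝ (Fin d)),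
      Module.finrank ℝ W ≤ k ∧ ∀ j, colv M j ∈ W := by
  set e := (WithLp.linearEquiv 2 ℝ (Fin d → ℝ)) with he
  have hcol : ∀ j, e (colv M j) = (M.map (Int.cast : ℤ → ℝ)).col j := by
    intro j; rfl
  rw [Matrix.rank_eq_finrank_span_cols]
  constructor
  · intro h
    refine ⟨(Submodule.span ℝ (Set.range (M.map (Int.cast : ℤ → ℝ)).col)).comap
      (e : EuclideanSpace ℝ (Fin d) →ₗ[ℝ] (Fin d → ℝ)), ?_, ?_⟩
    · rw [Submodule.comap_equiv_eq_map_symm, LinearEquiv.finrank_map_eq]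
      exact h
    · intro j
      rw [Submodule.mem_comap]
      apply Submodule.subset_span
      exact ⟨j, (hcol j).symm⟩
  · rintro ⟨W, hW, hj⟩
    have : Submodule.span ℝ (Set.range (M.map (Int.cast : ℤ → ℝ)).col) ≤
        W.map (e : EuclideanSpace ℝ (Fin d) →ₗ[ℝ] (Fin d → ℝ)) := by
      rw [Submodule.span_le]
      rintro _ ⟨j, rfl⟩
      exact ⟨colv M j, hj j, hcol j⟩
    refine (Submodule.finrank_mono this).trans ?_
    rw [LinearEquiv.finrank_map_eq]
    exact hW

lemma linDegCount_eq (n d k r : ℕ) : linDegCount n d k r = (mats n k (Fin d) (Fin r)).ncard := by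
  unfold linDegCount
  have hinj : Function.Injective (fun (M : Matrix (Fin d) (Fin r) ℤ) => colv M) := by
    intro M M' h
    ext i j
    have := congrFun h j
    have := congrArg (fun v => v i) this
    simpa [colv] using this
  rw [← Set.ncard_image_of_injective _ hinj]
  congr 1
  ext t
  constructor
  · rintro ⟨h1, h2⟩
    choose m hm1 hm2 hm3 using h1
    obtain ⟨M, hM⟩ : ∃ M : Matrix (Fin d) (Fin r) ℤ, ∀ i j, M i j = (m j i : ℤ) :=
      ⟨fun i j => (m j i : ℤ), fun _ _ => rfl⟩
    have ht : colv M = t := by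
      funext j
      ext i
      simp [colv, hm3, hM]
    refine ⟨M, ⟨fun i j => ?_, ?_⟩, ht⟩
    · rw [hM]
      exact ⟨by exact_mod_cast hm1 j i, by exact_mod_cast hm2 j i⟩
    rw [rank_le_iff, ht]
    exact h2
  · rintro ⟨M, hM, rfl⟩
    refine ⟨fun j i => ⟨(M i j).toNat, ?_, ?_, ?_⟩, (rank_le_iff M).1 hM.2⟩
    · have := hM.1 i j; omega
    · have := hM.1 i j; omega
    · have h : ((M i j).toNat : ℤ) = M i j := by have := hM.1 i j; omega
      have h' : (((M i j).toNat : ℤ) : ℝ) = M i j := by rw [h]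
      rw [Int.cast_natCast] at h'
      exact h'.symm

lemma exists_reduced {E : Type} [NormedAddCommGroup E] [InnerProductSpace ℝ E]
    [FiniteDimensional ℝ E] (k : ℕ) : ∃ K : ℝ, 1 ≤ K ∧ ∀ Λ : AddSubgroup E,
      (∀ R : ℝ, {v | v ∈ Λ ∧ ‖v‖ ≤ R}.Finite) →
      Module.finrank ℝ (Submodule.span ℝ (Λ : Set E)) ≤ k →
      ∃ b : Fin k → E, (∀ i, b i ∈ Λ) ∧ ∀ v ∈ Λ, ∃ c : Fin k → ℤ,
        v = ∑ i, c i • b i ∧ ∀ i, |(c i : ℝ)| * ‖b i‖ ≤ K * ‖v‖ := by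
  induction k with
  | zero =>
    refine ⟨1, le_rfl, fun Λ _ h => ⟨fun i => i.elim0, fun i => i.elim0, fun v hv =>
      ⟨fun i => i.elim0, ?_, fun i => i.elim0⟩⟩⟩
    have h0 : Submodule.span ℝ (Λ : Set E) = ⊥ := Submodule.finrank_eq_zero.1 (Nat.le_zero.1 h)
    have : v ∈ Submodule.span ℝ (Λ : Set E) := Submodule.subset_span hv
    rw [h0] at this
    simpa using this
  | succ k ih =>
    obtain ⟨K, hK1, ih⟩ := ih
    refine ⟨1 + 4 * k * K + 4 * K, by nlinarith [(Nat.cast_nonneg k : (0:ℝ) ≤ k)], ?_⟩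
    intro Λ hfin hrank
    by_cases hbot : ∀ v ∈ Λ, v = 0
    · refine ⟨fun _ => 0, fun _ => Λ.zero_mem, fun v hv => ⟨fun _ => 0, by simp [hbot v hv], ?_⟩⟩
      intro i
      simp [hbot v hv]
    push Not at hbot
    obtain ⟨v0, hv0, hv0ne⟩ := hbot
    have hfin' : {v | (v ∈ Λ ∧ ‖v‖ ≤ ‖v0‖) ∧ v ≠ 0}.Finite :=
      (hfin ‖v0‖).subset (fun v hv => hv.1)
    obtain ⟨b0, hb0, hmin⟩ := Set.exists_min_image _ (fun v => ‖v‖) hfin' ⟨v0, ⟨hv0, le_rfl⟩, hv0ne⟩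
    obtain ⟨⟨hb0Λ, hb0v⟩, hb0ne⟩ := hb0
    have hmin' : ∀ v ∈ Λ, v ≠ 0 → ‖b0‖ ≤ ‖v‖ := by
      intro v hv hne
      by_cases h : ‖v‖ ≤ ‖v0‖
      · exact hmin v ⟨⟨hv, h⟩, hne⟩
      · linarith
    have hb0pos : 0 < ‖b0‖ := norm_pos_iff.2 hb0ne
    -- the coefficient functional
    let lam : E →ₗ[ℝ] ℝ := (‖b0‖ ^ 2)⁻¹ • (innerSL ℝ b0 : E →ₗ[ℝ] ℝ)
    have hlam : ∀ v, lam v = (‖b0‖ ^ 2)⁻¹ * inner ℝ b0 v := fun v => rfl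
    have hlam0 : lam b0 = 1 := by
      rw [hlam, real_inner_self_eq_norm_sq]
      field_simp
    have hlamle : ∀ v, |lam v| * ‖b0‖ ≤ ‖v‖ := by
      intro v
      rw [hlam, abs_mul, abs_of_pos (by positivity)]
      have := abs_real_inner_le_norm b0 v
      calc (‖b0‖ ^ 2)⁻¹ * |inner ℝ b0 v| * ‖b0‖ ≤ (‖b0‖ ^ 2)⁻¹ * (‖b0‖ * ‖v‖) * ‖b0‖ := by gcongr
        _ = ‖v‖ := by field_simp
    let π : E →ₗ[ℝ] E := LinearMap.id - lam.smulRight b0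
    have hπ : ∀ v, π v = v - lam v • b0 := fun v => rfl
    have hπ0 : π b0 = 0 := by rw [hπ, hlam0]; simp
    have hπle : ∀ v, ‖π v‖ ≤ 2 * ‖v‖ := by
      intro v
      rw [hπ]
      refine (norm_sub_le _ _).trans ?_
      rw [norm_smul, Real.norm_eq_abs]
      linarith [hlamle v]
    -- rounding
    have hround : ∀ v ∈ Λ, ∃ m : ℤ, v - m • b0 ∈ Λ ∧ ‖v - m • b0‖ ≤ 2 * ‖π v‖ := by
      intro v hv
      refine ⟨round (lam v), Λ.sub_mem hv (Λ.zsmul_mem hb0Λ _), ?_⟩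
      set w := v - (round (lam v)) • b0 with hw
      have hwΛ : w ∈ Λ := Λ.sub_mem hv (Λ.zsmul_mem hb0Λ _)
      by_cases hw0 : w = 0
      · rw [hw0]; simp
      have h1 := hmin' w hwΛ hw0
      have h2 : w = π v + (lam v - round (lam v)) • b0 := by
        rw [hw, hπ, sub_smul, Int.cast_smul_eq_zsmul]; abel
      have h3 : ‖w‖ ≤ ‖π v‖ + 1 / 2 * ‖b0‖ := by
        calc ‖w‖ ≤ ‖π v‖ + ‖(lam v - round (lam v)) • b0‖ := by
              conv_lhs => rw [h2]
              exact norm_add_le _ _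
          _ ≤ _ := by
            rw [norm_smul, Real.norm_eq_abs]
            gcongr
            exact abs_sub_round _
      linarith
    let Λ' : AddSubgroup E := Λ.map (π : E →+ E)
    have hΛ'mem : ∀ w, w ∈ Λ' ↔ ∃ v ∈ Λ, π v = w := fun w => Iff.rfl
    have hf1 : ∀ R : ℝ, {v | v ∈ Λ' ∧ ‖v‖ ≤ R}.Finite := by
      intro R
      apply ((hfin (2 * R)).image π).subset
      rintro w ⟨hw, hwR⟩
      obtain ⟨v, hv, rfl⟩ := (hΛ'mem w).1 hw
      obtain ⟨m, hm, hm2⟩ := hround v hv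
      refine ⟨v - m • b0, ⟨hm, by linarith⟩, ?_⟩
      rw [map_sub, map_zsmul, hπ0]; simp
    have hf2 : Module.finrank ℝ (Submodule.span ℝ (Λ' : Set E)) ≤ k := by
      have hspan : Submodule.span ℝ (Λ' : Set E) = (Submodule.span ℝ (Λ : Set E)).map π := by
        rw [Submodule.map_span]; rfl
      rw [hspan]
      set S := Submodule.span ℝ (Λ : Set E) with hS
      have h1 := LinearMap.finrank_range_add_finrank_ker (π.domRestrict S)
      have h2 : LinearMap.range (π.domRestrict S) = S.map π := by
        rw [LinearMap.range_domRestrict]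
      rw [h2] at h1
      have h3 : 0 < Module.finrank ℝ (LinearMap.ker (π.domRestrict S)) := by
        rw [Module.finrank_pos_iff_exists_ne_zero]
        refine ⟨⟨⟨b0, Submodule.subset_span hb0Λ⟩, ?_⟩, ?_⟩
        · rw [LinearMap.mem_ker]; exact hπ0
        · intro h
          apply hb0ne
          have := congrArg (fun x : LinearMap.ker (π.domRestrict S) => ((x : S) : E)) h
          simpa using this
      omega
    obtain ⟨b', hb', hrep⟩ := ih Λ' hf1 hf2
    choose u huΛ hu using fun i => (hΛ'mem _).1 (hb' i)
    choose m hmΛ hm using fun i => hround (u i) (huΛ i)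
    have hπb : ∀ i, π (u i - m i • b0) = b' i := by
      intro i; rw [map_sub, map_zsmul, hπ0, hu]; simp
    refine ⟨Fin.cons b0 (fun i => u i - m i • b0), ?_, ?_⟩
    · intro i
      refine Fin.cases ?_ (fun i => ?_) i
      · exact hb0Λ
      · exact hmΛ i
    intro v hv
    obtain ⟨c, hc, hcb⟩ := hrep (π v) ((hΛ'mem _).2 ⟨v, hv, rfl⟩)
    set z := v - ∑ i, c i • (u i - m i • b0) with hz
    have hzΛ : z ∈ Λ := Λ.sub_mem hv (Λ.sum_mem fun i _ => Λ.zsmul_mem (hmΛ i) _)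
    have hπz : π z = 0 := by
      rw [hz, map_sub, map_sum]
      simp only [map_zsmul, hπb]
      rw [← hc, sub_self]
    obtain ⟨c0, hc0Λ, hc0⟩ := hround z hzΛ
    rw [hπz, norm_zero, mul_zero] at hc0
    have hz0 : z = c0 • b0 := by
      have := norm_le_zero_iff.1 hc0
      exact sub_eq_zero.1 this
    have hbi : ∀ i, |(c i : ℝ)| * ‖u i - m i • b0‖ ≤ 4 * K * ‖v‖ := by
      intro i
      calc |(c i : ℝ)| * ‖u i - m i • b0‖ ≤ |(c i : ℝ)| * (2 * ‖π (u i)‖) := by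
            gcongr; exact hm i
        _ = 2 * (|(c i : ℝ)| * ‖b' i‖) := by rw [hu]; ring
        _ ≤ 2 * (K * ‖π v‖) := mul_le_mul_of_nonneg_left (hcb i) (by norm_num)
        _ ≤ 2 * (K * (2 * ‖v‖)) := by gcongr; exact hπle v
        _ = _ := by ring
    refine ⟨Fin.cons c0 c, ?_, ?_⟩
    · rw [Fin.sum_univ_succ]
      simp only [Fin.cons_zero, Fin.cons_succ]
      rw [← hz0, hz]; abel
    · intro i
      refine Fin.cases ?_ (fun i => ?_) i
      · simp only [Fin.cons_zero]
        have : |(c0 : ℝ)| * ‖b0‖ = ‖z‖ := by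
          rw [hz0, ← Int.cast_smul_eq_zsmul ℝ, norm_smul, Real.norm_eq_abs]
        rw [this, hz]
        calc _ ≤ ‖v‖ + ‖∑ i, c i • (u i - m i • b0)‖ := norm_sub_le _ _
          _ ≤ ‖v‖ + ∑ i, ‖c i • (u i - m i • b0)‖ := by gcongr; exact norm_sum_le _ _
          _ ≤ ‖v‖ + ∑ i : Fin k, 4 * K * ‖v‖ := by
            gcongr with i
            rw [← Int.cast_smul_eq_zsmul ℝ, norm_smul, Real.norm_eq_abs]
            exact hbi i
          _ = (1 + 4 * k * K) * ‖v‖ := by simp; ring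
          _ ≤ _ := by
            apply mul_le_mul_of_nonneg_right _ (norm_nonneg v)
            linarith
      · simp only [Fin.cons_succ]
        refine (hbi i).trans ?_
        gcongr
        nlinarith [(Nat.cast_nonneg k : (0:ℝ) ≤ k)]

/-- a controlled factorization of profile `a` -/
def CtrlFact {k d r : ℕ} (K n : ℕ) (a : Fin k → ℕ) (b : Fin k → Fin d → ℤ) (c : Fin k → Fin r → ℤ)
    (M : Matrix (Fin d) (Fin r) ℤ) : Prop :=
  (∀ x y, M x y = ∑ i, b i x * c i y) ∧ (∀ i, b i ≠ 0) ∧ (∀ i, 2 ^ a i ≤ K * n) ∧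
  (∀ i x, |b i x| ≤ 2 ^ (a i + 1)) ∧ (∀ i y, |c i y| * 2 ^ a i ≤ K * n)

lemma factor_one {d r : ℕ} (hd : 0 < d) (N : ℕ) (hN : 1 ≤ N) (b : Fin d → ℤ) (c : Fin r → ℤ)
    (h : ∀ x y, |c y| * |b x| ≤ N) :
    ∃ (a : ℕ) (b' : Fin d → ℤ) (c' : Fin r → ℤ), b' ≠ 0 ∧ 2 ^ a ≤ N ∧
      (∀ x, |b' x| ≤ 2 ^ (a + 1)) ∧ (∀ y, |c' y| * 2 ^ a ≤ N) ∧
      ∀ x y, b' x * c' y = b x * c y := by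
  by_cases hb : b ≠ 0 ∧ c ≠ 0
  · obtain ⟨hb, hc⟩ := hb
    obtain ⟨x1, hx1⟩ := Function.ne_iff.1 hb
    obtain ⟨y0, hy0⟩ := Function.ne_iff.1 hc
    obtain ⟨x0, -, hx0⟩ := Finset.exists_max_image Finset.univ (fun x => (b x).natAbs) ⟨x1, Finset.mem_univ _⟩
    have hx0' : (b x0).natAbs ≠ 0 := by
      have := hx0 x1 (Finset.mem_univ _)
      simp only [Pi.zero_apply] at hx1
      omega
    have hlow := Nat.pow_log_le_self 2 hx0'
    have hup := Nat.lt_pow_succ_log_self (b := 2) (by norm_num) (b x0).natAbs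
    set a := Nat.log 2 (b x0).natAbs with ha
    have hlow' : (2 : ℤ) ^ a ≤ |b x0| := by
      rw [Int.abs_eq_natAbs]; exact_mod_cast hlow
    have hcN : ∀ y, |c y| * 2 ^ a ≤ N := by
      intro y
      exact (mul_le_mul_of_nonneg_left hlow' (abs_nonneg _)).trans (h x0 y)
    refine ⟨a, b, c, hb, ?_, ?_, hcN, fun _ _ => rfl⟩
    · have h1 := hcN y0
      have h2 : 1 ≤ |c y0| := Int.one_le_abs hy0
      have : (2 : ℤ) ^ a ≤ N := by
        have : (0 : ℤ) < 2 ^ a := by positivity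
        nlinarith
      exact_mod_cast this
    · intro x
      rw [Int.abs_eq_natAbs]
      have := hx0 x (Finset.mem_univ _)
      exact_mod_cast this.trans hup.le
  · refine ⟨0, fun _ => 1, fun _ => 0, ?_, by simpa using hN, by simp, by simp, ?_⟩
    · intro h0
      have := congrFun h0 ⟨0, hd⟩
      simp at this
    · intro x y
      rw [not_and_or, not_not, not_not] at hb
      rcases hb with hb | hb <;> simp [hb]

lemma exists_factor (d k r : ℕ) (hd : 0 < d) : ∃ K : ℕ, 1 ≤ K ∧ ∀ n : ℕ, 1 ≤ n →
    ∀ M ∈ mats n k (Fin d) (Fin r), ∃ a b c, CtrlFact (k := k) K n a b c M := by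
  obtain ⟨K, hK1, hK⟩ := exists_reduced (E := EuclideanSpace ℝ (Fin d)) k
  have hd1 : (1 : ℝ) ≤ d := by exact_mod_cast hd
  refine ⟨⌈K * d⌉₊, ?_, ?_⟩
  · rw [Nat.one_le_ceil_iff]; positivity
  intro n hn M hM
  obtain ⟨W, hW, hMW⟩ := (rank_le_iff M).1 hM.2
  let Λ : AddSubgroup (EuclideanSpace ℝ (Fin d)) :=
    { carrier := {v | v ∈ W ∧ ∀ i, ∃ m : ℤ, v i = m}
      zero_mem' := ⟨W.zero_mem, fun i => ⟨0, by simp⟩⟩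
      add_mem' := by
        rintro u v ⟨hu, hu'⟩ ⟨hv, hv'⟩
        refine ⟨W.add_mem hu hv, fun i => ?_⟩
        obtain ⟨m, hm⟩ := hu' i
        obtain ⟨m', hm'⟩ := hv' i
        exact ⟨m + m', by simp [hm, hm']⟩
      neg_mem' := by
        rintro u ⟨hu, hu'⟩
        refine ⟨W.neg_mem hu, fun i => ?_⟩
        obtain ⟨m, hm⟩ := hu' i
        exact ⟨-m, by simp [hm]⟩ }
  have hΛ : ∀ v, v ∈ Λ ↔ (v ∈ W ∧ ∀ i, ∃ m : ℤ, v i = m) := fun v => Iff.rfl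
  obtain ⟨b, hbΛ, hb⟩ := hK Λ (by
    intro R
    apply ((Set.finite_Icc (fun _ : Fin d => -⌈R⌉) (fun _ => ⌈R⌉)).image
      (fun m => (WithLp.toLp 2 (fun i => (m i : ℝ)) : EuclideanSpace ℝ (Fin d)))).subset
    rintro v ⟨hv, hvR⟩
    choose m hm using hv.2
    have hmR : ∀ i, |m i| ≤ ⌈R⌉ := by
      intro i
      have h1 : ‖v i‖ ≤ ‖v‖ := PiLp.norm_apply_le v i
      rw [hm, Real.norm_eq_abs] at h1
      have h2 : |(m i : ℝ)| ≤ (⌈R⌉ : ℝ) := h1.trans (hvR.trans (Int.le_ceil R))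
      exact_mod_cast h2
    refine ⟨m, ⟨fun i => (abs_le.1 (hmR i)).1, fun i => (abs_le.1 (hmR i)).2⟩, ?_⟩
    ext i
    simp [hm]) (by
    refine le_trans (Submodule.finrank_mono ?_) hW
    rw [Submodule.span_le]
    intro v hv
    exact hv.1)
  choose B hB using fun i => (hbΛ i).2
  choose c hc hcb using fun y => hb (colv M y) ((hΛ _).2 ⟨hMW y, fun i => ⟨M i y, rfl⟩⟩)
  have hcol : ∀ y, ‖colv M y‖ ≤ d * n := by
    intro y
    rw [EuclideanSpace.norm_eq]
    apply Real.sqrt_le_iff.2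
    refine ⟨by positivity, ?_⟩
    calc ∑ i, ‖colv M y i‖ ^ 2 ≤ ∑ i : Fin d, (n : ℝ) ^ 2 := by
          gcongr with i
          have h := hM.1 i y
          have : colv M y i = (M i y : ℝ) := rfl
          rw [this, Real.norm_eq_abs]
          rw [abs_le]
          have h1 : (1 : ℝ) ≤ M i y := by exact_mod_cast h.1
          have h2 : (M i y : ℝ) ≤ n := by exact_mod_cast h.2
          constructor <;> linarith
      _ = d * (n : ℝ) ^ 2 := by simp
      _ ≤ (d * n) ^ 2 := by
        rw [mul_pow]
        gcongr
        nlinarith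
  have key : ∀ i x y, |c y i| * |B i x| ≤ ((⌈K * d⌉₊ * n : ℕ) : ℤ) := by
    intro i x y
    have h1 := hcb y i
    have h2 : ‖b i x‖ ≤ ‖b i‖ := PiLp.norm_apply_le (b i) x
    rw [hB, Real.norm_eq_abs] at h2
    have h3 : |(c y i : ℝ)| * |(B i x : ℝ)| ≤ ((⌈K * d⌉₊ * n : ℕ) : ℝ) := by
      calc |(c y i : ℝ)| * |(B i x : ℝ)| ≤ |(c y i : ℝ)| * ‖b i‖ := by gcongr
        _ ≤ K * ‖colv M y‖ := h1
        _ ≤ K * (d * n) := by gcongr; exact hcol y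
        _ = K * d * n := by ring
        _ ≤ ⌈K * d⌉₊ * n := by gcongr; exact Nat.le_ceil _
        _ = _ := by push_cast; rfl
    exact_mod_cast h3
  have hN1 : 1 ≤ ⌈K * d⌉₊ * n := by
    have : 1 ≤ ⌈K * d⌉₊ := by rw [Nat.one_le_ceil_iff]; positivity
    exact Nat.mul_pos this hn
  choose a b' c' h1 h2 h3 h4 h5 using fun i =>
    factor_one hd _ hN1 (B i) (fun y => c y i) (fun x y => key i x y)
  refine ⟨a, b', c', ?_, h1, h2, h3, ?_⟩
  · intro x y
    have h6 : ((M x y : ℤ) : ℝ) = ((∑ i, b' i x * c' i y : ℤ) : ℝ) := by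
      have := congrArg (fun v => v x) (hc y)
      have h7 : colv M y x = (M x y : ℝ) := rfl
      simp only [h7] at this
      rw [this]
      push_cast
      simp only [← Int.cast_mul, h5]
      simp [hB, mul_comm]
    exact_mod_cast h6
  · intro i y
    have := h4 i y
    push_cast at this ⊢
    exact this

lemma count_profile {d k r : ℕ} (K n : ℕ) (a : Fin k → ℕ) (p q : Fin k) :
    {M : Matrix (Fin d) (Fin r) ℤ | M ∈ mats n k (Fin d) (Fin r) ∧ ∃ b c, CtrlFact K n a b c M}.ncard * 2 ^ (a q - a p) ≤
    ∏ i, ((2 * 2 ^ (a i + 2) + 1) ^ d * (2 * (2 * K * n / 2 ^ a i) + 1) ^ r) := by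
  classical
  set S := {M : Matrix (Fin d) (Fin r) ℤ | M ∈ mats n k (Fin d) (Fin r) ∧ ∃ b c, CtrlFact K n a b c M} with hS
  have hex : ∀ M : Matrix (Fin d) (Fin r) ℤ, ∃ b c, M ∈ S → CtrlFact K n a b c M := by
    intro M
    by_cases h : M ∈ S
    · obtain ⟨-, b, c, h⟩ := h
      exact ⟨b, c, fun _ => h⟩
    · exact ⟨0, 0, fun h' => absurd h' h⟩
  choose b c hbc using hex
  let P : Finset (Fin k → (Fin d → ℤ) × (Fin r → ℤ)) := Fintype.piFinset fun i =>
    (Fintype.piFinset fun _ : Fin d => Finset.Icc (-(2 ^ (a i + 2) : ℤ)) (2 ^ (a i + 2))) ×ˢ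
    (Fintype.piFinset fun _ : Fin r =>
      Finset.Icc (-((2 * K * n / 2 ^ a i : ℕ) : ℤ)) ((2 * K * n / 2 ^ a i : ℕ) : ℤ))
  have hPcard : P.card =
      ∏ i, ((2 * 2 ^ (a i + 2) + 1) ^ d * (2 * (2 * K * n / 2 ^ a i) + 1) ^ r) := by
    rw [Fintype.card_piFinset]
    apply Finset.prod_congr rfl
    intro i _
    rw [Finset.card_product, Fintype.card_piFinset, Fintype.card_piFinset]
    simp only [Int.card_Icc, Finset.prod_const, Finset.card_univ, Fintype.card_fin]
    congr 2
    · have : ((2 : ℤ) ^ (a i + 2) + 1 - -2 ^ (a i + 2)) = ((2 * 2 ^ (a i + 2) + 1 : ℕ) : ℤ) := by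
        push_cast; ring
      rw [this, Int.toNat_natCast]
    · omega
  rw [← hPcard, ← Set.ncard_coe_finset P]
  have hsrc : S.ncard * 2 ^ (a q - a p) =
      (S ×ˢ ((Finset.range (2 ^ (a q - a p)) : Finset ℕ) : Set ℕ)).ncard := by
    rw [Set.ncard_prod, Set.ncard_coe_finset, Finset.card_range]
  rw [hsrc]
  let b1 : Matrix (Fin d) (Fin r) ℤ → ℕ → Fin k → Fin d → ℤ := fun M u i x =>
    b M i x + if i = q then (u : ℤ) * b M p x else 0
  let c1 : Matrix (Fin d) (Fin r) ℤ → ℕ → Fin k → Fin r → ℤ := fun M u i y =>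
    c M i y - if i = p then (u : ℤ) * c M q y else 0
  have hprod : ∀ M ∈ S, ∀ u < 2 ^ (a q - a p), ∀ x y,
      M x y = ∑ i, b1 M u i x * c1 M u i y := by
    intro M hM u hu x y
    rw [(hbc M hM).1 x y]
    have : ∀ i, b1 M u i x * c1 M u i y = b M i x * c M i y +
      ((if i = q then (u : ℤ) * b M p x * c M i y else 0) -
       (if i = p then b M i x * ((u : ℤ) * c M q y) else 0) -
       (if i = q then (if i = p then (u : ℤ) * b M p x * (u * c M q y) else 0) else 0)) := by
      intro i
      simp only [b1, c1]
      split_ifs <;> ring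
    simp only [this, Finset.sum_add_distrib, Finset.sum_sub_distrib, Finset.sum_ite_eq',
      Finset.mem_univ, if_true]
    split_ifs with hpq
    · subst hpq
      have : u = 0 := by simpa using hu
      subst this
      simp
    · ring
  refine Set.ncard_le_ncard_of_injOn (fun Mu i => (b1 Mu.1 Mu.2 i, c1 Mu.1 Mu.2 i)) ?_ ?_
    (Finset.finite_toSet P)
  · rintro ⟨M, u⟩ ⟨hM, hu⟩
    have hu : u < 2 ^ (a q - a p) := by simpa using hu
    obtain ⟨-, -, -, h4, h5⟩ := hbc M hM
    have hu' : u = 0 ∨ (u ≤ 2 ^ (a q - a p) ∧ a p ≤ a q) := by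
      by_cases h : a p ≤ a q
      · exact Or.inr ⟨hu.le, h⟩
      · left
        rw [Nat.sub_eq_zero_of_le (by omega)] at hu
        omega
    have hupq : u = 0 ∨ (u : ℤ) * 2 ^ a p ≤ 2 ^ a q := by
      rcases hu' with h | ⟨h, h'⟩
      · exact Or.inl h
      · right
        have : u * 2 ^ a p ≤ 2 ^ a q := by
          calc u * 2 ^ a p ≤ 2 ^ (a q - a p) * 2 ^ a p := by gcongr
            _ = 2 ^ a q := by rw [← pow_add, Nat.sub_add_cancel h']
        exact_mod_cast this
    simp only [P, Finset.mem_coe, Finset.mem_product, Fintype.mem_piFinset, Finset.mem_Icc, ← abs_le]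
    intro i
    constructor
    · intro x
      have h6 := h4 i x
      simp only [b1]
      have e1 : (2 : ℤ) ^ (a i + 2) = 2 ^ (a i + 1) + 2 ^ (a i + 1) := by ring
      split_ifs with hi
      · subst hi
        refine (abs_add_le _ _).trans ?_
        rw [e1]
        refine add_le_add h6 ?_
        rcases hupq with h | h
        · simp [h]
        · rw [abs_mul, Nat.abs_cast]
          calc (u : ℤ) * |b M p x| ≤ u * 2 ^ (a p + 1) := by gcongr; exact h4 p x
            _ = (u * 2 ^ a p) * 2 := by ring
            _ ≤ 2 ^ a i * 2 := by gcongr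
            _ = _ := by ring
      · rw [add_zero, e1]
        have : (0 : ℤ) < 2 ^ (a i + 1) := by positivity
        linarith
    · intro y
      have h6 := h5 i y
      have hKn : (0 : ℤ) ≤ K * n := by positivity
      have : |c1 M u i y| * 2 ^ a i ≤ 2 * (K * n) := by
        simp only [c1]
        split_ifs with hi
        · subst hi
          calc _ ≤ (|c M i y| + |(u : ℤ) * c M q y|) * 2 ^ a i := by
                gcongr; exact abs_sub _ _
            _ = |c M i y| * 2 ^ a i + (u * 2 ^ a i) * |c M q y| := by
                rw [abs_mul, Nat.abs_cast]; ring
            _ ≤ K * n + K * n := by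
              refine add_le_add h6 ?_
              rcases hupq with h | h
              · simpa [h] using hKn
              · calc (u * 2 ^ a i) * |c M q y| ≤ 2 ^ a q * |c M q y| := by gcongr
                  _ = |c M q y| * 2 ^ a q := by ring
                  _ ≤ _ := h5 q y
            _ = _ := by ring
        · rw [sub_zero]; linarith
      rw [Int.abs_eq_natAbs] at this ⊢
      have h7 : (c1 M u i y).natAbs ≤ 2 * K * n / 2 ^ a i := by
        rw [Nat.le_div_iff_mul_le (by positivity), mul_assoc]
        exact_mod_cast this
      exact_mod_cast h7
  · rintro ⟨M, u⟩ ⟨hM, hu⟩ ⟨M', u'⟩ ⟨hM', hu'⟩ h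
    have hu : u < 2 ^ (a q - a p) := by simpa using hu
    have hu' : u' < 2 ^ (a q - a p) := by simpa using hu'
    have hb : b1 M u = b1 M' u' := by
      funext i; exact (Prod.ext_iff.1 (congrFun h i)).1
    have hc : c1 M u = c1 M' u' := by
      funext i; exact (Prod.ext_iff.1 (congrFun h i)).2
    have hMM : M = M' := by
      ext x y
      rw [hprod M hM u hu, hprod M' hM' u' hu', hb, hc]
    subst hMM
    obtain ⟨x, hx⟩ := Function.ne_iff.1 ((hbc M hM).2.1 p)
    have := congrFun (congrFun hb q) x
    simp only [b1, if_true] at this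
    have h8 : (u : ℤ) = u' := mul_right_cancel₀ hx (add_left_cancel this)
    have : u = u' := by exact_mod_cast h8
    rw [this]

lemma profile_real {d k r : ℕ} (K n : ℕ) (a : Fin k → ℕ) (p q : Fin k) :
    (({M : Matrix (Fin d) (Fin r) ℤ | M ∈ mats n k (Fin d) (Fin r) ∧ ∃ b c, CtrlFact K n a b c M}.ncard : ℕ) : ℝ) ≤
    (9 ^ d * (5 * K) ^ r) ^ k * (n : ℝ) ^ (k * r) *
      ((∏ i, ((2 : ℝ) ^ a i) ^ d / (2 ^ a i) ^ r) * (1 / 2) ^ (a q - a p)) := by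
  set S := {M : Matrix (Fin d) (Fin r) ℤ | M ∈ mats n k (Fin d) (Fin r) ∧ ∃ b c, CtrlFact K n a b c M} with hS
  by_cases hne : S.Nonempty
  · obtain ⟨M, -, b, c, hf⟩ := hne
    have hle := hf.2.2.1
    have h := count_profile (d := d) (r := r) K n a p q
    rw [← hS] at h
    have h' : (S.ncard : ℝ) * 2 ^ (a q - a p) ≤
        ∏ i, ((2 * 2 ^ (a i + 2) + 1) ^ d * (2 * ((2 * K * n / 2 ^ a i : ℕ) : ℝ) + 1) ^ r) := by
      exact_mod_cast h
    have h2 : ∏ i, ((2 * (2 : ℝ) ^ (a i + 2) + 1) ^ d * (2 * ((2 * K * n / 2 ^ a i : ℕ) : ℝ) + 1) ^ r)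
        ≤ ∏ i, ((9 ^ d * (5 * K) ^ r) * (n : ℝ) ^ r * (((2 : ℝ) ^ a i) ^ d / (2 ^ a i) ^ r)) := by
      apply Finset.prod_le_prod
      · intro i _; positivity
      intro i _
      have e1 : (1 : ℝ) ≤ 2 ^ a i := one_le_pow₀ (by norm_num)
      have e2 : ((2 * K * n / 2 ^ a i : ℕ) : ℝ) ≤ 2 * K * n / 2 ^ a i := by
        refine Nat.cast_div_le.trans ?_
        push_cast; rfl
      have e3 : (2 : ℝ) ^ a i ≤ K * n := by exact_mod_cast hle i
      have e4 : 1 ≤ K * n / (2 : ℝ) ^ a i := by rw [le_div_iff₀ (by positivity)]; linarith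
      calc (2 * (2 : ℝ) ^ (a i + 2) + 1) ^ d * (2 * ((2 * K * n / 2 ^ a i : ℕ) : ℝ) + 1) ^ r
          ≤ (9 * 2 ^ a i) ^ d * (5 * K * n / 2 ^ a i) ^ r := by
            gcongr
            · rw [pow_add]; linarith
            · have : 5 * K * n / (2 : ℝ) ^ a i = 2 * (2 * K * n / 2 ^ a i) + K * n / 2 ^ a i := by ring
              rw [this]; linarith
        _ = _ := by
          rw [mul_pow, div_pow, mul_pow (5 * (K : ℝ))]; ring
    have h3 := h'.trans h2
    rw [Finset.prod_mul_distrib, Finset.prod_const, Finset.card_univ, Fintype.card_fin, mul_pow (_ * _),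
      ← pow_mul, mul_comm r k] at h3
    have e5 : (1 / 2 : ℝ) ^ (a q - a p) * 2 ^ (a q - a p) = 1 := by
      rw [← mul_pow]; norm_num
    calc (S.ncard : ℝ) = (S.ncard : ℝ) * 2 ^ (a q - a p) * (1 / 2) ^ (a q - a p) := by
          rw [mul_assoc, mul_comm (2 ^ _), e5, mul_one]
      _ ≤ _ := mul_le_mul_of_nonneg_right h3 (by positivity)
      _ = _ := by ring
  · rw [Set.not_nonempty_iff_eq_empty.1 hne, Set.ncard_empty]
    simp only [Nat.cast_zero]
    positivity

lemma upper_sum (d k r : ℕ) (hd : 0 < d) : ∃ (K : ℕ) (C : ℝ), 1 ≤ K ∧ 0 < C ∧ ∀ n : ℕ, 1 ≤ n →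
    ∀ f : (Fin k → ℕ) → ℝ,
    (∀ a ∈ Fintype.piFinset (fun _ : Fin k => Finset.range (Nat.log 2 (K * n) + 1)), ∃ p q, (∏ i, ((2 : ℝ) ^ a i) ^ d / (2 ^ a i) ^ r) * (1 / 2) ^ (a q - a p) ≤ f a) →
    ((mats n k (Fin d) (Fin r)).ncard : ℝ) ≤ C * (n : ℝ) ^ (k * r) *
      ∑ a ∈ Fintype.piFinset (fun _ : Fin k => Finset.range (Nat.log 2 (K * n) + 1)), f a := by
  obtain ⟨K, hK1, hK⟩ := exists_factor d k r hd
  refine ⟨K, (9 ^ d * (5 * K) ^ r) ^ k, hK1, by positivity, ?_⟩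
  intro n hn f hf
  set F := Fintype.piFinset (fun _ : Fin k => Finset.range (Nat.log 2 (K * n) + 1)) with hF
  have hsub : mats n k (Fin d) (Fin r) ⊆ ⋃ a ∈ F, {M : Matrix (Fin d) (Fin r) ℤ |
      M ∈ mats n k (Fin d) (Fin r) ∧ ∃ b c, CtrlFact K n a b c M} := by
    intro M hM
    obtain ⟨a, b, c, h⟩ := hK n hn M hM
    simp only [Set.mem_iUnion]
    refine ⟨a, ?_, hM, b, c, h⟩
    rw [hF, Fintype.mem_piFinset]
    intro i
    rw [Finset.mem_range, Nat.lt_succ_iff]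
    exact Nat.le_log_of_pow_le (by norm_num) (h.2.2.1 i)
  have h1 := (Set.ncard_le_ncard hsub (by
    apply (mats_finite n k (Fin d) (Fin r)).subset
    intro M hM
    simp only [Set.mem_iUnion] at hM
    obtain ⟨a, ha, h, -⟩ := hM
    exact h)).trans (Finset.set_ncard_biUnion_le F _)
  have h2 : ((mats n k (Fin d) (Fin r)).ncard : ℝ) ≤ ∑ a ∈ F, (({M : Matrix (Fin d) (Fin r) ℤ |
      M ∈ mats n k (Fin d) (Fin r) ∧ ∃ b c, CtrlFact K n a b c M}.ncard : ℕ) : ℝ) := by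
    exact_mod_cast h1
  refine h2.trans ?_
  rw [Finset.mul_sum]
  apply Finset.sum_le_sum
  intro a ha
  obtain ⟨p, q, hpq⟩ := hf a ha
  refine (profile_real K n a p q).trans ?_
  exact mul_le_mul_of_nonneg_left hpq (by positivity)

lemma geom_sum_bound (ρ : ℝ) (h0 : 0 ≤ ρ) (h1 : ρ < 1) (N : ℕ) :
    ∑ i ∈ Finset.range N, ρ ^ i ≤ 1 / (1 - ρ) := by
  rw [le_div_iff₀ (by linarith), geom_sum_mul_neg]
  have := pow_nonneg h0 N
  linarith

lemma upper_gt (d k r : ℕ) (hd : 0 < d) (hk : 0 < k) (hdr : d < r) : ∃ C : ℝ, 0 < C ∧ ∀ n : ℕ, 1 ≤ n →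
    ((mats n k (Fin d) (Fin r)).ncard : ℝ) ≤ C * (n : ℝ) ^ (k * r) := by
  obtain ⟨K, C, hK, hC, h⟩ := upper_sum d k r hd
  refine ⟨C * 2 ^ k, by positivity, fun n hn => ?_⟩
  refine (h n hn (fun a => ∏ i, (1 / 2) ^ a i) ?_).trans ?_
  · intro a _
    refine ⟨⟨0, hk⟩, ⟨0, hk⟩, ?_⟩
    rw [Nat.sub_self, pow_zero, mul_one]
    apply Finset.prod_le_prod
    · intro i _; positivity
    · intro i _
      have e1 : (1 : ℝ) ≤ 2 ^ a i := one_le_pow₀ (by norm_num)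
      rw [div_le_iff₀ (by positivity), one_div, inv_pow, ← div_eq_inv_mul, le_div_iff₀ (by positivity),
        ← pow_succ]
      exact pow_le_pow_right₀ e1 hdr
  · rw [← Finset.prod_univ_sum]
    rw [mul_right_comm]
    gcongr
    rw [Finset.prod_const, Finset.card_univ, Fintype.card_fin]
    gcongr
    refine (geom_sum_bound (1/2) (by norm_num) (by norm_num) _).trans (by norm_num)

lemma upper_eq (d k : ℕ) (hd : 0 < d) (hk : 0 < k) : ∃ C : ℝ, 0 < C ∧ ∃ N : ℕ, ∀ n : ℕ, N ≤ n →
    ((mats n k (Fin d) (Fin d)).ncard : ℝ) ≤ C * ((n : ℝ) ^ (k * d) * Real.log n) := by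
  obtain ⟨K, C, hK, hC, h⟩ := upper_sum d k d hd
  have hkR : (1 : ℝ) ≤ k := by exact_mod_cast hk
  set ρ : ℝ := 1 - 1 / (2 * k) with hρ
  have hk2 : 1 / (2 * (k : ℝ)) ≤ 1 / 2 := by
    apply one_div_le_one_div_of_le <;> linarith
  have hk3 : 0 < 1 / (2 * (k : ℝ)) := by positivity
  have hρ0 : 0 ≤ ρ := by rw [hρ]; linarith
  have hρ1 : ρ < 1 := by rw [hρ]; linarith
  have hρk : 1 / 2 ≤ ρ ^ k := by
    have := one_add_mul_le_pow (a := -(1 / (2 * (k : ℝ)))) (by linarith) k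
    have e : 1 + (k : ℝ) * -(1 / (2 * k)) = 1 / 2 := by field_simp; norm_num
    rw [e] at this
    simpa [hρ, sub_eq_add_neg] using this
  refine ⟨C * (5 * (2 * k) ^ k), by positivity, max 3 K, fun n hn => ?_⟩
  have hn3 : 3 ≤ n := (le_max_left _ _).trans hn
  have hnK : K ≤ n := (le_max_right _ _).trans hn
  set L := Nat.log 2 (K * n) + 1 with hL
  refine (h n (by omega) (fun a => ∑ m ∈ Finset.range L, ∏ i, if m ≤ a i then ρ ^ (a i - m) else 0) ?_).trans ?_
  · intro a ha
    obtain ⟨p, -, hp⟩ := Finset.exists_min_image Finset.univ a ⟨⟨0, hk⟩, Finset.mem_univ _⟩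
    obtain ⟨q, -, hq⟩ := Finset.exists_max_image Finset.univ a ⟨⟨0, hk⟩, Finset.mem_univ _⟩
    refine ⟨p, q, ?_⟩
    have e1 : (∏ i, ((2 : ℝ) ^ a i) ^ d / (2 ^ a i) ^ d) = 1 := by
      apply Finset.prod_eq_one
      intro i _
      rw [div_self (by positivity)]
    rw [e1, one_mul]
    have hap : a p ∈ Finset.range L := (Fintype.mem_piFinset.1 ha) p
    refine le_trans ?_ (Finset.single_le_sum
      (f := fun m => ∏ i, if m ≤ a i then ρ ^ (a i - m) else 0) ?_ hap)
    · calc (1 / 2 : ℝ) ^ (a q - a p) ≤ (ρ ^ k) ^ (a q - a p) := by gcongr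
        _ = ∏ i : Fin k, ρ ^ (a q - a p) := by
          rw [Finset.prod_const, Finset.card_univ, Fintype.card_fin, ← pow_mul, ← pow_mul, mul_comm]
        _ ≤ ∏ i, if a p ≤ a i then ρ ^ (a i - a p) else 0 := by
          apply Finset.prod_le_prod
          · intro i _; positivity
          · intro i _
            rw [if_pos (hp i (Finset.mem_univ _))]
            apply pow_le_pow_of_le_one hρ0 hρ1.le
            have := hq i (Finset.mem_univ _)
            omega
    · intro m _
      apply Finset.prod_nonneg
      intro i _
      split_ifs <;> positivity
  · rw [Finset.sum_comm]
    have hm : ∀ m ∈ Finset.range L, ∑ a ∈ Fintype.piFinset (fun _ : Fin k => Finset.range L),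
        ∏ i, (if m ≤ a i then ρ ^ (a i - m) else 0) ≤ (2 * (k : ℝ)) ^ k := by
      intro m _
      rw [← Finset.prod_univ_sum (fun _ : Fin k => Finset.range L) (fun _ x => if m ≤ x then ρ ^ (x - m) else 0)]
      rw [Finset.prod_const, Finset.card_univ, Fintype.card_fin]
      gcongr
      have e : 1 / (1 - ρ) = 2 * k := by rw [hρ]; field_simp; norm_num
      rw [← e]
      refine le_trans ?_ (geom_sum_bound ρ hρ0 hρ1 (L - m))
      rw [← Finset.sum_filter]
      have hfil : (Finset.range L).filter (fun x => m ≤ x) = Finset.Ico m L := by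
        ext x; simp [and_comm]
      rw [hfil, Finset.sum_Ico_eq_sum_range]
      simp
    refine (mul_le_mul_of_nonneg_left (Finset.sum_le_sum hm) (by positivity)).trans ?_
    rw [Finset.sum_const, Finset.card_range, nsmul_eq_mul]
    have hlogn : 1 ≤ Real.log n := by
      rw [Real.le_log_iff_exp_le (by positivity)]
      have : (3 : ℝ) ≤ n := by exact_mod_cast hn3
      linarith [Real.exp_one_lt_d9]
    have hLle : (L : ℝ) ≤ 5 * Real.log n := by
      have h1 : ((Nat.log 2 (K * n) : ℕ) : ℝ) ≤ Real.logb 2 ((K * n : ℕ) : ℝ) := Real.natLog_le_logb _ _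
      have hlog2 : (1 : ℝ) / 2 < Real.log 2 := by linarith [Real.log_two_gt_d9]
      have h2 : Real.logb 2 ((K * n : ℕ) : ℝ) ≤ 4 * Real.log n := by
        rw [Real.logb, div_le_iff₀ (by linarith)]
        have : Real.log ((K * n : ℕ) : ℝ) ≤ 2 * Real.log n := by
          push_cast
          rw [Real.log_mul (by positivity) (by positivity)]
          have : Real.log K ≤ Real.log n := Real.log_le_log (by positivity) (by exact_mod_cast hnK)
          linarith
        nlinarith
      rw [hL]; push_cast; linarith
    calc C * (n : ℝ) ^ (k * d) * (L * (2 * k) ^ k) ≤ C * (n : ℝ) ^ (k * d) * (5 * Real.log n * (2 * k) ^ k) := by gcongr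
      _ = _ := by ring

lemma lower_simple (n d k r : ℕ) (hk : 0 < k) (hkd : k ≤ d) :
    n ^ (k * r) ≤ (mats n k (Fin d) (Fin r)).ncard := by
  classical
  let P : Finset (Fin k → Fin r → ℤ) := Fintype.piFinset fun _ => Fintype.piFinset fun _ =>
    Finset.Icc 1 (n : ℤ)
  have hP : P.card = n ^ (k * r) := by
    simp only [P, Fintype.card_piFinset, Finset.prod_const, Int.card_Icc, Finset.card_univ,
      Fintype.card_fin]
    rw [← pow_mul, mul_comm]
    congr 1
    omega
  let f : Fin d → Fin k := fun i => if h : i.1 < k then ⟨i.1, h⟩ else ⟨0, hk⟩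
  rw [← hP, ← Set.ncard_coe_finset]
  refine Set.ncard_le_ncard_of_injOn (fun X => Matrix.of fun i j => X (f i) j) ?_ ?_
    (mats_finite _ _ _ _)
  · intro X hX
    simp only [P, Finset.mem_coe, Fintype.mem_piFinset, Finset.mem_Icc] at hX
    refine ⟨fun i j => hX _ _, ?_⟩
    have : (Matrix.of fun i j => X (f i) j).map (Int.cast : ℤ → ℝ) =
      (Matrix.of fun (i : Fin d) (j : Fin k) => if f i = j then (1 : ℝ) else 0) *
      (Matrix.of fun i j => (X i j : ℝ)) := by
      ext i j
      simp [Matrix.mul_apply]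
    rw [this]
    refine (Matrix.rank_mul_le_left _ _).trans ((Matrix.rank_le_card_width _).trans ?_)
    simp
  · intro X _ X' _ h
    funext i j
    have := congrFun (congrFun h ⟨i.1, by omega⟩) j
    simpa [f] using this

lemma exists_residue (q a s b : ℕ) (hq : 1 ≤ q) (hco : Nat.Coprime q a) :
    ∃ y, b < y ∧ y ≤ b + q ∧ q ∣ a * y + s := by
  have h1 : IsCoprime (q : ℤ) (a : ℤ) := Nat.isCoprime_iff_coprime.2 hco
  obtain ⟨u, v, huv⟩ := h1
  have hq' : (0 : ℤ) < q := by exact_mod_cast hq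
  set z : ℤ := (-(s * v) - (b + 1)) % q with hz
  have hz0 : 0 ≤ z := Int.emod_nonneg _ hq'.ne'
  have hz1 : z < q := Int.emod_lt_of_pos _ hq'
  refine ⟨b + 1 + z.toNat, by omega, by omega, ?_⟩
  have hzd : (q : ℤ) ∣ (-(s * v) - (b + 1)) - z := Int.dvd_self_sub_emod
  obtain ⟨w, hw⟩ := hzd
  have : (q : ℤ) ∣ ((a * (b + 1 + z.toNat) + s : ℕ) : ℤ) := by
    push_cast
    rw [Int.toNat_of_nonneg hz0]
    refine ⟨s * u - a * w, ?_⟩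
    have e : z = (-(s * v) - (b + 1)) - q * w := by linarith
    rw [e]
    linear_combination (-(s : ℤ)) * huv
  exact_mod_cast this

lemma column_count {k' : ℕ} (q ℓ : ℕ) (α base : Fin (k' + 1) → ℕ) (hq : 1 ≤ q)
    (hco : Nat.Coprime q (α 0)) :
    ℓ ^ k' * (ℓ / q) ≤ ((Fintype.piFinset fun i => Finset.Ioc (base i) (base i + ℓ)).filter
      (fun x => q ∣ ∑ i, α i * x i)).card := by
  classical
  let P : Finset ((Fin k' → ℕ) × ℕ) :=
    (Fintype.piFinset fun i : Fin k' => Finset.Ioc (base i.succ) (base i.succ + ℓ)) ×ˢ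
      Finset.range (ℓ / q)
  have hP : P.card = ℓ ^ k' * (ℓ / q) := by
    simp [P, Fintype.card_piFinset]
  rw [← hP]
  choose y hy1 hy2 hy3 using fun s => exists_residue q (α 0) s (base 0) hq hco
  let g : (Fin k' → ℕ) → ℕ := fun x => y (∑ i, α i.succ * x i)
  apply Finset.card_le_card_of_injOn (fun p => Fin.cons (g p.1 + q * p.2) p.1)
  · rintro ⟨x, w⟩ hxw
    simp only [P, Finset.mem_coe, Finset.mem_product, Fintype.mem_piFinset, Finset.mem_range] at hxw
    obtain ⟨hx, hw⟩ := hxw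
    simp only [Finset.coe_filter, Set.mem_ofPred_eq, Fintype.mem_piFinset]
    constructor
    · intro i
      refine Fin.cases ?_ (fun i => ?_) i
      · simp only [Fin.cons_zero, Finset.mem_Ioc]
        have h1 := hy1 (∑ i, α i.succ * x i)
        have h2 := hy2 (∑ i, α i.succ * x i)
        have h3 : q * (w + 1) ≤ ℓ := by
          calc q * (w + 1) ≤ q * (ℓ / q) := by gcongr; omega
            _ ≤ ℓ := Nat.mul_div_le _ _
        rw [mul_add] at h3
        simp only [g]
        constructor
        · omega
        · omega
      · simpa using hx i
    · rw [Fin.sum_univ_succ]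
      simp only [Fin.cons_zero, Fin.cons_succ]
      have := hy3 (∑ i, α i.succ * x i)
      have e : α 0 * (g x + q * w) + ∑ i, α (Fin.succ i) * x i =
        (α 0 * g x + ∑ i, α (Fin.succ i) * x i) + q * (α 0 * w) := by ring
      rw [e]
      exact dvd_add this (dvd_mul_right _ _)
  · rintro ⟨x, w⟩ _ ⟨x', w'⟩ _ h
    simp only at h
    rw [Fin.cons_inj] at h
    obtain ⟨h1, h2⟩ := h
    subst h2
    have : q * w = q * w' := by omega
    rw [Nat.eq_of_mul_eq_mul_left hq this]

/-- representative in `[1,q]` -/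
def rep (q z : ℕ) : ℕ := (z + (q - 1)) % q + 1

lemma rep_pos (q z : ℕ) : 1 ≤ rep q z := Nat.le_add_left _ _

lemma rep_le (q z : ℕ) (hq : 1 ≤ q) : rep q z ≤ q := by
  have := Nat.mod_lt (z + (q - 1)) hq
  unfold rep; omega

lemma rep_modEq (q z : ℕ) (hq : 1 ≤ q) : rep q z ≡ z [MOD q] := by
  unfold rep
  have h1 : (z + (q - 1)) % q + 1 ≡ (z + (q - 1)) + 1 [MOD q] := (Nat.mod_modEq _ _).add_right 1
  have h2 : (z + (q - 1)) + 1 = z + q := by omega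
  rw [h2] at h1
  exact h1.trans (by simp [Nat.ModEq])

/-- the numerators of the graph map -/
def Gm {k e : ℕ} (q : ℕ) (α : Fin k → ℕ) (β : Fin e → ℕ) : Option (Fin e) → Fin k → ℕ
  | none, i => α i
  | some j, i => rep q (β j * α i)

lemma Gm_bounds {k e : ℕ} (q : ℕ) (hq : 1 ≤ q) (α : Fin k → ℕ) (β : Fin e → ℕ)
    (hα : ∀ i, 1 ≤ α i ∧ α i ≤ q) (j) (i) : 1 ≤ Gm q α β j i ∧ Gm q α β j i ≤ q := by
  cases j with
  | none => exact hα i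
  | some j => exact ⟨rep_pos _ _, rep_le _ _ hq⟩

lemma Gm_dvd {k e : ℕ} (q : ℕ) (hq : 1 ≤ q) (α : Fin k → ℕ) (β : Fin e → ℕ) (x : Fin k → ℕ)
    (hx : q ∣ ∑ i, α i * x i) (j) : q ∣ ∑ i, Gm q α β j i * x i := by
  cases j with
  | none => exact hx
  | some j =>
    have h1 : ∑ i, Gm q α β (some j) i * x i ≡ ∑ i, (β j * α i) * x i [MOD q] := by
      apply Nat.ModEq.sum
      intro i _
      exact (rep_modEq q _ hq).mul_right _
    rw [(h1.dvd_iff (dvd_refl q))]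
    have h2 : ∑ i, (β j * α i) * x i = β j * ∑ i, α i * x i := by
      rw [Finset.mul_sum]; apply Finset.sum_congr rfl; intros; ring
    rw [h2]
    exact hx.mul_left _

/-- base points of the boxes -/
def bs {k : ℕ} {τ : Type} (ℓ : ℕ) : (Fin k ⊕ τ) → Fin k → ℕ
  | Sum.inl s, i => if s = i then k * ℓ else 0
  | Sum.inr _, _ => 0

lemma det_inj {k : ℕ} {τ : Type} (ℓ : ℕ) (x : (Fin k ⊕ τ) → Fin k → ℕ)
    (hx : ∀ s i, bs ℓ s i < x s i ∧ x s i ≤ bs ℓ s i + ℓ) (v : Fin k → ℝ)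
    (hv : ∀ s, ∑ i, v i * x (Sum.inl s) i = 0) : v = 0 := by
  classical
  let A : Matrix (Fin k) (Fin k) ℝ := Matrix.of fun s i => (x (Sum.inl s) i : ℝ)
  have hdet : A.det ≠ 0 := by
    apply det_ne_zero_of_sum_row_lt_diag
    intro s
    have h1 : ∑ i ∈ Finset.univ.erase s, ‖A s i‖ ≤ ∑ i ∈ Finset.univ.erase s, (ℓ : ℝ) := by
      apply Finset.sum_le_sum
      intro i hi
      have hne : s ≠ i := (Finset.ne_of_mem_erase hi).symm
      have := (hx (Sum.inl s) i).2
      simp only [bs, if_neg hne, zero_add] at this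
      simp only [A, Matrix.of_apply]
      rw [Real.norm_eq_abs, Nat.abs_cast]
      exact_mod_cast this
    refine h1.trans_lt ?_
    rw [Finset.sum_const, Finset.card_erase_of_mem (Finset.mem_univ _), Finset.card_univ,
      Fintype.card_fin, nsmul_eq_mul]
    have := (hx (Sum.inl s) s).1
    simp only [bs, if_true] at this
    simp only [A, Matrix.of_apply]
    rw [Real.norm_eq_abs, Nat.abs_cast]
    have h2 : (k - 1) * ℓ < x (Sum.inl s) s := by
      refine lt_of_le_of_lt ?_ this
      gcongr
      omega
    exact_mod_cast h2
  apply Matrix.eq_zero_of_mulVec_eq_zero hdet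
  funext s
  simp only [Matrix.mulVec, dotProduct, A, Matrix.of_apply, Pi.zero_apply]
  rw [← hv s]
  apply Finset.sum_congr rfl
  intros; ring

lemma lower_count (k' e ℓ n : ℕ) (hn : 2 * (k' + 1) * ℓ ≤ n) :
    ∑ q ∈ Finset.Icc 1 ℓ, (Nat.totient q * q ^ k' * q ^ e) * (ℓ ^ k' * (ℓ / q)) ^ (k' + 1 + (e + 1)) ≤
    (mats n (k' + 1) (Fin (k' + 1) ⊕ Option (Fin e)) (Fin (k' + 1) ⊕ Option (Fin e))).ncard := by
  classical
  set κ := Fin (k' + 1) ⊕ Option (Fin e) with hκ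
  let A : ℕ → Finset (Fin (k' + 1) → ℕ) := fun q => Fintype.piFinset
    (Fin.cons ((Finset.Ico 1 (1 + q)).filter (fun x => q.Coprime x)) (fun _ => Finset.Ico 1 (1 + q)))
  let Bt : ℕ → Finset (Fin e → ℕ) := fun q => Fintype.piFinset fun _ => Finset.range q
  let Xs : ℕ → (Fin (k' + 1) → ℕ) → Finset (κ → Fin (k' + 1) → ℕ) := fun q α =>
    Fintype.piFinset fun s => (Fintype.piFinset fun i => Finset.Ioc (bs ℓ s i) (bs ℓ s i + ℓ)).filter
      (fun x => q ∣ ∑ i, α i * x i)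
  let P : Finset (Σ _ : ℕ, Σ _ : (Fin (k' + 1) → ℕ) × (Fin e → ℕ), (κ → Fin (k' + 1) → ℕ)) :=
    (Finset.Icc 1 ℓ).sigma fun q => (A q ×ˢ Bt q).sigma fun ab => Xs q ab.1
  have hA : ∀ q, ∀ α ∈ A q, q.Coprime (α 0) ∧ ∀ i, 1 ≤ α i ∧ α i ≤ q := by
    intro q α hα
    have h := Fintype.mem_piFinset.1 hα
    have h0 := h 0
    simp only [Fin.cons_zero, Finset.mem_filter, Finset.mem_Ico] at h0
    refine ⟨h0.2, fun i => ?_⟩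
    refine Fin.cases ?_ (fun i => ?_) i
    · omega
    · have := h i.succ
      simp only [Fin.cons_succ, Finset.mem_Ico] at this
      omega
  have hAcard : ∀ q, (A q).card = Nat.totient q * q ^ k' := by
    intro q
    simp only [A]
    rw [Fintype.card_piFinset, Fin.prod_univ_succ]
    simp only [Fin.cons_zero, Fin.cons_succ]
    rw [Nat.filter_coprime_Ico_eq_totient]
    simp
  have hPcard : ∑ q ∈ Finset.Icc 1 ℓ, (Nat.totient q * q ^ k' * q ^ e) *
      (ℓ ^ k' * (ℓ / q)) ^ (k' + 1 + (e + 1)) ≤ P.card := by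
    simp only [P]
    rw [Finset.card_sigma]
    apply Finset.sum_le_sum
    intro q hq
    have hq1 := (Finset.mem_Icc.1 hq).1
    rw [Finset.card_sigma]
    have hc : (A q ×ˢ Bt q).card = Nat.totient q * q ^ k' * q ^ e := by
      rw [Finset.card_product, hAcard]
      simp [Bt, Fintype.card_piFinset]
    rw [← hc, ← smul_eq_mul]
    apply Finset.card_nsmul_le_sum
    rintro ⟨α, β⟩ hab
    have hα := hA q α (Finset.mem_product.1 hab).1
    simp only [Xs]
    rw [Fintype.card_piFinset]
    have hκc : (Finset.univ : Finset κ).card = k' + 1 + (e + 1) := by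
      simp [hκ]
    rw [← hκc]
    apply Finset.pow_card_le_prod
    intro s _
    exact column_count q ℓ α (bs ℓ s) hq1 hα.1
  refine hPcard.trans ?_
  have hmem : ∀ p ∈ P, 1 ≤ p.1 ∧ (p.1.Coprime (p.2.1.1 0)) ∧ (∀ i, 1 ≤ p.2.1.1 i ∧ p.2.1.1 i ≤ p.1) ∧
      (∀ j, p.2.1.2 j < p.1) ∧ (∀ s i, bs ℓ s i < p.2.2 s i ∧ p.2.2 s i ≤ bs ℓ s i + ℓ) ∧
      ∀ s, p.1 ∣ ∑ i, p.2.1.1 i * p.2.2 s i := by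
    rintro ⟨q, ⟨α, β⟩, x⟩ hp
    simp only [P, Finset.mem_sigma, Finset.mem_product] at hp
    obtain ⟨hq, ⟨hα, hβ⟩, hx⟩ := hp
    have h1 := hA q α hα
    simp only [Bt, Fintype.mem_piFinset, Finset.mem_range] at hβ
    simp only [Xs, Fintype.mem_piFinset, Finset.mem_filter, Finset.mem_Ioc] at hx
    exact ⟨(Finset.mem_Icc.1 hq).1, h1.1, h1.2, hβ, fun s => (hx s).1, fun s => (hx s).2⟩
  rw [← Set.ncard_coe_finset]
  let Mf : (Σ _ : ℕ, Σ _ : (Fin (k' + 1) → ℕ) × (Fin e → ℕ), (κ → Fin (k' + 1) → ℕ)) →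
      Matrix κ κ ℤ := fun p => Matrix.of fun t s => match t with
        | Sum.inl i => (p.2.2 s i : ℤ)
        | Sum.inr j => (((∑ i, Gm p.1 p.2.1.1 p.2.1.2 j i * p.2.2 s i) / p.1 : ℕ) : ℤ)
  have hMl : ∀ p i s, Mf p (Sum.inl i) s = (p.2.2 s i : ℤ) := fun _ _ _ => rfl
  have hMr : ∀ p j s, Mf p (Sum.inr j) s =
    (((∑ i, Gm p.1 p.2.1.1 p.2.1.2 j i * p.2.2 s i) / p.1 : ℕ) : ℤ) := fun _ _ _ => rfl
  have hMr' : ∀ p ∈ P, ∀ j s, (Mf p (Sum.inr j) s : ℝ) =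
    ∑ i, (Gm p.1 p.2.1.1 p.2.1.2 j i : ℝ) / p.1 * p.2.2 s i := by
    intro p hp j s
    obtain ⟨h1, h2, h3, h4, h5, h6⟩ := hmem p hp
    have hd := Gm_dvd p.1 h1 p.2.1.1 p.2.1.2 (p.2.2 s) (h6 s) j
    have hne : (p.1 : ℝ) ≠ 0 := by
      have : p.1 ≠ 0 := by omega
      exact_mod_cast this
    rw [hMr, Int.cast_natCast, Nat.cast_div hd hne]
    push_cast
    rw [Finset.sum_div]
    apply Finset.sum_congr rfl
    intros; ring
  refine Set.ncard_le_ncard_of_injOn Mf ?_ ?_ (mats_finite _ _ _ _)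
  · intro p hp
    obtain ⟨h1, h2, h3, h4, h5, h6⟩ := hmem p hp
    have hsum : ∀ s, ∑ i, p.2.2 s i ≤ n := by
      intro s
      have hb : ∑ i, bs ℓ s i ≤ (k' + 1) * ℓ := by
        cases s with
        | inl s => simp [bs]
        | inr s => simp [bs]
      calc ∑ i, p.2.2 s i ≤ ∑ i, (bs ℓ s i + ℓ) := Finset.sum_le_sum fun i _ => (h5 s i).2
        _ = ∑ i, bs ℓ s i + (k' + 1) * ℓ := by
          rw [Finset.sum_add_distrib]; simp
        _ ≤ (k' + 1) * ℓ + (k' + 1) * ℓ := by gcongr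
        _ = 2 * (k' + 1) * ℓ := by ring
        _ ≤ n := hn
    constructor
    · intro t s
      cases t with
      | inl i =>
        rw [hMl]
        have e1 : p.2.2 s i ≤ ∑ i, p.2.2 s i :=
          Finset.single_le_sum (f := fun i => p.2.2 s i) (fun _ _ => Nat.zero_le _) (Finset.mem_univ i)
        have e2 := hsum s
        have e3 := (h5 s i).1
        constructor <;> omega
      | inr j =>
        rw [hMr]
        have hg := Gm_bounds p.1 h1 p.2.1.1 p.2.1.2 h3 j
        have hd := Gm_dvd p.1 h1 p.2.1.1 p.2.1.2 (p.2.2 s) (h6 s) j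
        have hpos : 0 < ∑ i, Gm p.1 p.2.1.1 p.2.1.2 j i * p.2.2 s i := by
          apply Finset.sum_pos
          · intro i _
            have e3 := (h5 s i).1
            exact Nat.mul_pos (hg i).1 (by omega)
          · exact ⟨0, Finset.mem_univ _⟩
        have e4 : 1 ≤ (∑ i, Gm p.1 p.2.1.1 p.2.1.2 j i * p.2.2 s i) / p.1 :=
          Nat.div_pos (Nat.le_of_dvd hpos hd) h1
        have e5 : (∑ i, Gm p.1 p.2.1.1 p.2.1.2 j i * p.2.2 s i) / p.1 ≤ n := by
          apply Nat.div_le_of_le_mul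
          calc ∑ i, Gm p.1 p.2.1.1 p.2.1.2 j i * p.2.2 s i ≤ ∑ i, p.1 * p.2.2 s i := by
                gcongr with i; exact (hg i).2
            _ = p.1 * ∑ i, p.2.2 s i := by rw [Finset.mul_sum]
            _ ≤ p.1 * n := by gcongr; exact hsum s
        exact ⟨by exact_mod_cast e4, by exact_mod_cast e5⟩
    · let U : Matrix κ (Fin (k' + 1)) ℝ := Matrix.of fun t i => match t with
        | Sum.inl i' => if i' = i then (1 : ℝ) else 0
        | Sum.inr j => (Gm p.1 p.2.1.1 p.2.1.2 j i : ℝ) / p.1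
      have : (Mf p).map (Int.cast : ℤ → ℝ) = U * (Matrix.of fun i s => (p.2.2 s i : ℝ)) := by
        ext t s
        cases t with
        | inl i => simp [Matrix.mul_apply, U, hMl]
        | inr j =>
          rw [Matrix.map_apply, hMr' p hp, Matrix.mul_apply]
          rfl
      rw [this]
      refine (Matrix.rank_mul_le_left _ _).trans ((Matrix.rank_le_card_width _).trans ?_)
      simp
  · intro p hp p' hp' h
    have hR := hMr' p hp
    have hR' := hMr' p' hp'
    obtain ⟨h1, h2, h3, h4, h5, h6⟩ := hmem p hp
    obtain ⟨h1', h2', h3', h4', -, -⟩ := hmem p' hp'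
    have hx : p.2.2 = p'.2.2 := by
      funext s i
      have := congrFun (congrFun h (Sum.inl i)) s
      rw [hMl, hMl] at this
      exact_mod_cast this
    obtain ⟨q, ⟨α, β⟩, x⟩ := p
    obtain ⟨q', ⟨α', β'⟩, x'⟩ := p'
    simp only at hx hR hR' h1 h2 h3 h4 h5 h1' h2' h3' h4'
    subst hx
    have hq0 : (q : ℝ) ≠ 0 := by
      have : q ≠ 0 := by omega
      exact_mod_cast this
    have hq0' : (q' : ℝ) ≠ 0 := by
      have : q' ≠ 0 := by omega
      exact_mod_cast this
    have hG : ∀ j i, q' * Gm q α β j i = q * Gm q' α' β' j i := by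
      intro j i
      have hv := det_inj ℓ x h5 (fun i => (Gm q α β j i : ℝ) / q - (Gm q' α' β' j i : ℝ) / q') (by
        intro s
        simp only [sub_mul, Finset.sum_sub_distrib]
        rw [← hR j (Sum.inl s), ← hR' j (Sum.inl s), h, sub_self])
      have := congrFun hv i
      simp only [Pi.zero_apply] at this
      rw [sub_eq_zero, div_eq_div_iff hq0 hq0'] at this
      have h7 : Gm q α β j i * q' = Gm q' α' β' j i * q := by exact_mod_cast this
      rw [mul_comm, h7, mul_comm]
    have hα0 : q' * α 0 = q * α' 0 := hG none 0
    have hqq : q = q' := by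
      apply Nat.dvd_antisymm
      · exact h2.dvd_of_dvd_mul_right (Dvd.intro _ hα0.symm)
      · exact h2'.dvd_of_dvd_mul_right (Dvd.intro _ hα0)
    subst hqq
    have hαα : α = α' := by
      funext i
      exact Nat.eq_of_mul_eq_mul_left h1 (hG none i)
    subst hαα
    have hββ : β = β' := by
      funext j
      have h8 : rep q (β j * α 0) = rep q (β' j * α 0) := Nat.eq_of_mul_eq_mul_left h1 (hG (some j) 0)
      have h9 : β j * α 0 ≡ β' j * α 0 [MOD q] :=
        (rep_modEq q _ h1).symm.trans (h8 ▸ rep_modEq q _ h1)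
      have h10 := Nat.ModEq.cancel_right_of_coprime h2 h9
      exact Nat.ModEq.eq_of_lt_of_lt h10 (h4 j) (h4' j)
    subst hββ
    rfl

lemma sum_inv_sq_le (ℓ : ℕ) : ∑ m ∈ Finset.Icc 1 ℓ, (1 : ℝ) / (m : ℝ) ^ 2 ≤ 2 := by
  have h : ∀ ℓ : ℕ, ∑ m ∈ Finset.Icc 1 (ℓ + 1), (1 : ℝ) / (m : ℝ) ^ 2 ≤ 2 - 1 / (ℓ + 1) := by
    intro ℓ
    induction ℓ with
    | zero => norm_num
    | succ ℓ ih =>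
      rw [Finset.sum_Icc_succ_top (by omega)]
      have h0 : (0 : ℝ) ≤ ℓ := Nat.cast_nonneg ℓ
      have h : (1 : ℝ) / ((ℓ + 1 + 1 : ℕ) : ℝ) ^ 2 ≤ 1 / (ℓ + 1) - 1 / (((ℓ + 1 : ℕ) : ℝ) + 1) := by
        push_cast
        rw [div_sub_div _ _ (by positivity) (by positivity), div_le_div_iff₀ (by positivity) (by positivity)]
        nlinarith
      linarith
  cases ℓ with
  | zero => norm_num
  | succ ℓ =>
    have h0 : (0 : ℝ) ≤ 1 / (ℓ + 1) := by positivity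
    linarith [h ℓ]

lemma totient_sum (ℓ : ℕ) : Real.log (ℓ + 1) / 2 ≤
    ∑ q ∈ Finset.Icc 1 ℓ, (Nat.totient q : ℝ) / (q : ℝ) ^ 2 := by
  classical
  set T := ∑ q ∈ Finset.Icc 1 ℓ, (Nat.totient q : ℝ) / (q : ℝ) ^ 2 with hT
  have hT0 : 0 ≤ T := Finset.sum_nonneg fun _ _ => by positivity
  have h1 : ∑ N ∈ Finset.Icc 1 ℓ, (1 : ℝ) / N ≤
      T * ∑ m ∈ Finset.Icc 1 ℓ, (1 : ℝ) / (m : ℝ) ^ 2 := by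
    rw [hT, Finset.sum_mul_sum, ← Finset.sum_product']
    have h2 : ∀ N ∈ Finset.Icc 1 ℓ, (1 : ℝ) / N = ∑ p ∈ (Finset.Icc 1 ℓ ×ˢ Finset.Icc 1 ℓ).filter
        (fun p => p.1 * p.2 = N), (Nat.totient p.1 : ℝ) / (p.1 : ℝ) ^ 2 * (1 / (p.2 : ℝ) ^ 2) := by
      intro N hN
      obtain ⟨hN1, hN2⟩ := Finset.mem_Icc.1 hN
      have h3 : (Finset.Icc 1 ℓ ×ˢ Finset.Icc 1 ℓ).filter (fun p => p.1 * p.2 = N) =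
          N.divisorsAntidiagonal := by
        ext ⟨a, b⟩
        simp only [Finset.mem_filter, Finset.mem_product, Finset.mem_Icc, Nat.mem_divisorsAntidiagonal]
        constructor
        · rintro ⟨-, h⟩; exact ⟨h, by omega⟩
        · rintro ⟨h, -⟩
          have ha : a ≠ 0 := by rintro rfl; omega
          have hb : b ≠ 0 := by rintro rfl; omega
          have h5 : a ≤ N := Nat.le_of_dvd (by omega) (Dvd.intro _ h)
          have h6 : b ≤ N := Nat.le_of_dvd (by omega) (Dvd.intro_left _ h)
          exact ⟨⟨⟨by omega, by omega⟩, ⟨by omega, by omega⟩⟩, h⟩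
      rw [h3]
      have h4 : ∀ p ∈ N.divisorsAntidiagonal, (Nat.totient p.1 : ℝ) / (p.1 : ℝ) ^ 2 * (1 / (p.2 : ℝ) ^ 2)
          = (fun a _ => (Nat.totient a : ℝ) / (N : ℝ) ^ 2) p.1 p.2 := by
        intro p hp
        have := (Nat.mem_divisorsAntidiagonal.1 hp).1
        simp only
        rw [← this]
        push_cast
        rw [mul_pow, div_mul_div_comm, mul_one]
      rw [Finset.sum_congr rfl h4, Nat.sum_divisorsAntidiagonal
        (fun a _ => (Nat.totient a : ℝ) / (N : ℝ) ^ 2), ← Finset.sum_div]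
      have h5 : ∑ a ∈ N.divisors, (Nat.totient a : ℝ) = N := by
        exact_mod_cast Nat.sum_totient N
      rw [h5]
      have : (N : ℝ) ≠ 0 := by
        have : N ≠ 0 := by omega
        exact_mod_cast this
      field_simp
    rw [Finset.sum_congr rfl h2]
    apply Finset.sum_fiberwise_le_sum_of_sum_fiber_nonneg
    intro y _
    exact Finset.sum_nonneg fun _ _ => by positivity
  have h2 : Real.log (ℓ + 1) ≤ ∑ N ∈ Finset.Icc 1 ℓ, (1 : ℝ) / N := by
    have := log_add_one_le_harmonic ℓ
    rw [harmonic_eq_sum_Icc] at this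
    push_cast at this
    simpa using this
  have h3 : ∑ m ∈ Finset.Icc 1 ℓ, (1 : ℝ) / (m : ℝ) ^ 2 ≤ 2 := sum_inv_sq_le ℓ
  have h4 := mul_le_mul_of_nonneg_left h3 hT0
  linarith

lemma lower_eq (d k : ℕ) (hk : 0 < k) (hkd : k < d) : ∃ c : ℝ, 0 < c ∧ ∃ N : ℕ, ∀ n : ℕ, N ≤ n →
    c * ((n : ℝ) ^ (k * d) * Real.log n) ≤ ((mats n k (Fin d) (Fin d)).ncard : ℝ) := by
  classical
  obtain ⟨k', rfl⟩ : ∃ k', k = k' + 1 := ⟨k - 1, by omega⟩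
  obtain ⟨e, rfl⟩ : ∃ e, d = k' + 1 + (e + 1) := ⟨d - (k' + 1) - 1, by omega⟩
  set D := k' + 1 + (e + 1) with hD
  set K : ℕ := 2 * (k' + 1) with hK
  have hKpos : 0 < K := by omega
  have hKR : (0 : ℝ) < K := by exact_mod_cast hKpos
  refine ⟨((1 / (2 * K : ℝ)) ^ (k' + 1)) ^ D * (1 / 2) ^ D * (1 / 4), by positivity, max 1 (K ^ 2), fun n hn => ?_⟩
  have hn1 : 1 ≤ n := (le_max_left _ _).trans hn
  have hnK : K ^ 2 ≤ n := (le_max_right _ _).trans hn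
  have hnR : (0 : ℝ) < n := by exact_mod_cast hn1
  set ℓ := n / K with hℓ
  have hKn : K ≤ n := le_trans (by nlinarith) hnK
  have hℓ1 : 1 ≤ ℓ := Nat.div_pos hKn hKpos
  have hcard := lower_count k' e ℓ n (Nat.mul_div_le n K)
  have hre := mats_reindex n (k' + 1)
    (Fintype.equivFinOfCardEq (by simp [hD]) : (Fin (k' + 1) ⊕ Option (Fin e)) ≃ Fin D)
    (Fintype.equivFinOfCardEq (by simp [hD]) : (Fin (k' + 1) ⊕ Option (Fin e)) ≃ Fin D)
  have h1 := hcard.trans hre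
  have h2 : ((∑ q ∈ Finset.Icc 1 ℓ, (Nat.totient q * q ^ k' * q ^ e) * (ℓ ^ k' * (ℓ / q)) ^ D : ℕ) : ℝ) ≤
    ((mats n (k' + 1) (Fin D) (Fin D)).ncard : ℝ) := by exact_mod_cast h1
  refine le_trans ?_ h2
  push_cast
  have hfloor : ∀ a b : ℕ, 1 ≤ b → b ≤ a → (a : ℝ) / (2 * b) ≤ ((a / b : ℕ) : ℝ) := by
    intro a b hb hab
    have h3 : 1 ≤ a / b := Nat.div_pos hab hb
    have h4 : a < b * (a / b + 1) := Nat.lt_mul_div_succ a hb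
    have h5 : (a : ℝ) < b * (((a / b : ℕ) : ℝ) + 1) := by exact_mod_cast h4
    have h6 : (1 : ℝ) ≤ ((a / b : ℕ) : ℝ) := by exact_mod_cast h3
    have hbR : (0 : ℝ) < b := by exact_mod_cast hb
    rw [div_le_iff₀ (by positivity)]
    nlinarith
  have hterm : ∀ q ∈ Finset.Icc 1 ℓ, ((ℓ : ℝ) ^ (k' + 1)) ^ D * (1 / 2) ^ D * ((Nat.totient q : ℝ) / (q : ℝ) ^ 2) ≤
      (Nat.totient q * (q : ℝ) ^ k' * (q : ℝ) ^ e) * ((ℓ : ℝ) ^ k' * ((ℓ / q : ℕ) : ℝ)) ^ D := by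
    intro q hq
    obtain ⟨hq1, hq2⟩ := Finset.mem_Icc.1 hq
    have hqR : (0 : ℝ) < q := by exact_mod_cast hq1
    calc _ = (Nat.totient q * (q : ℝ) ^ k' * (q : ℝ) ^ e) * ((ℓ : ℝ) ^ k' * ((ℓ : ℝ) / (2 * q))) ^ D := by
          have e1 : (ℓ : ℝ) ^ k' * ((ℓ : ℝ) / (2 * q)) = (ℓ : ℝ) ^ (k' + 1) * (1 / 2) * (1 / q) := by
            field_simp
            rw [pow_succ]
          rw [e1, mul_pow, mul_pow _ (1 / 2 : ℝ)]
          have e2 : (q : ℝ) ^ k' * (q : ℝ) ^ e * (1 / q) ^ D = 1 / (q : ℝ) ^ 2 := by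
            rw [hD, one_div, inv_pow]
            field_simp
            ring
          calc _ = ((ℓ : ℝ) ^ (k' + 1)) ^ D * (1 / 2) ^ D * (Nat.totient q * (1 / (q : ℝ) ^ 2)) := by ring
            _ = _ := by rw [← e2]; ring
      _ ≤ _ := by
        gcongr
        exact hfloor ℓ q hq1 hq2
  refine le_trans ?_ (Finset.sum_le_sum hterm)
  rw [← Finset.mul_sum]
  have hℓn : (n : ℝ) / (2 * K) ≤ ℓ := hfloor n K hKpos hKn
  have hlog : Real.log n / 4 ≤ ∑ q ∈ Finset.Icc 1 ℓ, (Nat.totient q : ℝ) / (q : ℝ) ^ 2 := by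
    refine le_trans ?_ (totient_sum ℓ)
    have h3 : (n : ℝ) ≤ ((ℓ : ℝ) + 1) ^ 2 := by
      have h4 : n < K * (ℓ + 1) := Nat.lt_mul_div_succ n hKpos
      have h5 : n ≤ (ℓ + 1) ^ 2 := by
        by_contra hcon
        push Not at hcon
        have h6 : K < ℓ + 1 := by
          by_contra h
          push Not at h
          nlinarith
        nlinarith
      exact_mod_cast h5
    have h4 := Real.log_le_log hnR h3
    rw [Real.log_pow] at h4
    push_cast at h4
    linarith
  have hlog0 : 0 ≤ Real.log n := Real.log_nonneg (by exact_mod_cast hn1)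
  calc _ = ((((n : ℝ) / (2 * K)) ^ (k' + 1)) ^ D) * (1 / 2) ^ D * (Real.log n / 4) := by
        have e3 : (n : ℝ) / (2 * K) = 1 / (2 * K) * n := by ring
        rw [e3, mul_pow (1 / (2 * (K : ℝ))) (n : ℝ), mul_pow ((1 / (2 * (K : ℝ))) ^ (k' + 1)),
          ← pow_mul (n : ℝ)]
        ring
    _ ≤ _ := by gcongr

lemma main_ge (d k r : ℕ) (hk : 0 < k) (hkd : k < d) (hdr : d ≤ r) :
    ∃ c₁ c₂ : ℝ, 0 < c₁ ∧ 0 < c₂ ∧ ∃ N : ℕ, ∀ n ≥ N,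
      c₁ * ldkr d k r n ≤ ((mats n k (Fin d) (Fin r)).ncard : ℝ) ∧
      ((mats n k (Fin d) (Fin r)).ncard : ℝ) ≤ c₂ * ldkr d k r n := by
  rcases hdr.eq_or_lt with rfl | hlt
  · obtain ⟨c, hc, N, h⟩ := lower_eq d k hk hkd
    obtain ⟨C, hC, N', h'⟩ := upper_eq d k (by omega) hk
    refine ⟨c, C, hc, hC, max N N', fun n hn => ?_⟩
    simp only [ldkr, ne_eq, not_true_eq_false, if_false]
    exact ⟨h n ((le_max_left _ _).trans hn), h' n ((le_max_right _ _).trans hn)⟩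
  · obtain ⟨C, hC, h'⟩ := upper_gt d k r (by omega) hk hlt
    refine ⟨1, C, one_pos, hC, 1, fun n hn => ?_⟩
    simp only [ldkr, if_pos hlt.ne', max_eq_left hlt.le]
    refine ⟨?_, h' n hn⟩
    rw [one_mul]
    exact_mod_cast lower_simple n d k r hk hkd.le

theorem linear_degenerate_tuples_count (d k r : ℕ) (hd : 0 < d) (hk : 0 < k) (hr : 0 < r)
    (hkd : k < d) (hkr : k < r) :
    ∃ c₁ c₂ : ℝ, 0 < c₁ ∧ 0 < c₂ ∧ ∃ N : ℕ, ∀ n ≥ N,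
      c₁ * ldkr d k r n ≤ (linDegCount n d k r : ℝ) ∧
      (linDegCount n d k r : ℝ) ≤ c₂ * ldkr d k r n := by
  simp only [linDegCount_eq]
  rcases le_total d r with h | h
  · exact main_ge d k r hk hkd h
  · obtain ⟨c₁, c₂, h1, h2, N, hN⟩ := main_ge r k d hk hkr h
    refine ⟨c₁, c₂, h1, h2, N, fun n hn => ?_⟩
    have e1 : (mats n k (Fin d) (Fin r)).ncard = (mats n k (Fin r) (Fin d)).ncard :=
      le_antisymm (mats_transpose _ _ _ _) (mats_transpose _ _ _ _)
    have e2 : ldkr d k r n = ldkr r k d n := by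
      unfold ldkr
      by_cases hrd : r = d
      · subst hrd; rfl
      · rw [if_pos hrd, if_pos (Ne.symm hrd), max_comm]
    rw [e1, e2]
    exact hN n hn
end
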